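/- Let E = C([0,T];ℝ^d) with the supremum norm and X = L²(0,T;ℝ^d), and let φ : E → ℝ be bounded and Fréchet differentiable with bounded derivative. Then there exists a sequence of functions φ_n : X → ℝ, each bounded and Fréchet differentiable with bounded derivative, such that (i) φ_n(h) → φ(h) as n → ∞ for every h ∈ E (regarded as an element of X), and (ii) Dφ_n(h)(η) → Dφ(h)(η) as n → ∞ for all h, η ∈ E. -/

import Mathlib

open MeasureTheory Filter

attribute [local instance] MeasureTheory.Measure.Subtype.measureSpace

instance icc_volume_finite (c e : ℝ) : IsFiniteMeasure (volume : Measure (Set.Icc c e)) := by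
  constructor
  rw [MeasureTheory.Measure.Subtype.volume_univ measurableSet_Icc.nullMeasurableSet]
  exact measure_Icc_lt_top

namespace ApproxLp

/-- slow square-root profile -/
noncomputable def Psi (x : ℝ) : ℝ := 2 * x / (√(1 + |x|) + 1)

lemma sqrtA_ge (x : ℝ) : 1 ≤ √(1 + |x|) := by
  rw [Real.one_le_sqrt]; linarith [abs_nonneg x]

lemma sqrtA_sq (x : ℝ) : √(1 + |x|) * √(1 + |x|) = 1 + |x| :=
  Real.mul_self_sqrt (by positivity)

lemma Psi_neg (x : ℝ) : Psi (-x) = - Psi x := by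
  simp only [Psi, abs_neg]; ring

lemma Psi_of_nonneg {x : ℝ} (hx : 0 ≤ x) : Psi x = 2 * (√(1 + |x|) - 1) := by
  have h1 := sqrtA_ge x
  have h2 := sqrtA_sq x
  rw [abs_of_nonneg hx] at *
  unfold Psi
  rw [abs_of_nonneg hx, div_eq_iff (by linarith)]
  nlinarith

lemma Psi_abs (x : ℝ) : |Psi x| = 2 * (√(1 + |x|) - 1) := by
  have h1 := sqrtA_ge x
  rcases le_total 0 x with h | h
  · rw [Psi_of_nonneg h, abs_of_nonneg (by linarith)]
  · have := Psi_of_nonneg (x := -x) (by linarith)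
    rw [Psi_neg, abs_neg] at this
    rw [← abs_neg, this, abs_of_nonneg (by linarith)]

lemma Psi_max_pos {x : ℝ} (y : ℝ) (hx : 0 ≤ x) :
    |Psi y - Psi x| ≤ 4 * (1 / √(1 + |x|)) * |y - x| := by
  have hA := sqrtA_ge x
  have hB := sqrtA_ge y
  have hA2 := sqrtA_sq x
  have hB2 := sqrtA_sq y
  have key : |Psi y - Psi x| * √(1 + |x|) ≤ 4 * |y - x| := by
    rcases le_total 0 y with h | h
    · rw [Psi_of_nonneg h, Psi_of_nonneg hx]
      rw [abs_of_nonneg hx, abs_of_nonneg h] at *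
      set A := √(1 + x)
      set B := √(1 + y)
      have : (B - A) * (B + A) = y - x := by nlinarith
      have h3 : |B - A| * (B + A) = |y - x| := by
        rw [← this, abs_mul, abs_of_nonneg (by linarith : 0 ≤ B + A)]
      have h4 : |2 * (B - 1) - 2 * (A - 1)| = 2 * |B - A| := by
        rw [show 2 * (B - 1) - 2 * (A - 1) = 2 * (B - A) by ring, abs_mul]; simp
      rw [h4]
      nlinarith [abs_nonneg (B - A)]
    · have e1 : |Psi y - Psi x| ≤ |Psi y| + |Psi x| := abs_sub _ _
      rw [Psi_abs, Psi_abs] at e1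
      have e2 : |y - x| = |y| + |x| := by
        rw [abs_of_nonneg hx, abs_of_nonpos h, abs_of_nonpos (by linarith)]; ring
      rw [e2]
      set A := √(1 + |x|)
      set B := √(1 + |y|)
      have hx' := abs_nonneg x
      have hy' := abs_nonneg y
      have : |Psi y - Psi x| * A ≤ (2 * (B - 1) + 2 * (A - 1)) * A := by gcongr
      refine this.trans ?_
      rcases le_total A B with hAB | hAB
      · nlinarith
      · nlinarith
  rw [mul_one_div, div_mul_eq_mul_div, le_div_iff₀ (by linarith)]
  exact key

lemma Psi_max (x y : ℝ) : |Psi y - Psi x| ≤ 4 * (1 / √(1 + |x|)) * |y - x| := by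
  rcases le_total 0 x with h | h
  · exact Psi_max_pos y h
  · have := Psi_max_pos (x := -x) (-y) (by linarith)
    rw [Psi_neg, Psi_neg, abs_neg, ← abs_neg] at this
    rw [show |y - x| = |-y - -x| by rw [← abs_neg]; congr 1; ring]
    convert this using 2
    ring

lemma Psi_hasDerivAt (x : ℝ) : HasDerivAt Psi (1 / √(1 + |x|)) x := by
  have hpos : ∀ x : ℝ, 0 < x → HasDerivAt Psi (1 / √(1 + |x|)) x := by
    intro x hx
    have h1 : HasDerivAt (fun y : ℝ => 2 * (√(1 + y) - 1)) (2 * (1 / (2 * √(1 + x)))) x := by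
      have : HasDerivAt (fun y : ℝ => 1 + y) 1 x := (hasDerivAt_id x).const_add 1
      exact ((this.sqrt (by linarith)).sub_const 1).const_mul 2
    rw [abs_of_pos hx]
    have h2 : Psi =ᶠ[nhds x] (fun y : ℝ => 2 * (√(1 + y) - 1)) := by
      filter_upwards [lt_mem_nhds hx] with y hy
      rw [Psi_of_nonneg hy.le, abs_of_pos hy]
    refine (h1.congr_of_eventuallyEq h2).congr_deriv ?_
    have : √(1 + x) ≠ 0 := by positivity
    field_simp
  rcases lt_trichotomy x 0 with h | h | h
  · have h1 := hpos (-x) (by linarith)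
    have h2 := (h1.comp x (hasDerivAt_neg x)).neg
    rw [abs_neg] at h2
    refine (h2.congr_deriv (by ring)).congr_of_eventuallyEq ?_
    filter_upwards with y
    simp [Psi_neg]
  · subst h
    have hc : Continuous (fun x : ℝ => 2 / (√(1 + |x|) + 1)) := by
      refine continuous_const.div (by fun_prop) ?_
      intro x; have := sqrtA_ge x; linarith
    rw [hasDerivAt_iff_tendsto_slope]
    have : Tendsto (fun x : ℝ => 2 / (√(1 + |x|) + 1)) (nhdsWithin 0 {0}ᶜ) (nhds (1 / √(1+|0|))) := by
      have := hc.tendsto 0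
      simp only [abs_zero, add_zero, Real.sqrt_one] at this ⊢
      norm_num at this ⊢
      exact this.mono_left nhdsWithin_le_nhds
    refine this.congr' ?_
    filter_upwards [self_mem_nhdsWithin] with y hy
    have hy : y ≠ 0 := hy
    have := sqrtA_ge y
    simp [slope_def_field, Psi]
    field_simp
  · exact hpos x h

lemma Psi_mul_self_nonneg (x : ℝ) : 0 ≤ Psi x * x := by
  unfold Psi
  have := sqrtA_ge x
  rw [div_mul_eq_mul_div]
  apply div_nonneg <;> nlinarith [mul_self_nonneg x]

noncomputable def Dl (θ t : ℝ) : ℝ := θ * Psi (Real.sin t / θ) * Real.cos t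
noncomputable def fl (θ t : ℝ) : ℝ :=
  1 / √(1 + |Real.sin t / θ|) * Real.cos t ^ 2 - θ * Psi (Real.sin t / θ) * Real.sin t

lemma Dl_hasDerivAt {θ : ℝ} (hθ : 0 < θ) (t : ℝ) : HasDerivAt (Dl θ) (fl θ t) t := by
  have h1 := (Real.hasDerivAt_sin t).div_const θ
  have h2 := (Psi_hasDerivAt (Real.sin t / θ)).comp t h1
  have h3 := (h2.const_mul θ).mul (Real.hasDerivAt_cos t)
  refine h3.congr_deriv ?_
  unfold fl
  simp only [Function.comp]
  field_simp
  ring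

lemma theta_Psi_le {θ v : ℝ} (hθ : 0 < θ) (hv : |v| ≤ 1) : |θ * Psi (v / θ)| ≤ 2 * √θ := by
  rw [abs_mul, abs_of_pos hθ, Psi_abs]
  have h1 := sqrtA_ge (v/θ)
  have h2 := sqrtA_sq (v/θ)
  have h3 : |v / θ| ≤ 1 / θ := by rw [abs_div, abs_of_pos hθ]; gcongr
  have h4 : √(1 + |v/θ|) - 1 ≤ √(1/θ) := by
    apply Real.le_sqrt_of_sq_le
    nlinarith
  have h5 : θ * √(1/θ) = √θ := by
    rw [Real.sqrt_div zero_le_one, Real.sqrt_one]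
    have := Real.mul_self_sqrt hθ.le
    have h : √θ ≠ 0 := by positivity
    field_simp
    nlinarith
  nlinarith

lemma Dl_abs_le {θ : ℝ} (hθ : 0 < θ) (t : ℝ) : |Dl θ t| ≤ 2 * √θ := by
  unfold Dl
  rw [abs_mul]
  have h1 := theta_Psi_le hθ (Real.abs_sin_le_one t)
  have h2 := Real.abs_cos_le_one t
  have h3 := abs_nonneg (Real.cos t)
  have h4 := abs_nonneg (θ * Psi (Real.sin t / θ))
  nlinarith

lemma fl_le_one {θ : ℝ} (hθ : 0 < θ) (t : ℝ) : fl θ t ≤ 1 := by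
  unfold fl
  have h1 := Psi_mul_self_nonneg (Real.sin t / θ)
  have h2 : 0 ≤ θ * Psi (Real.sin t / θ) * Real.sin t := by
    have : θ * Psi (Real.sin t / θ) * Real.sin t = θ^2 * (Psi (Real.sin t / θ) * (Real.sin t/θ)) := by
      field_simp
    rw [this]; positivity
  have h3 : 1 / √(1 + |Real.sin t / θ|) ≤ 1 := by
    have := sqrtA_ge (Real.sin t / θ)
    rw [div_le_one (by linarith)]; exact this
  have h4 : Real.cos t ^ 2 ≤ 1 := Real.cos_sq_le_one t
  have h5 : 0 ≤ 1 / √(1 + |Real.sin t / θ|) := by positivity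
  nlinarith [sq_nonneg (Real.cos t)]

lemma fl_ge {θ : ℝ} (hθ : 0 < θ) (t : ℝ) :
    1 / √(1 + |Real.sin t / θ|) * Real.cos t ^ 2 - 2 * √θ ≤ fl θ t := by
  unfold fl
  have h1 := theta_Psi_le hθ (Real.abs_sin_le_one t)
  have h2 : |θ * Psi (Real.sin t / θ) * Real.sin t| ≤ 2 * √θ := by
    rw [abs_mul]
    have h2 := Real.abs_sin_le_one t
    have h3 := abs_nonneg (Real.sin t)
    have h4 := abs_nonneg (θ * Psi (Real.sin t / θ))
    nlinarith
  linarith [le_abs_self (θ * Psi (Real.sin t / θ) * Real.sin t)]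

lemma fl_ge' {θ : ℝ} (hθ : 0 < θ) (t : ℝ) : - (2 * √θ) ≤ fl θ t := by
  have := fl_ge hθ t
  have h5 : 0 ≤ 1 / √(1 + |Real.sin t / θ|) * Real.cos t ^ 2 := by positivity
  linarith

lemma fl_zone {θ c : ℝ} (hθ : 0 < θ) (hc : 0 < c) (hb : 2 * √θ < c) :
    ∃ z, 0 < z ∧ ∀ t, |Real.sin t| < z → 1 - c ≤ fl θ t := by
  have hcont : Continuous (fun v : ℝ => 1 / √(1 + |v / θ|) * (1 - v^2)) := by
    refine (continuous_const.div (by fun_prop) ?_).mul (by fun_prop)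
    intro x; have := sqrtA_ge (x/θ); linarith
  have h0 := hcont.tendsto 0
  simp at h0
  have := h0 (lt_mem_nhds (show 1 - (c - 2*√θ) < 1 by linarith))
  rw [mem_map, Metric.mem_nhds_iff] at this
  obtain ⟨z, hz, hsub⟩ := this
  refine ⟨z, hz, fun t ht => ?_⟩
  have h1 : Real.sin t ∈ Metric.ball (0:ℝ) z := by simpa using ht
  have h2 := hsub h1
  simp only [Set.mem_preimage, Set.mem_setOf_eq] at h2
  have h3 := fl_ge hθ t
  rw [Real.cos_sq'] at h3
  simp only [one_div] at h3
  linarith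

/-- maximal inequality -/
lemma Dl_max {θ : ℝ} (hθ : 0 < θ) (t t' : ℝ) :
    |Dl θ t' - Dl θ t| ≤ (30 * √θ + 8 * max 0 (fl θ t)) * |t' - t| := by
  set P := 1 / √(1 + |Real.sin t / θ|) with hP
  have hP0 : 0 ≤ P := by positivity
  have hP1 : P ≤ 1 := by
    have := sqrtA_ge (Real.sin t / θ)
    rw [hP, div_le_one (by linarith)]; exact this
  have hsq : 0 ≤ √θ := Real.sqrt_nonneg _
  have e1 : Dl θ t' - Dl θ t = θ * (Psi (Real.sin t'/θ) - Psi (Real.sin t/θ)) * Real.cos t +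
      θ * Psi (Real.sin t'/θ) * (Real.cos t' - Real.cos t) := by unfold Dl; ring
  have hsin : |Real.sin t' - Real.sin t| ≤ |t' - t| := by
    have := Real.lipschitzWith_sin.dist_le_mul t' t
    simpa [Real.dist_eq] using this
  have hcos : |Real.cos t' - Real.cos t| ≤ |t' - t| := by
    have := Real.lipschitzWith_cos.dist_le_mul t' t
    simpa [Real.dist_eq] using this
  have h1 : |θ * (Psi (Real.sin t'/θ) - Psi (Real.sin t/θ))| ≤ 4 * P * |t' - t| := by
    rw [abs_mul, abs_of_pos hθ]
    have := Psi_max (Real.sin t/θ) (Real.sin t'/θ)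
    rw [← hP, ← sub_div, abs_div, abs_of_pos hθ] at this
    calc θ * _ ≤ θ * (4 * P * (|Real.sin t' - Real.sin t| / θ)) := by gcongr
      _ = 4 * P * |Real.sin t' - Real.sin t| := by field_simp
      _ ≤ _ := by gcongr
  have h2 := theta_Psi_le hθ (Real.abs_sin_le_one t')
  have h3 : |Dl θ t' - Dl θ t| ≤ (4 * P * |Real.cos t| + 2 * √θ) * |t' - t| := by
    rw [e1]
    refine (abs_add_le _ _).trans ?_
    rw [abs_mul, abs_mul (θ * Psi _)]
    have a1 : |θ * (Psi (Real.sin t' / θ) - Psi (Real.sin t / θ))| * |Real.cos t| ≤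
      4 * P * |t' - t| * |Real.cos t| := by gcongr
    have a2 : |θ * Psi (Real.sin t' / θ)| * |Real.cos t' - Real.cos t| ≤ 2 * √θ * |t' - t| := by gcongr
    linarith
  refine h3.trans ?_
  gcongr ?_ * _
  have hf := fl_ge hθ t
  rw [← hP] at hf
  have hc1 := Real.abs_cos_le_one t
  have hc0 := abs_nonneg (Real.cos t)
  have hcs := Real.sin_sq_add_cos_sq t
  rw [← sq_abs (Real.cos t)] at hf hcs
  have hm1 := le_max_left 0 (fl θ t)
  have hm2 := le_max_right 0 (fl θ t)
  rcases le_total (1/2) |Real.cos t| with h | h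
  · have : P * |Real.cos t| ≤ 2 * (P * |Real.cos t|^2) := by nlinarith [mul_nonneg hP0 hc0]
    nlinarith
  · have hs : 1/2 ≤ |Real.sin t| := by
      by_contra hh
      push Not at hh
      have := abs_nonneg (Real.sin t)
      rw [← sq_abs (Real.sin t)] at hcs
      nlinarith
    have hP2 : P ≤ 2 * √θ := by
      rw [hP, abs_div, abs_of_pos hθ]
      rw [div_le_iff₀ (by positivity)]
      have : (1/2)^2 ≤ θ * (1 + |Real.sin t|/θ) := by
        have : θ * (1 + |Real.sin t|/θ) = θ + |Real.sin t| := by field_simp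
        rw [this]; linarith
      have := Real.le_sqrt_of_sq_le this
      rw [Real.sqrt_mul hθ.le] at this
      linarith
    nlinarith

lemma exists_theta (b : ℝ) (hb : 0 < b) : ∃ θ : ℝ, 0 < θ ∧ 30 * √θ = b := by
  refine ⟨(b/30)^2, by positivity, ?_⟩
  rw [Real.sqrt_sq (by positivity)]; ring

/-- 1-D flattener data -/
lemma exists_Dl (b c : ℝ) (hb : 0 < b) (hc : 0 < c) : ∃ (D f : ℝ → ℝ) (z : ℝ), 0 < z ∧
    (∀ t, HasDerivAt D (f t) t) ∧ (∀ t, |D t| ≤ b) ∧ (∀ t, -b ≤ f t) ∧ (∀ t, f t ≤ 1) ∧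
    (∀ t, |Real.sin t| < z → 1 - c ≤ f t) ∧
    (∀ t t', |D t' - D t| ≤ (b + 8 * max 0 (f t)) * |t' - t|) := by
  obtain ⟨θ, hθ, h⟩ := exists_theta (min b c) (lt_min hb hc)
  have hs : 0 < √θ := Real.sqrt_pos.2 hθ
  have h1 := min_le_left b c
  have h2 := min_le_right b c
  obtain ⟨z, hz, hzz⟩ := fl_zone hθ hc (by linarith)
  refine ⟨Dl θ, fl θ, z, hz, Dl_hasDerivAt hθ, fun t => (Dl_abs_le hθ t).trans (by linarith),
    fun t => le_trans (by linarith) (fl_ge' hθ t), fl_le_one hθ, hzz, fun t t' => ?_⟩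
  refine (Dl_max hθ t t').trans ?_
  gcongr
  linarith

/-- stair function -/
lemma exists_stair (a : ℝ) (ha : 0 < a) : ∃ S S' : ℝ → ℝ, (∀ t, HasDerivAt S (S' t) t) ∧
    (∃ K, ∀ t, |S' t| ≤ K) ∧ (∀ t, |S t - t| ≤ Real.pi) ∧ (∀ t, S' t ≠ 0 → |Real.sin t| < a) := by
  set ρ : ℝ → ℝ := fun t => max 0 (1 - |Real.sin t| / a) with hρ
  have hρc : Continuous ρ := by fun_prop
  have hρ0 : ∀ t, 0 ≤ ρ t := fun t => le_max_left _ _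
  have hρ1 : ∀ t, ρ t ≤ 1 := fun t => by
    apply max_le zero_le_one; have : 0 ≤ |Real.sin t| / a := by positivity
    linarith
  have hper : Function.Periodic ρ Real.pi := by
    intro t; simp [hρ, Real.sin_add_pi]
  set I := ∫ s in (0:ℝ)..Real.pi, ρ s with hI
  have hIpos : 0 < I := by
    apply intervalIntegral.integral_pos Real.pi_pos hρc.continuousOn (fun x _ => hρ0 x)
    exact ⟨0, ⟨le_rfl, Real.pi_pos.le⟩, by simp [hρ]⟩
  set S : ℝ → ℝ := fun t => Real.pi / I * ∫ s in (0:ℝ)..t, ρ s with hS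
  have hmono : Monotone S := by
    intro x y hxy
    simp only [hS]
    have : 0 ≤ ∫ s in x..y, ρ s := intervalIntegral.integral_nonneg hxy (fun u _ => hρ0 u)
    have h2 := intervalIntegral.integral_add_adjacent_intervals (hρc.intervalIntegrable (μ := volume) 0 x)
      (hρc.intervalIntegrable x y)
    have : 0 < Real.pi / I := div_pos Real.pi_pos hIpos
    apply mul_le_mul_of_nonneg_left _ this.le
    linarith
  have hshift : ∀ t, S (t + Real.pi) = S t + Real.pi := by
    intro t
    simp only [hS]
    have h2 := intervalIntegral.integral_add_adjacent_intervals (hρc.intervalIntegrable (μ := volume) 0 t)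
      (hρc.intervalIntegrable t (t+Real.pi))
    have h3 := hper.intervalIntegral_add_eq t 0
    rw [zero_add] at h3
    rw [← h2, h3, ← hI]
    field_simp
  have hdiffper : Function.Periodic (fun t => S t - t) Real.pi := by
    intro t; simp only [hshift]; ring
  refine ⟨S, fun t => Real.pi / I * ρ t, fun t => ?_, ⟨Real.pi / I, fun t => ?_⟩, fun t => ?_, fun t ht => ?_⟩
  · exact ((hρc.integral_hasStrictDerivAt 0 t).hasDerivAt).const_mul _
  · have : 0 < Real.pi / I := div_pos Real.pi_pos hIpos
    rw [abs_mul, abs_of_pos this, abs_of_nonneg (hρ0 t)]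
    nlinarith [hρ1 t]
  · obtain ⟨y, hy, hyt⟩ := hdiffper.exists_mem_Ico₀ Real.pi_pos t
    have hyt : S t - t = S y - y := hyt
    rw [hyt]
    have h0 : S 0 = 0 := by simp [hS]
    have h1 : S Real.pi = Real.pi := by have := hshift 0; rw [zero_add, h0, zero_add] at this; exact this
    have h2 := hmono hy.1
    have h3 := hmono hy.2.le
    rw [abs_le]
    have := hy.1
    have := hy.2
    constructor <;> linarith
  · by_contra h
    push Not at h
    apply ht
    have : ρ t = 0 := by
      simp only [hρ]; apply max_eq_left
      have : 1 ≤ |Real.sin t| / a := by rw [le_div_iff₀ ha]; linarith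
      linarith
    simp [this]
end ApproxLp


namespace ApproxLp

noncomputable def mf (η σ : ℝ) : ℝ := Real.cos σ / (Real.cos σ ^ 2 + η ^ 2)
noncomputable def mf' (η σ : ℝ) : ℝ :=
  - Real.sin σ * (η ^ 2 - Real.cos σ ^ 2) / (Real.cos σ ^ 2 + η ^ 2) ^ 2

lemma mf_hasDerivAt {η : ℝ} (hη : 0 < η) (σ : ℝ) : HasDerivAt (mf η) (mf' η σ) σ := by
  have hp : Real.cos σ ^ 2 + η ^ 2 ≠ 0 := by positivity
  have h1 := Real.hasDerivAt_cos σ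
  have h2 := h1.div ((h1.pow 2).add_const (η^2)) hp
  refine h2.congr_deriv ?_
  unfold mf'
  congr 1
  push_cast
  simp only [pow_one, Pi.pow_apply]
  ring

lemma mf'_le {η : ℝ} (hη : 0 < η) (σ : ℝ) : |mf' η σ| ≤ 1 / η ^ 2 := by
  unfold mf'
  have hp : 0 < Real.cos σ ^ 2 + η ^ 2 := by positivity
  rw [abs_div, abs_of_pos (by positivity : 0 < (Real.cos σ ^ 2 + η ^ 2) ^ 2), abs_mul, abs_neg]
  have h1 : |η ^ 2 - Real.cos σ ^ 2| ≤ Real.cos σ ^ 2 + η ^ 2 := by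
    rw [abs_le]; constructor <;> nlinarith [sq_nonneg (Real.cos σ), sq_nonneg η]
  have h2 := Real.abs_sin_le_one σ
  rw [div_le_div_iff₀ (by positivity) (by positivity)]
  have h3 : |Real.sin σ| * |η ^ 2 - Real.cos σ ^ 2| ≤ 1 * (Real.cos σ ^ 2 + η ^ 2) := by gcongr
  have h4 : η ^ 2 ≤ Real.cos σ ^ 2 + η ^ 2 := by nlinarith [sq_nonneg (Real.cos σ)]
  calc _ ≤ 1 * (Real.cos σ ^ 2 + η ^ 2) * (Real.cos σ ^ 2 + η ^ 2) := by gcongr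
    _ = _ := by ring

lemma mf_le {η : ℝ} (hη : 0 < η) (σ : ℝ) : |mf η σ| ≤ 1 / (2 * η) := by
  unfold mf
  have hp : 0 < Real.cos σ ^ 2 + η ^ 2 := by positivity
  rw [abs_div, abs_of_pos hp, div_le_div_iff₀ hp (by positivity), ← sq_abs (Real.cos σ)]
  nlinarith [sq_nonneg (|Real.cos σ| - η)]

lemma mf_lip {η : ℝ} (hη : 0 < η) (σ σ' : ℝ) : |mf η σ' - mf η σ| ≤ 1 / η ^ 2 * |σ' - σ| := by
  have := Convex.norm_image_sub_le_of_norm_hasDerivWithin_le (f := mf η) (f' := mf' η)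
    (s := Set.univ) (C := 1/η^2) (x := σ) (y := σ')
    (fun x _ => (mf_hasDerivAt hη x).hasDerivWithinAt) (fun x _ => mf'_le hη x) convex_univ
    trivial trivial
  simpa using this

lemma sin_diff (σ σ' : ℝ) :
    |Real.sin σ' - Real.sin σ| ≤ (|Real.cos σ| + |σ' - σ|) * |σ' - σ| := by
  rw [Real.sin_sub_sin, abs_mul, abs_mul]
  have h1 : |Real.sin ((σ' - σ)/2)| ≤ |σ' - σ| / 2 := by
    have := Real.abs_sin_le_abs (x := (σ' - σ)/2)
    rwa [abs_div, abs_two] at this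
  have h2 : |Real.cos ((σ' + σ)/2)| ≤ |Real.cos σ| + |σ' - σ| := by
    have := Real.lipschitzWith_cos.dist_le_mul ((σ'+σ)/2) σ
    simp only [Real.dist_eq, NNReal.coe_one, one_mul] at this
    rw [show (σ' + σ)/2 - σ = (σ' - σ)/2 by ring, abs_div, abs_two] at this
    have h3 := abs_sub_abs_le_abs_sub (Real.cos ((σ'+σ)/2)) (Real.cos σ)
    linarith [abs_nonneg (σ' - σ)]
  rw [abs_two]
  have : |Real.sin ((σ' - σ)/2)| * |Real.cos ((σ' + σ)/2)| ≤ (|σ' - σ| / 2) * (|Real.cos σ| + |σ' - σ|) := by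
    gcongr
  nlinarith

lemma exists_F (a δ η : ℝ) (ha : 0 < a) (hδ : 0 < δ) (hη : 0 < η) :
    ∃ (F Fω Fs : ℝ → ℝ → ℝ) (z : ℝ), 0 < z ∧
    (∀ v : ℝ × ℝ, HasFDerivAt (fun v : ℝ × ℝ => F v.1 v.2)
      (Fω v.1 v.2 • ContinuousLinearMap.fst ℝ ℝ ℝ + Fs v.1 v.2 • ContinuousLinearMap.snd ℝ ℝ ℝ) v) ∧
    (∀ ω σ, |F ω σ - σ| ≤ δ) ∧ (∃ B, ∀ ω σ, |Fω ω σ| ≤ B) ∧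
    (∀ ω σ, -δ ≤ Fs ω σ) ∧ (∀ ω σ, Fs ω σ ≤ 1 + δ) ∧
    (∀ ω σ σ', |F ω σ' - F ω σ - (σ' - σ)| ≤ (δ + 8 * max 0 (1 - Fs ω σ)) * |σ' - σ|) ∧
    (∀ ω σ, |Real.sin (ω + a * Real.sin σ)| < z →
      Fs ω σ ≤ 1 + δ - Real.cos σ ^ 2 / (Real.cos σ ^ 2 + η ^ 2) * (1 - δ)) := by
  set x₀ := η * δ / 9 with hx₀
  have hx₀p : 0 < x₀ := by positivity
  obtain ⟨b, hb, hb1, hb2, hb3, hb4, hb5⟩ : ∃ b : ℝ, 0 < b ∧ b ≤ 1 ∧ b ≤ δ/4 ∧ b / (a * η^2) ≤ δ/36 ∧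
      b / (a * η * x₀) ≤ δ/2 ∧ b / (2 * a * η) ≤ δ := by
    refine ⟨min 1 (min (δ/4) (min (δ/36 * (a * η^2)) (min (δ/2 * (a * η * x₀)) (δ * (2 * a * η))))), ?_, ?_, ?_, ?_, ?_, ?_⟩
    · refine lt_min one_pos (lt_min ?_ (lt_min ?_ (lt_min ?_ ?_))) <;> positivity
    · exact min_le_left _ _
    · exact (min_le_right _ _).trans (min_le_left _ _)
    · rw [div_le_iff₀ (by positivity)]
      exact (min_le_right _ _).trans ((min_le_right _ _).trans (min_le_left _ _))
    · rw [div_le_iff₀ (by positivity)]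
      exact (min_le_right _ _).trans ((min_le_right _ _).trans ((min_le_right _ _).trans (min_le_left _ _)))
    · rw [div_le_iff₀ (by positivity)]
      exact (min_le_right _ _).trans ((min_le_right _ _).trans ((min_le_right _ _).trans (min_le_right _ _)))
  obtain ⟨D, f, z, hz, hD, hDb, hfl, hfu, hfz, hmax⟩ := exists_Dl b δ hb hδ
  set g : ℝ → ℝ := fun σ => Real.cos σ ^ 2 / (Real.cos σ ^ 2 + η ^ 2) with hg
  have hg0 : ∀ σ, 0 ≤ g σ := fun σ => by positivity
  have hg1 : ∀ σ, g σ ≤ 1 := fun σ => by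
    simp only [hg]; rw [div_le_one (by positivity)]; nlinarith [sq_nonneg η]
  have hmg : ∀ σ, mf η σ * Real.cos σ = g σ := fun σ => by simp only [mf, hg]; ring
  have hmg' : ∀ σ, |mf η σ| * |Real.cos σ| = g σ := fun σ => by
    rw [← abs_mul, hmg, abs_of_nonneg (hg0 σ)]
  -- small term
  have hsm : ∀ ω σ, |1 / a * mf' η σ * D (ω + a * Real.sin σ)| ≤ δ/36 := by
    intro ω σ
    refine le_trans ?_ hb3
    rw [abs_mul, abs_mul, abs_of_pos (by positivity : 0 < 1/a)]
    calc _ ≤ 1 / a * (1/η^2) * b := by gcongr; exact mf'_le hη σ; exact hDb _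
      _ = _ := by field_simp
  have hmax1 : ∀ t, max 0 (f t) ≤ 1 := fun t => max_le zero_le_one (hfu t)
  refine ⟨fun ω σ => σ - 1 / a * (mf η σ * D (ω + a * Real.sin σ)),
    fun ω σ => - (1 / a * (mf η σ * f (ω + a * Real.sin σ))),
    fun ω σ => 1 - 1 / a * mf' η σ * D (ω + a * Real.sin σ) - g σ * f (ω + a * Real.sin σ),
    z, hz, ?_, ?_, ?_, ?_, ?_, ?_, ?_⟩
  · intro v
    have h1 : HasFDerivAt (fun v : ℝ × ℝ => v.1) (ContinuousLinearMap.fst ℝ ℝ ℝ) v := hasFDerivAt_fst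
    have h2 : HasFDerivAt (fun v : ℝ × ℝ => v.2) (ContinuousLinearMap.snd ℝ ℝ ℝ) v := hasFDerivAt_snd
    have h3 := h1.add ((HasDerivAt.comp_hasFDerivAt v (Real.hasDerivAt_sin v.2) h2).const_mul a)
    have h4 := HasDerivAt.comp_hasFDerivAt v (hD (v.1 + a * Real.sin v.2)) h3
    have h5 := HasDerivAt.comp_hasFDerivAt v (mf_hasDerivAt hη v.2) h2
    have h6 := h2.sub ((h5.mul h4).const_mul (1/a))
    refine h6.congr_fderiv ?_
    ext
    · simp
    · simp [← hmg]
      field_simp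
      ring
  · intro ω σ
    refine le_trans ?_ hb5
    simp only [sub_sub_cancel_left, abs_neg]
    rw [abs_mul, abs_mul, abs_of_pos (by positivity : 0 < 1/a)]
    calc _ ≤ 1 / a * (1/(2 * η) * b) := by gcongr; exact mf_le hη σ; exact hDb _
      _ = _ := by field_simp
  · refine ⟨1 / a * (1/(2 * η) * (1 + b)), fun ω σ => ?_⟩
    rw [abs_neg, abs_mul, abs_mul, abs_of_pos (by positivity : 0 < 1/a)]
    gcongr
    · exact mf_le hη σ
    · rw [abs_le]; constructor <;> linarith [hfl (ω + a * Real.sin σ), hfu (ω + a * Real.sin σ)]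
  · intro ω σ
    have := (abs_le.1 (hsm ω σ)).2
    have h2 : g σ * f (ω + a * Real.sin σ) ≤ 1 := by nlinarith [hg0 σ, hg1 σ, hfu (ω + a * Real.sin σ)]
    simp only
    linarith
  · intro ω σ
    have := (abs_le.1 (hsm ω σ)).1
    have h2 : -b ≤ g σ * f (ω + a * Real.sin σ) := by nlinarith [hg0 σ, hg1 σ, hfl (ω + a * Real.sin σ)]
    simp only
    linarith
  · intro ω σ σ'
    set w := ω + a * Real.sin σ with hw
    set w' := ω + a * Real.sin σ' with hw'
    set d := |σ' - σ| with hd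
    have hd0 : 0 ≤ d := abs_nonneg _
    have hsm1 := abs_le.1 (hsm ω σ)
    rw [← hw] at hsm1
    have hgf : g σ * max 0 (f w) ≤ max 0 (1 - (1 - 1 / a * mf' η σ * D w - g σ * f w)) + δ/36 := by
      rcases le_total 0 (f w) with h | h
      · rw [max_eq_right h]
        have := le_max_right 0 (1 - (1 - 1 / a * mf' η σ * D w - g σ * f w))
        linarith
      · rw [max_eq_left h]
        have := le_max_left 0 (1 - (1 - 1 / a * mf' η σ * D w - g σ * f w))
        linarith
    set Mx := max 0 (1 - (1 - 1 / a * mf' η σ * D w - g σ * f w)) with hMx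
    have hMx0 : 0 ≤ Mx := le_max_left _ _
    have e1 : σ' - 1 / a * (mf η σ' * D w') - (σ - 1 / a * (mf η σ * D w)) - (σ' - σ) =
       - (1 / a * (mf η σ' - mf η σ) * D w') - (1 / a) * mf η σ * (D w' - D w) := by ring
    rw [e1]
    have t1 : |1 / a * (mf η σ' - mf η σ) * D w'| ≤ δ/36 * d := by
      rw [abs_mul, abs_mul, abs_of_pos (by positivity : 0 < 1/a)]
      calc _ ≤ 1 / a * (1/η^2 * d) * b := by gcongr; exact mf_lip hη σ σ'; exact hDb _
        _ = b / (a * η^2) * d := by field_simp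
        _ ≤ _ := by gcongr
    have t2 : |1 / a * mf η σ * (D w' - D w)| ≤ (8 * (g σ * max 0 (f w)) + δ/4 + δ/2) * d := by
      rw [abs_mul, abs_mul, abs_of_pos (by positivity : 0 < 1/a)]
      have hm := mf_le hη σ
      have hfp : 0 ≤ max 0 (f w) := le_max_left _ _
      rcases le_total d x₀ with h | h
      · have h1 := hmax w w'
        have h2 : |w' - w| ≤ a * ((|Real.cos σ| + x₀) * d) := by
          rw [show w' - w = a * (Real.sin σ' - Real.sin σ) by simp only [hw, hw']; ring, abs_mul, abs_of_pos ha]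
          gcongr
          refine (sin_diff σ σ').trans ?_
          gcongr
        have h3 : |mf η σ| * (|Real.cos σ| + x₀) ≤ g σ + δ / 18 := by
          rw [mul_add, hmg']
          have : |mf η σ| * x₀ ≤ 1 / (2*η) * x₀ := by gcongr
          have e : 1 / (2*η) * x₀ = δ/18 := by rw [hx₀]; field_simp; norm_num
          linarith
        calc 1 / a * |mf η σ| * |D w' - D w| ≤ 1 / a * |mf η σ| * ((b + 8 * max 0 (f w)) * (a * ((|Real.cos σ| + x₀) * d))) := by
              gcongr; exact h1.trans (by gcongr)
          _ = (|mf η σ| * (|Real.cos σ| + x₀)) * ((b + 8 * max 0 (f w)) * d) := by field_simp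
          _ ≤ (g σ + δ/18) * ((b + 8 * max 0 (f w)) * d) := by gcongr
          _ = ((g σ + δ/18) * (b + 8 * max 0 (f w))) * d := by ring
          _ ≤ _ := by
              gcongr
              have a1 : g σ * b ≤ 1 * (δ/4) := by
                gcongr; exact hg1 σ
              have a2 : δ/18 * (b + 8 * max 0 (f w)) ≤ δ/18 * (1 + 8 * 1) := by
                gcongr; exact hmax1 w
              linarith
      · have h1 : |D w' - D w| ≤ 2 * b := by
          refine (abs_sub _ _).trans ?_; linarith [hDb w, hDb w']
        calc 1 / a * |mf η σ| * |D w' - D w| ≤ 1 / a * (1/(2*η)) * (2 * b) := by gcongr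
          _ = b / (a * η * x₀) * x₀ := by field_simp
          _ ≤ δ/2 * d := by gcongr
          _ ≤ _ := by
            gcongr
            have := hg0 σ
            have : 0 ≤ g σ * max 0 (f w) := by positivity
            linarith
    calc _ ≤ |1 / a * (mf η σ' - mf η σ) * D w'| + |1 / a * mf η σ * (D w' - D w)| := by
            refine (abs_sub _ _).trans ?_; rw [abs_neg]
      _ ≤ δ/36 * d + (8 * (g σ * max 0 (f w)) + δ/4 + δ/2) * d := add_le_add t1 t2
      _ = (δ/36 + δ/4 + δ/2 + 8 * (g σ * max 0 (f w))) * d := by ring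
      _ ≤ _ := by
        gcongr ?_ * _
        linarith
  · intro ω σ hz
    have h1 := hfz _ hz
    have := (abs_le.1 (hsm ω σ)).1
    have h2 : g σ * (1 - δ) ≤ g σ * f (ω + a * Real.sin σ) := by gcongr
    simp only
    linarith

lemma exists_G (a δ c : ℝ) (ha : 0 < a) (hδ : 0 < δ) (hc : 0 < c) :
    ∃ (G Gω Gs : ℝ → ℝ → ℝ) (z B : ℝ), 0 < z ∧ 0 < B ∧
    (∀ v : ℝ × ℝ, HasFDerivAt (fun v : ℝ × ℝ => G v.1 v.2)
      (Gω v.1 v.2 • ContinuousLinearMap.fst ℝ ℝ ℝ + Gs v.1 v.2 • ContinuousLinearMap.snd ℝ ℝ ℝ) v) ∧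
    (∀ ω σ, |G ω σ - σ| ≤ B) ∧ (∀ ω σ, |Gω ω σ| ≤ B) ∧
    (∀ ω σ, -δ ≤ Gs ω σ) ∧ (∀ ω σ, Gs ω σ ≤ 1 + δ) ∧
    (∀ ω σ σ', |G ω σ' - G ω σ - (σ' - σ)| ≤ (δ + 152 * max 0 (1 - Gs ω σ)) * |σ' - σ|) ∧
    (∀ ω σ, |Real.sin (ω + a * Real.sin σ)| < z → Gs ω σ ≤ c) := by
  obtain ⟨e, he, he1, heδ, hec⟩ : ∃ e : ℝ, 0 < e ∧ e ≤ 1 ∧ 400 * e ≤ δ ∧ 6 * e ≤ c := by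
    refine ⟨min 1 (min (δ/400) (c/6)), lt_min one_pos (lt_min (by positivity) (by positivity)), min_le_left _ _, ?_, ?_⟩
    · have := (min_le_right 1 (min (δ/400) (c/6))).trans (min_le_left _ _)
      linarith
    · have := (min_le_right 1 (min (δ/400) (c/6))).trans (min_le_right _ _)
      linarith
  obtain ⟨D, f, y, hy, hD, hDb, hfl, hfu, hfz, hmax⟩ := exists_Dl e e he he
  set η := √e * y / 2 with hη
  have hηp : 0 < η := by positivity
  have hη2 : η ^ 2 = e * y^2 / 4 := by
    rw [hη, div_pow, mul_pow, Real.sq_sqrt he.le]; norm_num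
  set e' := min e (y/2) with he'
  have he'p : 0 < e' := lt_min he (by positivity)
  have he'1 : e' ≤ e := min_le_left _ _
  have he'2 : e' ≤ y / 2 := min_le_right _ _
  obtain ⟨F, Fω, Fs, z, hz, hF, hFb, ⟨B, hB⟩, hFl, hFu, hFm, hFz⟩ := exists_F a e' η ha he'p hηp
  set k : ℝ → ℝ := fun s => 1 - f (s - Real.pi/2) with hk
  have hk0 : ∀ s, 0 ≤ k s := fun s => by simp only [hk]; linarith [hfu (s - Real.pi/2)]
  have hk1 : ∀ s, k s ≤ 1 + e := fun s => by simp only [hk]; linarith [hfl (s - Real.pi/2)]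
  have hH : ∀ s, HasDerivAt (fun s => s - D (s - Real.pi/2)) (k s) s := by
    intro s
    have := (hD (s - Real.pi/2)).comp s ((hasDerivAt_id s).sub_const (Real.pi/2))
    have h2 := (hasDerivAt_id s).sub this
    refine h2.congr_deriv ?_
    simp [hk]
  have hB0 : 0 ≤ B := (abs_nonneg _).trans (hB 0 0)
  refine ⟨fun ω σ => F ω σ - D (F ω σ - Real.pi/2), fun ω σ => k (F ω σ) * Fω ω σ,
    fun ω σ => k (F ω σ) * Fs ω σ, z, 2 + 2 * B, hz, by positivity, ?_, ?_, ?_, ?_, ?_, ?_, ?_⟩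
  · intro v
    have := HasDerivAt.comp_hasFDerivAt v (hH (F v.1 v.2)) (hF v)
    refine this.congr_fderiv ?_
    rw [smul_add, smul_smul, smul_smul]
  · intro ω σ
    have h1 := abs_le.1 (hFb ω σ)
    have h2 := abs_le.1 (hDb (F ω σ - Real.pi/2))
    rw [abs_le]; constructor <;> linarith
  · intro ω σ
    rw [abs_mul, abs_of_nonneg (hk0 _)]
    have h1 := hB ω σ
    have h2 := hk1 (F ω σ)
    have h3 := abs_nonneg (Fω ω σ)
    nlinarith [hk0 (F ω σ)]
  · intro ω σ
    have h1 := hk0 (F ω σ)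
    have h2 := hk1 (F ω σ)
    have h3 := hFl ω σ
    simp only
    nlinarith
  · intro ω σ
    have h1 := hk0 (F ω σ)
    have h2 := hk1 (F ω σ)
    have h3 := hFu ω σ
    have h4 : k (F ω σ) * Fs ω σ ≤ k (F ω σ) * (1 + e) := by gcongr; linarith
    simp only
    nlinarith
  · intro ω σ σ'
    have m1 := hFm ω σ σ'
    have m2 := hmax (F ω σ - Real.pi/2) (F ω σ' - Real.pi/2)
    have hf1 : f (F ω σ - Real.pi/2) = 1 - k (F ω σ) := by simp only [hk]; ring
    rw [hf1, show F ω σ' - Real.pi/2 - (F ω σ - Real.pi/2) = F ω σ' - F ω σ by ring] at m2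
    have h1 := hk0 (F ω σ)
    have h2 := hk1 (F ω σ)
    have h3 := hFu ω σ
    have h4 := hFl ω σ
    set κ := k (F ω σ)
    set s := Fs ω σ
    set d := |σ' - σ| with hd
    have hd0 : 0 ≤ d := abs_nonneg _
    set M := max 0 (1 - κ * s) with hM
    have hM0 : 0 ≤ M := le_max_left _ _
    have hM1 : 1 - κ * s ≤ M := le_max_right _ _
    have q1 : max 0 (1 - κ) ≤ M + 2 * e := by
      apply max_le (by positivity)
      have : κ * s ≤ κ * (1 + e) := by gcongr; linarith
      nlinarith
    have q2 : max 0 (1 - s) ≤ M + 2 * e := by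
      apply max_le (by positivity)
      rcases le_total 0 s with h | h
      · have : κ * s ≤ (1 + e) * s := by gcongr
        nlinarith
      · nlinarith
    have q3 : max 0 (1 - s) ≤ 2 := max_le (by norm_num) (by linarith)
    have m3 : |F ω σ' - F ω σ| ≤ 18 * d := by
      have : |F ω σ' - F ω σ| ≤ |F ω σ' - F ω σ - (σ' - σ)| + d := by
        have := abs_add_le (F ω σ' - F ω σ - (σ' - σ)) (σ' - σ)
        rwa [sub_add_cancel] at this
      have : (e' + 8 * max 0 (1 - s)) * d ≤ (1 + 8 * 2) * d := by gcongr; linarith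
      linarith
    have e1 : F ω σ' - D (F ω σ' - Real.pi/2) - (F ω σ - D (F ω σ - Real.pi/2)) - (σ' - σ) =
      (F ω σ' - F ω σ - (σ' - σ)) - (D (F ω σ' - Real.pi/2) - D (F ω σ - Real.pi/2)) := by ring
    rw [e1]
    calc _ ≤ (e' + 8 * max 0 (1 - s)) * d + (e + 8 * max 0 (1 - κ)) * |F ω σ' - F ω σ| :=
            (abs_sub _ _).trans (add_le_add m1 m2)
      _ ≤ (e + 8 * (M + 2 * e)) * d + (e + 8 * (M + 2 * e)) * (18 * d) := by gcongr
      _ = (323 * e + 152 * M) * d := by ring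
      _ ≤ _ := by gcongr; linarith
  · intro ω σ hzz
    have f1 := hFz ω σ hzz
    have h1 := hk0 (F ω σ)
    have h2 := hk1 (F ω σ)
    have h3 := hFu ω σ
    rcases le_total (Fs ω σ) 0 with hs | hs
    · simp only; nlinarith
    rcases le_or_gt (y/2) |Real.cos σ| with h | h
    · have hg : 1 - e ≤ Real.cos σ ^ 2 / (Real.cos σ ^ 2 + η ^ 2) := by
        rw [le_div_iff₀ (by positivity), hη2]
        have : (y/2)^2 ≤ |Real.cos σ|^2 := by gcongr
        rw [sq_abs] at this
        nlinarith [mul_pos he hy]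
      have : (1 - e) * (1 - e) ≤ Real.cos σ ^ 2 / (Real.cos σ ^ 2 + η ^ 2) * (1 - e') := by
        gcongr
      have h5 : Fs ω σ ≤ 3 * e := by nlinarith
      have : k (F ω σ) * Fs ω σ ≤ 2 * (3 * e) := by gcongr; linarith
      simp only
      linarith
    · have h5 : |Real.sin (F ω σ - Real.pi/2)| < y := by
        rw [Real.sin_sub_pi_div_two, abs_neg]
        have := Real.lipschitzWith_cos.dist_le_mul (F ω σ) σ
        simp only [Real.dist_eq, NNReal.coe_one, one_mul] at this
        have h6 := abs_sub_abs_le_abs_sub (Real.cos (F ω σ)) (Real.cos σ)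
        have := hFb ω σ
        linarith
      have h6 := hfz _ h5
      have h7 : k (F ω σ) ≤ e := by simp only [hk]; linarith
      have : k (F ω σ) * Fs ω σ ≤ e * 2 := by gcongr; linarith
      simp only
      linarith
end ApproxLp


namespace ApproxLp

variable {X : Type*} [NormedAddCommGroup X] [NormedSpace ℝ X]

/-- one flattening step at a point -/
def StepAt (δ c : ℝ) (t Q : X → ℝ) (x : X) (κ : ℝ) : Prop :=
  -δ ≤ κ ∧ κ ≤ 1 + δ ∧ ‖fderiv ℝ Q x - κ • fderiv ℝ t x‖ ≤ c ∧
  (∀ z, |(Q z - Q x) - (t z - t x)| ≤ (δ + 152 * max 0 (1 - κ)) * |t z - t x| + c * ‖z - x‖) ∧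
  (∀ z, |Q z - Q x| ≤ (1 + δ) * |t z - t x| + c * ‖z - x‖)

/-- differentiable with bounded derivative -/
def DB (u : X → ℝ) : Prop := Differentiable ℝ u ∧ ∃ M, ∀ x, ‖fderiv ℝ u x‖ ≤ M

lemma lip_of_fderiv {u : X → ℝ} {M : ℝ} (hu : Differentiable ℝ u) (hM : ∀ x, ‖fderiv ℝ u x‖ ≤ M)
    (x z : X) : |u z - u x| ≤ M * ‖z - x‖ := by
  have := Convex.norm_image_sub_le_of_norm_fderiv_le (𝕜 := ℝ) (f := u) (s := Set.univ) (C := M)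
    (x := x) (y := z) (fun x _ => hu x) (fun x _ => hM x) convex_univ trivial trivial
  simpa using this

lemma lip_of_deriv {g g' : ℝ → ℝ} {M : ℝ} (hg : ∀ t, HasDerivAt g (g' t) t)
    (hM : ∀ t, |g' t| ≤ M) (x z : ℝ) : |g z - g x| ≤ M * |z - x| := by
  have := Convex.norm_image_sub_le_of_norm_hasDerivWithin_le (f := g) (f' := g')
    (s := Set.univ) (C := M) (x := x) (y := z)
    (fun x _ => (hg x).hasDerivWithinAt) (fun x _ => hM x) convex_univ
    trivial trivial
  simpa using this

lemma DB.comp {u : X → ℝ} (hu : DB u) {g g' : ℝ → ℝ} (hg : ∀ t, HasDerivAt g (g' t) t) {K : ℝ}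
    (hK : ∀ t, |g' t| ≤ K) : DB (fun x => g (u x)) := by
  obtain ⟨h1, M, hM⟩ := hu
  have hd : ∀ x, HasFDerivAt (fun x => g (u x)) (g' (u x) • fderiv ℝ u x) x :=
    fun x => HasDerivAt.comp_hasFDerivAt x (hg (u x)) (h1 x).hasFDerivAt
  refine ⟨fun x => (hd x).differentiableAt, K * M, fun x => ?_⟩
  rw [(hd x).fderiv, norm_smul]
  have : 0 ≤ K := (abs_nonneg _).trans (hK 0)
  gcongr
  · exact hK _
  · exact hM x

lemma DB.add {u v : X → ℝ} (hu : DB u) (hv : DB v) : DB (fun x => u x + v x) := by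
  obtain ⟨h1, M, hM⟩ := hu
  obtain ⟨h2, N, hN⟩ := hv
  refine ⟨h1.add h2, M + N, fun x => ?_⟩
  have e : HasFDerivAt (fun x => u x + v x) (fderiv ℝ u x + fderiv ℝ v x) x :=
    (h1 x).hasFDerivAt.add (h2 x).hasFDerivAt
  rw [e.fderiv]
  exact (norm_add_le _ _).trans (add_le_add (hM x) (hN x))

lemma DB.const_mul {u : X → ℝ} (hu : DB u) (a : ℝ) : DB (fun x => a * u x) :=
  hu.comp (g := fun t => a * t) (g' := fun _ => a)
    (fun t => by simpa using (hasDerivAt_id t).const_mul a) (K := |a|) (fun _ => le_rfl)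

lemma level (w t : X → ℝ) (hw : DB w) (ht : DB t) (a δ c τ : ℝ) (ha : 0 < a) (hδ : 0 < δ)
    (hc : 0 < c) (hτ : 0 < τ) :
    ∃ (Q w' : X → ℝ) (z : ℝ), 0 < z ∧ DB Q ∧ DB w' ∧ (∀ x, |Q x - t x| ≤ τ) ∧
      (∀ x, |w' x - w x| ≤ a) ∧
      ∀ x, ∃ κ, StepAt δ c t Q x κ ∧ (|Real.sin (w' x)| < z → κ ≤ c) := by
  obtain ⟨G, Gω, Gs, z, B, hz, hB, hG, hGb, hGω, hGl, hGu, hGm, hGz⟩ := exists_G a δ c ha hδ hc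
  have hw0 := hw
  have ht0 := ht
  obtain ⟨hwd, W, hW⟩ := hw
  obtain ⟨htd, T, hT⟩ := ht
  have hW0 : 0 ≤ W := (norm_nonneg _).trans (hW 0)
  have hT0 : 0 ≤ T := (norm_nonneg _).trans (hT 0)
  obtain ⟨p, hp, hp1, hp2⟩ : ∃ p : ℝ, 0 < p ∧ p * B ≤ τ ∧ p * B * W ≤ c := by
    refine ⟨min (τ/B) (c/(B*(W+1))), lt_min (by positivity) (by positivity), ?_, ?_⟩
    · rw [← le_div_iff₀ hB]; exact min_le_left _ _
    · have h1 : min (τ/B) (c/(B*(W+1))) ≤ c/(B*(W+1)) := min_le_right _ _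
      have h2 : c/(B*(W+1)) * (B * (W + 1)) = c := by field_simp
      have h3 : B * W ≤ B * (W+1) := by gcongr; linarith
      calc _ = min (τ/B) (c/(B*(W+1))) * (B * W) := by ring
        _ ≤ c/(B*(W+1)) * (B * (W+1)) := by gcongr
        _ = c := h2
  have hQd : ∀ x, HasFDerivAt (fun x => p * G (w x) (t x / p))
      ((p * Gω (w x) (t x / p)) • fderiv ℝ w x + Gs (w x) (t x/p) • fderiv ℝ t x) x := by
    intro x
    have h1 := (hwd x).hasFDerivAt.prodMk ((htd x).hasFDerivAt.const_mul (1/p))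
    have h2 := ((hG (w x, 1/p * t x)).comp x h1).const_mul p
    have e : ∀ y, 1 / p * t y = t y / p := fun y => by ring
    simp only [e] at h2
    refine h2.congr_fderiv ?_
    ext v
    simp
    field_simp
  have hGω' : ∀ ω ω' σ, |G ω' σ - G ω σ| ≤ B * |ω' - ω| := by
    intro ω ω' σ
    refine lip_of_deriv (g := fun ω => G ω σ) (g' := fun ω => Gω ω σ) (fun s => ?_) (fun s => hGω s σ) ω ω'
    have h1 : HasDerivAt (fun x : ℝ => (x, σ)) (1, 0) s := (hasDerivAt_id s).prodMk (hasDerivAt_const s σ)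
    have h2 := (hG (s, σ)).comp_hasDerivAt s h1
    refine HasDerivAt.congr_deriv h2 (by simp)
  have hGs' : ∀ ω σ σ', |G ω σ' - G ω σ| ≤ (1 + δ) * |σ' - σ| := by
    intro ω σ σ'
    refine lip_of_deriv (g := fun σ => G ω σ) (g' := fun σ => Gs ω σ) (fun s => ?_) (fun s => ?_) σ σ'
    · have h1 : HasDerivAt (fun x : ℝ => (ω, x)) (0, 1) s := (hasDerivAt_const s ω).prodMk (hasDerivAt_id s)
      have h2 := (hG (ω, s)).comp_hasDerivAt s h1
      refine HasDerivAt.congr_deriv h2 (by simp)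
    · rw [abs_le]; constructor <;> linarith [hGl ω s, hGu ω s]
  have hdiv : ∀ x y : X, p * |t y / p - t x / p| = |t y - t x| := by
    intro x y; rw [← sub_div, abs_div, abs_of_pos hp]; field_simp
  have hfirst : ∀ x y σ, |p * (G (w y) σ - G (w x) σ)| ≤ c * ‖y - x‖ := by
    intro x y σ
    rw [abs_mul, abs_of_pos hp]
    calc _ ≤ p * (B * (W * ‖y - x‖)) := by
          gcongr; exact (hGω' _ _ _).trans (by gcongr; exact lip_of_fderiv hwd hW x y)
      _ = p * B * W * ‖y - x‖ := by ring
      _ ≤ _ := by gcongr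
  have hstep : ∀ x, StepAt δ c t (fun x => p * G (w x) (t x / p)) x (Gs (w x) (t x / p)) := by
    intro x
    refine ⟨hGl _ _, hGu _ _, ?_, fun y => ?_, fun y => ?_⟩
    · rw [(hQd x).fderiv, add_sub_cancel_right, norm_smul, Real.norm_eq_abs, abs_mul, abs_of_pos hp]
      calc _ ≤ p * B * W := by gcongr; exact hGω _ _; exact hW x
        _ ≤ c := hp2
    · have e : p * G (w y) (t y / p) - p * G (w x) (t x / p) - (t y - t x) =
        p * (G (w y) (t y / p) - G (w x) (t y / p)) +
        p * (G (w x) (t y / p) - G (w x) (t x / p) - (t y / p - t x / p)) := by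
          field_simp; ring
      rw [e]
      refine (abs_add_le _ _).trans ?_
      rw [add_comm]
      refine add_le_add ?_ (hfirst x y _)
      rw [abs_mul, abs_of_pos hp, ← hdiv]
      have := mul_le_mul_of_nonneg_left (hGm (w x) (t x / p) (t y / p)) hp.le
      linarith
    · have e : p * G (w y) (t y / p) - p * G (w x) (t x / p) =
        p * (G (w y) (t y / p) - G (w x) (t y / p)) +
        p * (G (w x) (t y / p) - G (w x) (t x / p)) := by
          ring
      rw [e]
      refine (abs_add_le _ _).trans ?_
      rw [add_comm]
      refine add_le_add ?_ (hfirst x y _)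
      rw [abs_mul, abs_of_pos hp, ← hdiv]
      have := mul_le_mul_of_nonneg_left (hGs' (w x) (t x / p) (t y / p)) hp.le
      linarith
  refine ⟨fun x => p * G (w x) (t x / p), fun x => w x + a * Real.sin (t x / p), z, hz,
    ⟨fun x => (hQd x).differentiableAt, p * B * W + (1 + δ) * T, fun x => ?_⟩, ?_, fun x => ?_, fun x => ?_, fun x => ⟨_, hstep x, fun h => hGz _ _ h⟩⟩
  · rw [(hQd x).fderiv]
    refine (norm_add_le _ _).trans ?_
    rw [norm_smul, norm_smul, Real.norm_eq_abs, Real.norm_eq_abs, abs_mul, abs_of_pos hp]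
    gcongr
    · exact hGω _ _
    · exact hW x
    · rw [abs_le]; constructor <;> linarith [hGl (w x) (t x / p), hGu (w x) (t x / p)]
    · exact hT x
  · refine hw0.add (DB.const_mul (DB.comp ht0 (g := fun s => Real.sin (s / p)) (g' := fun s => Real.cos (s/p) * (1/p)) (K := 1/p) ?_ ?_) a)
    · intro s
      exact (Real.hasDerivAt_sin (s/p)).comp s ((hasDerivAt_id s).div_const p)
    · intro s
      rw [abs_mul, abs_of_pos (by positivity : 0 < 1/p)]
      have := Real.abs_cos_le_one (s/p)
      have : 0 < 1/p := by positivity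
      nlinarith
  · have e : p * G (w x) (t x / p) - t x = p * (G (w x) (t x / p) - t x / p) := by field_simp
    rw [e, abs_mul, abs_of_pos hp]
    refine le_trans ?_ hp1
    gcongr; exact hGb _ _
  · rw [add_sub_cancel_left, abs_mul, abs_of_pos ha]
    have := Real.abs_sin_le_one (t x / p)
    nlinarith

lemma levels (t : ℕ → X → ℝ) (ht : ∀ i, DB (t i)) (w : X → ℝ) (hw : DB w) (δ c τ : ℝ)
    (hδ : 0 < δ) (hc : 0 < c) (hτ : 0 < τ) (n : ℕ) :
    ∃ (Q : ℕ → X → ℝ) (w' : X → ℝ) (z : ℝ), 0 < z ∧ (∀ i, DB (Q i)) ∧ DB w' ∧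
      (∀ i x, |Q i x - t i x| ≤ τ) ∧ (∀ x, |w' x - w x| ≤ n) ∧
      ∀ x, ∃ κ : ℕ → ℝ, (∀ i < n, StepAt δ c (t i) (Q i) x (κ i)) ∧
        (|Real.sin (w' x)| < z → ∀ i < n, κ i ≤ c) := by
  induction n with
  | zero =>
    exact ⟨t, w, 1, one_pos, ht, hw, fun i x => by simpa using hτ.le, fun x => by simp,
      fun x => ⟨0, by simp, by simp⟩⟩
  | succ n ih =>
    obtain ⟨Q, w', z, hz, hQ, hw', hQt, hww, hκ⟩ := ih
    have hapos : 0 < min (z/2) 1 := lt_min (by positivity) one_pos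
    obtain ⟨Qn, w'', z', hz', hQn, hw'', hQnt, hwww, hκn⟩ :=
      level w' (t n) hw' (ht n) (min (z/2) 1) δ c τ hapos hδ hc hτ
    refine ⟨Function.update Q n Qn, w'', min (z/2) z', lt_min (by positivity) hz', ?_, hw'', ?_, ?_, ?_⟩
    · intro i
      by_cases h : i = n
      · subst h; simpa using hQn
      · simpa [h] using hQ i
    · intro i x
      by_cases h : i = n
      · subst h; simpa using hQnt x
      · simpa [h] using hQt i x
    · intro x
      have h1 := hww x
      have h2 := (hwww x).trans (min_le_right _ _)
      have := abs_add_le (w'' x - w' x) (w' x - w x)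
      rw [sub_add_sub_cancel] at this
      push_cast; linarith
    · intro x
      obtain ⟨κ, h1, h2⟩ := hκ x
      obtain ⟨κn, h3, h4⟩ := hκn x
      refine ⟨Function.update κ n κn, ?_, ?_⟩
      · intro i hi
        by_cases h : i = n
        · subst h; simpa using h3
        · simpa [h] using h1 i (by omega)
      · intro hs i hi
        by_cases h : i = n
        · subst h; simpa using h4 (hs.trans_le (min_le_right _ _))
        · have : |Real.sin (w' x)| < z := by
            have a1 := hs.trans_le (min_le_left _ _)
            have a2 := (hwww x).trans (min_le_left _ _)
            have a3 := Real.lipschitzWith_sin.dist_le_mul (w'' x) (w' x)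
            simp only [Real.dist_eq, NNReal.coe_one, one_mul] at a3
            have a4 := abs_sub_abs_le_abs_sub (Real.sin (w' x)) (Real.sin (w'' x))
            rw [abs_sub_comm] at a4
            linarith
          simpa [h] using h2 this i (by omega)

/-- The gadget. -/
lemma gadget (t : ℕ → X → ℝ) (ht : ∀ i, DB (t i)) (υ : X → ℝ) (hυ : DB υ) (δ τ : ℝ)
    (hδ : 0 < δ) (hτ : 0 < τ) (n : ℕ) :
    ∃ (Q : ℕ → X → ℝ) (Z : X → ℝ), (∀ i, DB (Q i)) ∧ DB Z ∧
      (∀ i x, |Q i x - t i x| ≤ τ) ∧ (∀ x, |Z x - υ x| ≤ τ) ∧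
      ∀ x, ∃ κ : ℕ → ℝ, (∀ i < n, StepAt δ δ (t i) (Q i) x (κ i)) ∧
        (fderiv ℝ Z x = 0 ∨ ∀ i < n, κ i ≤ δ) := by
  set τ' := τ / (Real.pi + n) with hτ'
  have hpn : 0 < Real.pi + n := by positivity
  have hτp : 0 < τ' := by positivity
  obtain ⟨Q, w, z, hz, hQ, hw, hQt, hww, hκ⟩ := levels t ht (fun x => 1/τ' * υ x) (hυ.const_mul _) δ δ τ hδ hδ hτ n
  obtain ⟨S, S', hS, ⟨K, hK⟩, hSb, hSz⟩ := exists_stair z hz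
  refine ⟨Q, fun x => τ' * S (w x), hQ, (hw.comp hS hK).const_mul _, hQt, fun x => ?_, fun x => ?_⟩
  · have e : τ' * S (w x) - υ x = τ' * ((S (w x) - w x) + (w x - 1/τ' * υ x)) := by field_simp; ring
    rw [e, abs_mul, abs_of_pos hτp]
    calc _ ≤ τ' * (Real.pi + n) := by
          gcongr; exact (abs_add_le _ _).trans (add_le_add (hSb _) (hww x))
      _ = τ := by rw [hτ']; field_simp
  · obtain ⟨κ, h1, h2⟩ := hκ x
    refine ⟨κ, h1, ?_⟩
    by_cases h : S' (w x) = 0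
    · left
      have := (HasDerivAt.comp_hasFDerivAt x (hS (w x)) (hw.1 x).hasFDerivAt).const_mul τ'
      have e : HasFDerivAt (fun x => τ' * S (w x)) (τ' • S' (w x) • fderiv ℝ w x) x := this
      rw [e.fderiv, h]; simp
    · right; exact h2 (hSz _ h)
end ApproxLp


namespace ApproxLp

variable {X : Type*} [NormedAddCommGroup X] [NormedSpace ℝ X]

lemma gronwall_aux (a g : ℕ → ℝ) (e : ℝ) (he : 0 ≤ e) (ha : ∀ q, 0 ≤ a q) (hg : ∀ q, 0 ≤ g q)
    (h : ∀ q, a (q+1) ≤ (1 + g q) * a q + g q * e) (m k : ℕ) :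
    a (m + k) ≤ Real.exp (∑ i ∈ Finset.range k, g (i + m)) *
      (a m + (∑ i ∈ Finset.range k, g (i + m)) * e) := by
  induction k with
  | zero => simp
  | succ k ih =>
    rw [Finset.sum_range_succ]
    set s := ∑ i ∈ Finset.range k, g (i + m)
    have hs : 0 ≤ s := Finset.sum_nonneg (fun i _ => hg _)
    have h1 := h (m + k)
    rw [add_comm m k] at h1
    rw [add_comm m k] at ih
    rw [show m + (k+1) = k + m + 1 by ring]
    set γ := g (k + m)
    have hγ : 0 ≤ γ := hg _
    have h2 : 1 + γ ≤ Real.exp γ := by linarith [Real.add_one_le_exp γ]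
    have h3 : 1 ≤ Real.exp (s + γ) := Real.one_le_exp (by positivity)
    have ham := ha m
    calc a (k + m + 1) ≤ (1 + γ) * a (k+m) + γ * e := h1
      _ ≤ Real.exp γ * (Real.exp s * (a m + s * e)) + γ * e := by gcongr; exact ha _
      _ = Real.exp (s + γ) * (a m + s * e) + γ * e := by rw [Real.exp_add]; ring
      _ ≤ Real.exp (s + γ) * (a m + s * e) + Real.exp (s+γ) * (γ * e) := by
          have : 0 ≤ γ * e := by positivity
          have : 1 * (γ * e) ≤ Real.exp (s+γ) * (γ * e) := by gcongr
          linarith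
      _ = _ := by ring

lemma gronwall (a g : ℕ → ℝ) (e : ℝ) (he : 0 ≤ e) (ha : ∀ q, 0 ≤ a q) (hg : ∀ q, 0 ≤ g q)
    (hs : Summable g) (h : ∀ q, a (q+1) ≤ (1 + g q) * a q + g q * e) (m k : ℕ) :
    a (m + k) ≤ Real.exp (∑' i, g i) * (a m + (∑' i, g (i + m)) * e) := by
  refine (gronwall_aux a g e he ha hg h m k).trans ?_
  have hsm : Summable (fun i => g (i + m)) := (summable_nat_add_iff m).2 hs
  have h1 : ∑ i ∈ Finset.range k, g (i + m) ≤ ∑' i, g (i + m) :=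
    hsm.sum_le_tsum _ (fun i _ => hg _)
  have h2 : ∑' i, g (i + m) ≤ ∑' i, g i := by
    rw [← hs.sum_add_tsum_nat_add m]
    have : 0 ≤ ∑ i ∈ Finset.range m, g i := Finset.sum_nonneg (fun i _ => hg _)
    linarith
  have h3 : 0 ≤ ∑ i ∈ Finset.range k, g (i + m) := Finset.sum_nonneg (fun i _ => hg _)
  have := ha m
  gcongr
  linarith

/-- near-point Lipschitz estimate -/
lemma near_lip {b : X → ℝ} {x : X} (hb : DifferentiableAt ℝ b x) {ε : ℝ} (hε : 0 < ε) :
    ∀ᶠ z in nhds x, |b z - b x - fderiv ℝ b x (z - x)| ≤ ε * ‖z - x‖ := by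
  have := hb.hasFDerivAt.isLittleO.def hε
  simpa using this

lemma near_lip' {b : X → ℝ} {x : X} (hb : DifferentiableAt ℝ b x) {ε : ℝ} (hε : 0 < ε) :
    ∀ᶠ z in nhds x, |b z - b x| ≤ (‖fderiv ℝ b x‖ + ε) * ‖z - x‖ := by
  filter_upwards [near_lip hb hε] with z hz
  have h1 := (fderiv ℝ b x).le_opNorm (z - x)
  rw [Real.norm_eq_abs] at h1
  have := abs_add_le (b z - b x - fderiv ℝ b x (z - x)) (fderiv ℝ b x (z - x))
  rw [sub_add_cancel] at this
  linarith

section limit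
variable {b : ℕ → X → ℝ} {y : X → ℝ} {x : X} {g κ : ℕ → ℝ}
  (hb : ∀ q, DifferentiableAt ℝ (b q) x) (hg : ∀ q, 0 ≤ g q) (hs : Summable g)
  (hstep : ∀ q, StepAt (g q) (g q) (b q) (b (q+1)) x (κ q))
  (hy : ∀ z, Tendsto (fun q => b q z) atTop (nhds (y z)))

include hg hs hstep in
lemma lim_incr (z : X) (m k : ℕ) : |b (m+k) z - b (m+k) x| ≤
    Real.exp (∑' i, g i) * (|b m z - b m x| + (∑' i, g (i + m)) * ‖z - x‖) :=
  gronwall (fun q => |b q z - b q x|) g ‖z - x‖ (norm_nonneg _) (fun _ => abs_nonneg _) hg hs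
    (fun q => (hstep q).2.2.2.2 z) m k

include hg hs hstep hy in
lemma lim_incr_y (z : X) (m : ℕ) : |y z - y x| ≤
    Real.exp (∑' i, g i) * (|b m z - b m x| + (∑' i, g (i + m)) * ‖z - x‖) := by
  have h1 : Tendsto (fun k => |b (k+m) z - b (k+m) x|) atTop (nhds |y z - y x|) :=
    (((tendsto_add_atTop_iff_nat m).2 (hy z)).sub ((tendsto_add_atTop_iff_nat m).2 (hy x))).abs
  refine le_of_tendsto' h1 (fun k => ?_)
  rw [add_comm k m]
  exact lim_incr hg hs hstep z m k

include hstep hg in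
lemma kappa_abs (q : ℕ) : |κ q| ≤ 1 + g q := by
  obtain ⟨h1, h2, -⟩ := hstep q
  rw [abs_le]; constructor <;> linarith [hg q]

include hstep in
lemma dstep (q : ℕ) : ‖fderiv ℝ (b (q+1)) x‖ ≤ |κ q| * ‖fderiv ℝ (b q) x‖ + g q := by
  obtain ⟨-, -, h3, -⟩ := hstep q
  have := norm_add_le (fderiv ℝ (b (q+1)) x - κ q • fderiv ℝ (b q) x) (κ q • fderiv ℝ (b q) x)
  rw [sub_add_cancel, norm_smul, Real.norm_eq_abs] at this
  linarith

include hg hs hstep in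
lemma lim_d (m k : ℕ) : ‖fderiv ℝ (b (m+k)) x‖ ≤
    Real.exp (∑' i, g i) * (‖fderiv ℝ (b m) x‖ + (∑' i, g (i + m)) * 1) := by
  refine gronwall (fun q => ‖fderiv ℝ (b q) x‖) g 1 zero_le_one (fun _ => norm_nonneg _) hg hs
    (fun q => ?_) m k
  refine (dstep hstep q).trans ?_
  rw [mul_one]
  gcongr
  exact kappa_abs hg hstep q

include hb hg hs hstep hy in
lemma lim_zero (hz : ∀ ε > 0, ∃ m, ‖fderiv ℝ (b m) x‖ ≤ ε ∧ ∑' i, g (i + m) ≤ ε) :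
    HasFDerivAt y (0 : X →L[ℝ] ℝ) x := by
  rw [hasFDerivAt_iff_isLittleO, Asymptotics.isLittleO_iff]
  intro ε hε
  set E := Real.exp (∑' i, g i) with hE
  have hEp : 0 < E := Real.exp_pos _
  obtain ⟨m, hm1, hm2⟩ := hz (ε / (3 * E)) (by positivity)
  filter_upwards [near_lip' (hb m) (show 0 < ε / (3*E) by positivity)] with z hz
  have h1 := lim_incr_y hg hs hstep hy z m
  rw [← hE] at h1
  simp only [zero_apply, sub_zero, Real.norm_eq_abs]
  refine h1.trans ?_
  calc E * (|b m z - b m x| + (∑' i, g (i + m)) * ‖z - x‖)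
      ≤ E * ((ε/(3*E) + ε/(3*E)) * ‖z - x‖ + ε/(3*E) * ‖z - x‖) := by
        gcongr; exact hz.trans (by gcongr)
    _ = ε * ‖z - x‖ := by field_simp; ring

include hb hg hs hstep hy in
lemma lim_bound {D : X →L[ℝ] ℝ} (hD : HasFDerivAt y D x) (m : ℕ) : ‖D‖ ≤
    Real.exp (∑' i, g i) * (‖fderiv ℝ (b m) x‖ + ∑' i, g (i + m)) := by
  have hEp : 0 < Real.exp (∑' i, g i) := Real.exp_pos _
  refine le_of_forall_pos_le_add (fun ε hε => ?_)
  have hS : 0 ≤ ∑' i, g (i + m) := tsum_nonneg (fun i => hg _)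
  refine hD.le_of_lip' (by positivity) ?_
  filter_upwards [near_lip' (hb m) (show 0 < ε / Real.exp (∑' i, g i) by positivity)] with z hz
  rw [Real.norm_eq_abs]
  refine (lim_incr_y hg hs hstep hy z m).trans ?_
  calc _ ≤ Real.exp (∑' i, g i) * ((‖fderiv ℝ (b m) x‖ + ε / Real.exp (∑' i, g i)) * ‖z - x‖ + (∑' i, g (i + m)) * ‖z - x‖) := by gcongr
    _ = _ := by field_simp; ring

include hb hg hs hstep hy in
lemma lim_nonzero {β : ℝ} (hβ : 0 < β) {m₀ : ℕ} (hd : ∀ q, m₀ ≤ q → β ≤ ‖fderiv ℝ (b q) x‖) :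
    ∃ D : X →L[ℝ] ℝ, HasFDerivAt y D x := by
  set E := Real.exp (∑' i, g i) with hE
  have hEp : 0 < E := Real.exp_pos _
  set S := ∑' i, g (i + m₀) with hSdef
  have hS0 : 0 ≤ S := tsum_nonneg (fun i => hg _)
  have hsm : Summable (fun i => g (i + m₀)) := (summable_nat_add_iff m₀).2 hs
  set Dm := E * (‖fderiv ℝ (b m₀) x‖ + S * 1) with hDm
  have hDmax : ∀ k, ‖fderiv ℝ (b (k + m₀)) x‖ ≤ Dm := fun k => by
    rw [add_comm]; exact lim_d hg hs hstep m₀ k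
  have hDm0 : 0 ≤ Dm := (norm_nonneg _).trans (hDmax 0)
  set η : ℕ → ℝ := fun k => max 0 (1 - κ (k + m₀)) with hη
  have hη0 : ∀ k, 0 ≤ η k := fun k => le_max_left _ _
  have hηs : Summable η := by
    refine summable_of_sum_range_le (c := (‖fderiv ℝ (b m₀) x‖ + (2 * Dm + 1) * S)/β) hη0 (fun n => ?_)
    rw [le_div_iff₀ hβ]
    have key : ∀ n, (∑ i ∈ Finset.range n, η i) * β ≤ ‖fderiv ℝ (b (0 + m₀)) x‖ - ‖fderiv ℝ (b (n + m₀)) x‖ +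
        (2 * Dm + 1) * ∑ i ∈ Finset.range n, g (i + m₀) := by
      intro n
      induction n with
      | zero => simp
      | succ n ih =>
        rw [Finset.sum_range_succ, Finset.sum_range_succ]
        have h1 := dstep hstep (n + m₀)
        obtain ⟨k1, k2, -⟩ := hstep (n + m₀)
        have hgn := hg (n + m₀)
        have h2 : |κ (n + m₀)| ≤ 1 - η n + 2 * g (n + m₀) := by
          simp only [hη]
          rcases le_total (1 - κ (n+m₀)) 0 with h | h
          · rw [max_eq_left h, abs_le]; constructor <;> linarith
          · rw [max_eq_right h, abs_le]; constructor <;> linarith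
        have h3 := hDmax n
        have h4 := hd (n + m₀) (by omega)
        have h5 := hη0 n
        rw [show n + 1 + m₀ = n + m₀ + 1 by ring]
        set d := ‖fderiv ℝ (b (n + m₀)) x‖
        have h6 : |κ (n + m₀)| * d ≤ (1 - η n + 2 * g (n + m₀)) * d := by gcongr
        nlinarith [mul_le_mul_of_nonneg_left h4 h5, mul_le_mul_of_nonneg_left h3 hgn]
    refine (key n).trans ?_
    have h1 : ∑ i ∈ Finset.range n, g (i + m₀) ≤ S := hsm.sum_le_tsum _ (fun i _ => hg _)
    have : (2 * Dm + 1) * ∑ i ∈ Finset.range n, g (i + m₀) ≤ (2 * Dm + 1) * S := by gcongr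
    rw [zero_add]
    linarith [norm_nonneg (fderiv ℝ (b (n + m₀)) x)]
  -- derivatives converge
  have hDc : ∃ D : X →L[ℝ] ℝ, Tendsto (fun k => fderiv ℝ (b (k + m₀)) x) atTop (nhds D) := by
    apply cauchySeq_tendsto_of_complete
    refine cauchySeq_of_dist_le_of_summable (fun k => (η k + g (k + m₀)) * Dm + g (k + m₀)) (fun k => ?_)
      (((hηs.add hsm).mul_right Dm).add hsm)
    rw [dist_comm, dist_eq_norm, Nat.succ_eq_add_one, show k + 1 + m₀ = k + m₀ + 1 by ring]
    obtain ⟨k1, k2, k3, -⟩ := hstep (k + m₀)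
    have hgn := hg (k + m₀)
    have e : fderiv ℝ (b (k + m₀ + 1)) x - fderiv ℝ (b (k + m₀)) x =
      (fderiv ℝ (b (k + m₀ + 1)) x - κ (k + m₀) • fderiv ℝ (b (k + m₀)) x) + (κ (k + m₀) - 1) • fderiv ℝ (b (k + m₀)) x := by
      rw [sub_smul, one_smul]; abel
    rw [e]
    refine (norm_add_le _ _).trans ?_
    rw [norm_smul, Real.norm_eq_abs, add_comm]
    have : |κ (k + m₀) - 1| ≤ η k + g (k + m₀) := by
      have a1 := hη0 k
      have a2 : 1 - κ (k + m₀) ≤ η k := le_max_right _ _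
      rw [abs_le]; constructor <;> linarith
    gcongr
    exact hDmax k
  obtain ⟨D, hD⟩ := hDc
  refine ⟨D, ?_⟩
  set K := E * ((‖fderiv ℝ (b m₀) x‖ + 1) + S) with hK
  have hK0 : 0 ≤ K := by positivity
  set ν : ℕ → ℝ := fun k => (g (k + m₀) + 152 * η k) * K + g (k + m₀) with hν
  have hνs : Summable ν := ((hsm.add (hηs.mul_left 152)).mul_right K).add hsm
  have hν0 : ∀ k, 0 ≤ ν k := fun k => by
    have := hη0 k; have := hg (k + m₀); simp only [hν]; positivity
  have hcau : ∀ᶠ z in nhds x, ∀ n, |(y z - y x) - (b (n + m₀) z - b (n + m₀) x)| ≤ (∑' k, ν (k + n)) * ‖z - x‖ := by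
    filter_upwards [near_lip' (hb m₀) one_pos] with z hz n
    have hΔ : ∀ k, |b (k + m₀) z - b (k + m₀) x| ≤ K * ‖z - x‖ := by
      intro k
      rw [add_comm]
      refine (lim_incr hg hs hstep z m₀ k).trans ?_
      calc _ ≤ E * ((‖fderiv ℝ (b m₀) x‖ + 1) * ‖z - x‖ + S * ‖z - x‖) := by gcongr
        _ = _ := by rw [hK]; ring
    set B : ℕ → ℝ := fun k => b (k + m₀) z - b (k + m₀) x with hB
    have hBt : Tendsto B atTop (nhds (y z - y x)) :=
      ((tendsto_add_atTop_iff_nat m₀).2 (hy z)).sub ((tendsto_add_atTop_iff_nat m₀).2 (hy x))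
    have hBs : ∀ k, dist (B k) (B (k+1)) ≤ ν k * ‖z - x‖ := by
      intro k
      rw [dist_comm, Real.dist_eq]
      simp only [hB]
      rw [show k + 1 + m₀ = k + m₀ + 1 by ring]
      refine ((hstep (k+m₀)).2.2.2.1 z).trans ?_
      have h1 := hΔ k
      have h2 : 0 ≤ g (k + m₀) + 152 * max 0 (1 - κ (k + m₀)) := by
        have := hη0 k; have := hg (k + m₀); positivity
      calc _ ≤ (g (k + m₀) + 152 * max 0 (1 - κ (k + m₀))) * (K * ‖z - x‖) + g (k+m₀) * ‖z - x‖ := by gcongr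
        _ = _ := by simp only [hν, hη]; ring
    have := dist_le_tsum_of_dist_le_of_tendsto (fun k => ν k * ‖z - x‖) hBs (hνs.mul_right _) hBt n
    rw [dist_comm, Real.dist_eq, tsum_mul_right] at this
    simp only [add_comm n] at this
    exact this
  rw [hasFDerivAt_iff_isLittleO, Asymptotics.isLittleO_iff]
  intro ε hε
  have ht1 : Tendsto (fun n => ∑' k, ν (k + n)) atTop (nhds 0) := tendsto_sum_nat_add ν
  have hD' : Tendsto (fun k => ‖fderiv ℝ (b (k + m₀)) x - D‖) atTop (nhds 0) := by
    rw [← tendsto_iff_norm_sub_tendsto_zero]; exact hD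
  obtain ⟨n, hn1, hn2⟩ := ((ht1.eventually (gt_mem_nhds (show 0 < ε/3 by positivity))).and
    (hD'.eventually (gt_mem_nhds (show 0 < ε/3 by positivity)))).exists
  filter_upwards [hcau, near_lip (hb (n + m₀)) (show 0 < ε/3 by positivity)] with z h1 h2
  have h3 := h1 n
  have h4 : |(fderiv ℝ (b (n + m₀)) x - D) (z - x)| ≤ ε/3 * ‖z - x‖ := by
    calc |(fderiv ℝ (b (n + m₀)) x - D) (z - x)| ≤ ‖fderiv ℝ (b (n + m₀)) x - D‖ * ‖z - x‖ :=
          ContinuousLinearMap.le_opNorm (fderiv ℝ (b (n + m₀)) x - D) (z - x)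
      _ ≤ _ := by gcongr
  have h5 : (∑' k, ν (k + n)) * ‖z - x‖ ≤ ε/3 * ‖z - x‖ := by gcongr
  have e : y z - y x - D (z - x) = ((y z - y x) - (b (n + m₀) z - b (n + m₀) x)) +
    (b (n + m₀) z - b (n + m₀) x - fderiv ℝ (b (n + m₀)) x (z - x)) + (fderiv ℝ (b (n + m₀)) x - D) (z - x) := by
    simp only [sub_apply]; ring
  rw [Real.norm_eq_abs, e]
  refine (abs_add_le _ _).trans ?_
  have := abs_add_le ((y z - y x) - (b (n + m₀) z - b (n + m₀) x)) (b (n + m₀) z - b (n + m₀) x - fderiv ℝ (b (n + m₀)) x (z - x))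
  linarith

include hb hg hs hstep hy in
lemma lim_diff : DifferentiableAt ℝ y x := by
  by_cases h : ∀ ε > 0, ∃ m, ‖fderiv ℝ (b m) x‖ ≤ ε ∧ ∑' i, g (i + m) ≤ ε
  · exact (lim_zero hb hg hs hstep hy h).differentiableAt
  · push Not at h
    obtain ⟨ε, hε, h⟩ := h
    have ht1 : Tendsto (fun n => ∑' k, g (k + n)) atTop (nhds 0) := tendsto_sum_nat_add g
    obtain ⟨m₀, hm⟩ := eventually_atTop.1 (ht1.eventually (gt_mem_nhds hε))
    obtain ⟨D, hD⟩ := lim_nonzero hb hg hs hstep hy hε (m₀ := m₀) (fun q hq => by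
      by_contra hc
      push Not at hc
      have := h q hc.le
      linarith [hm q hq])
    exact hD.differentiableAt

include hb hg hs hstep hy in
lemma lim_flat (hfl : ∀ N, ∃ q, N ≤ q ∧ κ q ≤ g q) : fderiv ℝ y x = 0 := by
  refine (lim_zero hb hg hs hstep hy (fun ε hε => ?_)).fderiv
  have ht1 : Tendsto (fun n => ∑' k, g (k + n)) atTop (nhds 0) := tendsto_sum_nat_add g
  have ht2 : Tendsto g atTop (nhds 0) := hs.tendsto_atTop_zero
  set Dm := Real.exp (∑' i, g i) * (‖fderiv ℝ (b 0) x‖ + (∑' i, g (i + 0)) * 1) with hDm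
  have hDmax : ∀ k, ‖fderiv ℝ (b k) x‖ ≤ Dm := fun k => by
    have := lim_d hg hs hstep 0 k
    rwa [zero_add] at this
  have hDm0 : 0 ≤ Dm := (norm_nonneg _).trans (hDmax 0)
  obtain ⟨N, hN⟩ := eventually_atTop.1 ((ht1.eventually (gt_mem_nhds hε)).and
    (ht2.eventually (gt_mem_nhds (show 0 < ε/(Dm + 1) by positivity))))
  obtain ⟨q, hq, hκ⟩ := hfl N
  refine ⟨q + 1, ?_, (hN (q+1) (by omega)).1.le⟩
  have h1 := dstep hstep q
  have h2 := (hN q hq).2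
  obtain ⟨k1, -⟩ := hstep q
  have h3 : |κ q| ≤ g q := by rw [abs_le]; constructor <;> linarith
  have hgq := hg q
  calc _ ≤ g q * Dm + g q := h1.trans (by gcongr; exact hDmax q)
    _ = g q * (Dm + 1) := by ring
    _ ≤ ε / (Dm + 1) * (Dm + 1) := by gcongr
    _ = ε := by field_simp
end limit
end ApproxLp


namespace ApproxLp
variable {X : Type*} [NormedAddCommGroup X] [NormedSpace ℝ X]

lemma norm_fderiv_le_of_lip {Y : Type*} [NormedAddCommGroup Y] [NormedSpace ℝ Y] {f : X → Y} {x : X} {C : ℝ} (hC : 0 ≤ C)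
    (h : ∀ z, ‖f z - f x‖ ≤ C * ‖z - x‖) : ‖fderiv ℝ f x‖ ≤ C := by
  by_cases hd : DifferentiableAt ℝ f x
  · exact hd.hasFDerivAt.le_of_lip' hC (Eventually.of_forall h)
  · rw [fderiv_zero_of_not_differentiableAt hd]; simpa using hC

lemma StepAt.pull {Y : Type*} [NormedAddCommGroup Y] [NormedSpace ℝ Y] {δ c κ τ : ℝ} (hc : 0 ≤ c) {t Q : Y → ℝ} {p : X → Y} {x : X}
    (hτ : 0 < τ) (h : StepAt δ c t Q (p x) κ) (ht : DifferentiableAt ℝ t (p x))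
    (hQ : DifferentiableAt ℝ Q (p x)) (hp : DifferentiableAt ℝ p x)
    (hpl : ∀ z, ‖p z - p x‖ ≤ τ⁻¹ * ‖z - x‖) :
    StepAt δ c (fun x => τ * t (p x)) (fun x => τ * Q (p x)) x κ := by
  obtain ⟨h1, h2, h3, h4, h5⟩ := h
  have et : HasFDerivAt (fun x => τ * t (p x)) (τ • (fderiv ℝ t (p x)).comp (fderiv ℝ p x)) x :=
    (ht.hasFDerivAt.comp x hp.hasFDerivAt).const_mul τ
  have eQ : HasFDerivAt (fun x => τ * Q (p x)) (τ • (fderiv ℝ Q (p x)).comp (fderiv ℝ p x)) x :=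
    (hQ.hasFDerivAt.comp x hp.hasFDerivAt).const_mul τ
  have hn : ‖fderiv ℝ p x‖ ≤ τ⁻¹ := norm_fderiv_le_of_lip (by positivity) hpl
  have key : ∀ z, τ * (c * ‖p z - p x‖) ≤ c * ‖z - x‖ := fun z => by
    calc τ * (c * ‖p z - p x‖) ≤ τ * (c * (τ⁻¹ * ‖z - x‖)) := by gcongr; exact hpl z
      _ = _ := by field_simp
  refine ⟨h1, h2, ?_, fun z => ?_, fun z => ?_⟩
  · rw [et.fderiv, eQ.fderiv]
    have : τ • (fderiv ℝ Q (p x)).comp (fderiv ℝ p x) - κ • τ • (fderiv ℝ t (p x)).comp (fderiv ℝ p x)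
        = τ • (fderiv ℝ Q (p x) - κ • fderiv ℝ t (p x)).comp (fderiv ℝ p x) := by
      ext v; simp; ring
    rw [this, norm_smul, Real.norm_eq_abs, abs_of_pos hτ]
    calc _ ≤ τ * (‖fderiv ℝ Q (p x) - κ • fderiv ℝ t (p x)‖ * ‖fderiv ℝ p x‖) := by
          gcongr; exact ContinuousLinearMap.opNorm_comp_le _ _
      _ ≤ τ * (c * τ⁻¹) := by gcongr
      _ = c := by field_simp
  · have e : τ * Q (p z) - τ * Q (p x) - (τ * t (p z) - τ * t (p x)) =
      τ * (Q (p z) - Q (p x) - (t (p z) - t (p x))) := by ring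
    have e2 : τ * t (p z) - τ * t (p x) = τ * (t (p z) - t (p x)) := by ring
    rw [e, e2, abs_mul, abs_mul, abs_of_pos hτ]
    have := mul_le_mul_of_nonneg_left (h4 (p z)) hτ.le
    linarith [key z]
  · have e : τ * Q (p z) - τ * Q (p x) = τ * (Q (p z) - Q (p x)) := by ring
    have e2 : τ * t (p z) - τ * t (p x) = τ * (t (p z) - t (p x)) := by ring
    rw [e, e2, abs_mul, abs_mul, abs_of_pos hτ]
    have := mul_le_mul_of_nonneg_left (h5 (p z)) hτ.le
    linarith [key z]

lemma gadgetU (n : ℕ) (M : ℕ → ℝ) (U δ : ℝ) (hδ : 0 < δ) : ∃ R : ℝ, ∀ (t : ℕ → X → ℝ) (υ : X → ℝ),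
    (∀ i < n, Differentiable ℝ (t i) ∧ ∀ x, ‖fderiv ℝ (t i) x‖ ≤ M i) →
    Differentiable ℝ υ → (∀ x, ‖fderiv ℝ υ x‖ ≤ U) → ∀ τ : ℝ, 0 < τ →
    ∃ (Q : ℕ → X → ℝ) (Z : X → ℝ), (∀ i < n, Differentiable ℝ (Q i)) ∧ Differentiable ℝ Z ∧
      (∀ x, ‖fderiv ℝ Z x‖ ≤ R) ∧ (∀ i < n, ∀ x, |Q i x - t i x| ≤ τ) ∧ (∀ x, |Z x - υ x| ≤ τ) ∧
      ∀ x, ∃ κ : ℕ → ℝ, (∀ i < n, StepAt δ δ (t i) (Q i) x (κ i)) ∧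
        (fderiv ℝ Z x = 0 ∨ ∀ i < n, κ i ≤ δ) := by
  let M' : ℕ → ℝ := fun i => |M i| + 1
  have hM' : ∀ i, 0 < M' i := fun i => by positivity
  let U' : ℝ := |U| + 1
  have hU' : 0 < U' := by positivity
  let t' : ℕ → (Fin (n+1) → ℝ) → ℝ := fun i v => M' i * v (Fin.ofNat (n+1) i)
  let υ' : (Fin (n+1) → ℝ) → ℝ := fun v => U' * v (Fin.last n)
  have hproj : ∀ j : Fin (n+1), DB (fun v : Fin (n+1) → ℝ => v j) := fun j => by
    have h : ∀ x, HasFDerivAt (fun v : Fin (n+1) → ℝ => v j)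
      (ContinuousLinearMap.proj (R := ℝ) (φ := fun _ => ℝ) j) x := fun x =>
        (ContinuousLinearMap.proj (R := ℝ) (φ := fun _ => ℝ) j).hasFDerivAt
    refine ⟨fun x => (h x).differentiableAt, ‖ContinuousLinearMap.proj (R := ℝ) (φ := fun _ : Fin (n+1) => ℝ) j‖, fun x => ?_⟩
    rw [(h x).fderiv]
  have ht' : ∀ i, DB (t' i) := fun i => (hproj _).const_mul _
  have hυ' : DB υ' := (hproj _).const_mul _
  obtain ⟨Q, Z, hQ, ⟨hZ, R, hR⟩, hQt, hZυ, hk⟩ := gadget t' ht' υ' hυ' δ 1 hδ one_pos n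
  refine ⟨R, fun t υ ht hυ hυb τ hτ => ?_⟩
  let p : X → (Fin (n+1) → ℝ) := fun x j =>
    if (j : ℕ) < n then (M' j * τ)⁻¹ * t j x else (U' * τ)⁻¹ * υ x
  have hp : Differentiable ℝ p := by
    rw [differentiable_pi]
    intro j
    by_cases h : (j : ℕ) < n
    · simp only [p, h, if_true]
      exact (ht j h).1.const_mul _
    · simp only [p, h, if_false]
      exact hυ.const_mul _
  have hpl : ∀ x z, ‖p z - p x‖ ≤ τ⁻¹ * ‖z - x‖ := by
    intro x z
    rw [pi_norm_le_iff_of_nonneg (by positivity)]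
    intro j
    by_cases h : (j : ℕ) < n
    · simp only [p, h, if_true, Pi.sub_apply]
      rw [← mul_sub, norm_mul, Real.norm_eq_abs, Real.norm_eq_abs, abs_of_pos (inv_pos.2 (mul_pos (hM' j) hτ))]
      calc _ ≤ (M' j * τ)⁻¹ * (M' j * ‖z - x‖) := by
            have := hM' j
            gcongr
            refine (lip_of_fderiv (ht j h).1 (ht j h).2 x z).trans ?_
            gcongr
            simp only [M']; linarith [le_abs_self (M j)]
        _ = _ := by have := (hM' j).ne'; field_simp
    · simp only [p, h, if_false, Pi.sub_apply]
      rw [← mul_sub, norm_mul, Real.norm_eq_abs, Real.norm_eq_abs, abs_of_pos (inv_pos.2 (mul_pos hU' hτ))]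
      calc _ ≤ (U' * τ)⁻¹ * (U' * ‖z - x‖) := by
            gcongr
            refine (lip_of_fderiv hυ hυb x z).trans ?_
            gcongr
            simp only [U']; linarith [le_abs_self U]
        _ = _ := by field_simp
  have et : ∀ i < n, t i = fun x => τ * t' i (p x) := by
    intro i hi
    funext x
    have h0 : ((Fin.ofNat (n+1) i : Fin (n+1)) : ℕ) = i := by
      simp [Fin.ofNat, Nat.mod_eq_of_lt (show i < n + 1 by omega)]
    have := (hM' i).ne'
    simp only [t', p, h0, hi, if_true]
    field_simp
  have eυ : υ = fun x => τ * υ' (p x) := by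
    funext x
    simp only [υ', p, Fin.val_last, lt_irrefl, if_false]
    field_simp
  have dQ : ∀ i x, HasFDerivAt (fun x => τ * Q i (p x)) (τ • (fderiv ℝ (Q i) (p x)).comp (fderiv ℝ p x)) x :=
    fun i x => (((hQ i).1 _).hasFDerivAt.comp x (hp x).hasFDerivAt).const_mul τ
  have dZ : ∀ x, HasFDerivAt (fun x => τ * Z (p x)) (τ • (fderiv ℝ Z (p x)).comp (fderiv ℝ p x)) x :=
    fun x => ((hZ _).hasFDerivAt.comp x (hp x).hasFDerivAt).const_mul τ
  refine ⟨fun i x => τ * Q i (p x), fun x => τ * Z (p x), fun i _ x => (dQ i x).differentiableAt,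
    fun x => (dZ x).differentiableAt, fun x => ?_, fun i hi x => ?_, fun x => ?_, fun x => ?_⟩
  · rw [(dZ x).fderiv, norm_smul, Real.norm_eq_abs, abs_of_pos hτ]
    have hn : ‖fderiv ℝ p x‖ ≤ τ⁻¹ := norm_fderiv_le_of_lip (by positivity) (hpl x)
    have hR0 : 0 ≤ R := (norm_nonneg _).trans (hR (p x))
    calc _ ≤ τ * (‖fderiv ℝ Z (p x)‖ * ‖fderiv ℝ p x‖) := by
          gcongr; exact ContinuousLinearMap.opNorm_comp_le _ _
      _ ≤ τ * (R * τ⁻¹) := by gcongr; exact hR _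
      _ = R := by field_simp
  · rw [et i hi]
    simp only
    rw [← mul_sub, abs_mul, abs_of_pos hτ]
    nlinarith [hQt i (p x)]
  · conv_lhs => rw [eυ]
    simp only
    rw [← mul_sub, abs_mul, abs_of_pos hτ]
    nlinarith [hZυ (p x)]
  · obtain ⟨κ, k1, k2⟩ := hk (p x)
    refine ⟨κ, fun i hi => ?_, ?_⟩
    · rw [et i hi]
      exact StepAt.pull hδ.le hτ (k1 i hi) ((ht' i).1 _) ((hQ i).1 _) (hp x) (hpl x)
    · refine k2.imp (fun h => ?_) id
      rw [(dZ x).fderiv, h]; simp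

lemma StepAt.blend {δ c c' κ τ : ℝ} {v V b : X → ℝ} {x : X} (hδ : 0 ≤ δ) (hc : 0 ≤ c) (hc' : 0 ≤ c')
    (h : StepAt δ c v V x κ) (hv : DifferentiableAt ℝ v x) (hV : DifferentiableAt ℝ V x)
    (hb : DifferentiableAt ℝ b x) (b0 : 0 ≤ b x) (b1 : b x ≤ 1) (hVv : ∀ z, |V z - v z| ≤ τ)
    (hbl : ∀ z, |b z - b x| * τ ≤ c' * ‖z - x‖) :
    StepAt δ (c + c') v (fun z => v z + b z * (V z - v z)) x (1 - b x + b x * κ) := by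
  obtain ⟨h1, h2, h3, h4, h5⟩ := h
  have hd : HasFDerivAt (fun z => v z + b z * (V z - v z))
      (fderiv ℝ v x + (b x • (fderiv ℝ V x - fderiv ℝ v x) + (V x - v x) • fderiv ℝ b x)) x :=
    hv.hasFDerivAt.add (hb.hasFDerivAt.mul (hV.hasFDerivAt.sub hv.hasFDerivAt))
  have hτ : 0 ≤ τ := (abs_nonneg _).trans (hVv x)
  have hbz : ∀ z w, |(b z - b x) * (V w - v w)| ≤ c' * ‖z - x‖ := fun z w => by
    rw [abs_mul]
    exact (mul_le_mul_of_nonneg_left (hVv w) (abs_nonneg _)).trans (hbl z)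
  have hmax : max 0 (1 - (1 - b x + b x * κ)) = b x * max 0 (1 - κ) := by
    rw [mul_max_of_nonneg _ _ b0]; congr 1 <;> ring
  refine ⟨by nlinarith, by nlinarith, ?_, fun z => ?_, fun z => ?_⟩
  · rw [hd.fderiv]
    have e : fderiv ℝ v x + (b x • (fderiv ℝ V x - fderiv ℝ v x) + (V x - v x) • fderiv ℝ b x) -
        (1 - b x + b x * κ) • fderiv ℝ v x = b x • (fderiv ℝ V x - κ • fderiv ℝ v x) +
          (V x - v x) • fderiv ℝ b x := by
      ext w; simp; ring
    rw [e]
    refine (norm_add_le _ _).trans (add_le_add ?_ ?_)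
    · rw [norm_smul, Real.norm_eq_abs, abs_of_nonneg b0]
      nlinarith [norm_nonneg (fderiv ℝ V x - κ • fderiv ℝ v x)]
    · have : HasFDerivAt (fun z => (V x - v x) * b z) ((V x - v x) • fderiv ℝ b x) x :=
        hb.hasFDerivAt.const_mul _
      rw [← this.fderiv]
      refine norm_fderiv_le_of_lip hc' (fun z => ?_)
      have := hbz z x
      rw [← mul_sub, mul_comm]; exact this
  · have e : v z + b z * (V z - v z) - (v x + b x * (V x - v x)) - (v z - v x) =
      b x * (V z - V x - (v z - v x)) + (b z - b x) * (V z - v z) := by ring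
    rw [e, hmax]
    refine (abs_add_le _ _).trans ?_
    rw [abs_mul (b x), abs_of_nonneg b0]
    have a1 := mul_le_mul_of_nonneg_left (h4 z) b0
    have a2 := hbz z z
    have a3 : b x * (δ * |v z - v x|) ≤ δ * |v z - v x| := mul_le_of_le_one_left (by positivity) b1
    have a4 : b x * (c * ‖z - x‖) ≤ c * ‖z - x‖ := mul_le_of_le_one_left (by positivity) b1
    nlinarith
  · have e : v z + b z * (V z - v z) - (v x + b x * (V x - v x)) =
      (1 - b x) * (v z - v x) + b x * (V z - V x) + (b z - b x) * (V z - v z) := by ring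
    rw [e]
    refine (abs_add_le _ _).trans ?_
    have a0 := abs_add_le ((1 - b x) * (v z - v x)) (b x * (V z - V x))
    rw [abs_mul (b x), abs_of_nonneg b0, abs_mul (1 - b x), abs_of_nonneg (by linarith : 0 ≤ 1 - b x)] at a0
    have a1 := mul_le_mul_of_nonneg_left (h5 z) b0
    have a2 := hbz z z
    have a3 : b x * (δ * |v z - v x|) ≤ δ * |v z - v x| := mul_le_of_le_one_left (by positivity) b1
    have a4 : b x * (c * ‖z - x‖) ≤ c * ‖z - x‖ := mul_le_of_le_one_left (by positivity) b1
    nlinarith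
end ApproxLp


namespace ApproxLp
variable {X : Type*} [NormedAddCommGroup X] [NormedSpace ℝ X]

/-- a system of disjoint shells -/
structure Shell (β : ℕ → X → ℝ) (s : ℕ → ℝ) (ρ : X → ℝ) : Prop where
  spos : ∀ k, 0 < s k
  diff : ∀ k, Differentiable ℝ (β k)
  nn : ∀ k x, 0 ≤ β k x
  le1 : ∀ k x, β k x ≤ 1
  disj : ∀ z k l, β k z ≠ 0 → β l z ≠ 0 → k = l
  lip : ∀ k x z, |β k z - β k x| * s k ≤ ‖z - x‖
  deg : ∀ x, (∀ k, β k x = 0) → ∀ ε > 0, ∀ᶠ z in nhds x, ∀ k, β k z * s k ≤ ε * ‖z - x‖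
  bd : ∀ k z, β k z * s k ≤ ρ z

/-- glueing along shells -/
noncomputable def glue (β : ℕ → X → ℝ) (v : X → ℝ) (V : ℕ → X → ℝ) : X → ℝ :=
  fun z => v z + ∑' k, β k z * (V k z - v z)

section
variable {β : ℕ → X → ℝ} {s : ℕ → ℝ} {ρ : X → ℝ} (hS : Shell β s ρ) {v : X → ℝ} {V : ℕ → X → ℝ}

include hS in
lemma glue_eq {z : X} {k : ℕ} (hk : β k z ≠ 0) : glue β v V z = v z + β k z * (V k z - v z) := by
  unfold glue
  rw [tsum_eq_single k]
  intro l hl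
  by_cases h : β l z = 0
  · simp [h]
  · exact absurd (hS.disj z l k h hk) hl

omit [NormedSpace ℝ X] in
lemma glue_none {z : X} (h : ∀ k, β k z = 0) : glue β v V z = v z := by
  unfold glue; simp [h]

include hS in
lemma glue_eq' (z : X) : ∃ k, glue β v V z = v z + β k z * (V k z - v z) := by
  by_cases h : ∀ k, β k z = 0
  · exact ⟨0, by rw [glue_none h, h 0]; ring⟩
  · push Not at h
    obtain ⟨k, hk⟩ := h
    exact ⟨k, glue_eq hS hk⟩

include hS in
lemma glue_near {x : X} {k : ℕ} (hk : β k x ≠ 0) :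
    glue β v V =ᶠ[nhds x] (fun z => v z + β k z * (V k z - v z)) := by
  filter_upwards [((hS.diff k).continuous.continuousAt (x := x)).eventually_ne hk] with z hz
  exact glue_eq hS hz

include hS in
lemma glue_fderiv {x : X} {k : ℕ} (hk : β k x ≠ 0) (hv : DifferentiableAt ℝ v x)
    (hV : DifferentiableAt ℝ (V k) x) :
    HasFDerivAt (glue β v V) (fderiv ℝ v x + (β k x • (fderiv ℝ (V k) x - fderiv ℝ v x) +
      (V k x - v x) • fderiv ℝ (β k) x)) x := by
  have hd : HasFDerivAt (fun z => v z + β k z * (V k z - v z))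
      (fderiv ℝ v x + (β k x • (fderiv ℝ (V k) x - fderiv ℝ v x) + (V k x - v x) • fderiv ℝ (β k) x)) x :=
    hv.hasFDerivAt.add ((hS.diff k x).hasFDerivAt.mul (hV.hasFDerivAt.sub hv.hasFDerivAt))
  exact hd.congr_of_eventuallyEq (glue_near hS hk)

include hS in
lemma glue_fderiv_one {x : X} {k : ℕ} (hk : β k x = 1) (hv : DifferentiableAt ℝ v x)
    (hV : DifferentiableAt ℝ (V k) x) : HasFDerivAt (glue β v V) (fderiv ℝ (V k) x) x := by
  have h := glue_fderiv hS (by rw [hk]; norm_num) hv hV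
  have h0 : fderiv ℝ (β k) x = 0 := by
    apply IsLocalMax.fderiv_eq_zero
    exact Eventually.of_forall (fun z => by rw [hk]; exact hS.le1 k z)
  rw [hk, h0] at h
  convert h using 1
  simp

include hS in
lemma glue_fderiv_none {c : ℝ} {x : X} (h : ∀ k, β k x = 0) (hv : DifferentiableAt ℝ v x)
    (hVv : ∀ k z, β k z ≠ 0 → |V k z - v z| ≤ c * s k) :
    HasFDerivAt (glue β v V) (fderiv ℝ v x) x := by
  have h0 : HasFDerivAt (fun z => ∑' k, β k z * (V k z - v z)) (0 : X →L[ℝ] ℝ) x := by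
    rw [hasFDerivAt_iff_isLittleO, Asymptotics.isLittleO_iff]
    intro ε hε
    filter_upwards [hS.deg x h (ε / (|c| + 1)) (by positivity)] with z hz
    have e1 : ∑' k, β k x * (V k x - v x) = 0 := by simp [h]
    rw [e1, zero_apply, sub_zero, sub_zero, Real.norm_eq_abs]
    have e2 : ∑' k, β k z * (V k z - v z) = glue β v V z - v z := by unfold glue; ring
    rw [e2]
    by_cases hz0 : ∀ k, β k z = 0
    · rw [glue_none hz0, sub_self, abs_zero]; positivity
    · push Not at hz0
      obtain ⟨k, hk⟩ := hz0
      rw [glue_eq hS hk]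
      have a := hVv k z hk
      have b := hz k
      have sp := hS.spos k
      have bn := hS.nn k z
      calc |v z + β k z * (V k z - v z) - v z| = β k z * |V k z - v z| := by
            rw [show v z + β k z * (V k z - v z) - v z = β k z * (V k z - v z) by ring, abs_mul,
              abs_of_nonneg bn]
        _ ≤ β k z * ((|c| + 1) * s k) := by
            gcongr
            refine a.trans ?_
            gcongr
            linarith [le_abs_self c]
        _ = (|c| + 1) * (β k z * s k) := by ring
        _ ≤ (|c| + 1) * (ε / (|c| + 1) * ‖z - x‖) := by gcongr
        _ = _ := by field_simp
  have : HasFDerivAt (fun z => v z + ∑' k, β k z * (V k z - v z)) (fderiv ℝ v x + 0) x :=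
    hv.hasFDerivAt.add h0
  rw [add_zero] at this
  exact this

include hS in
lemma shell_fderiv (k : ℕ) (x : X) : s k * ‖fderiv ℝ (β k) x‖ ≤ 1 := by
  have sp := hS.spos k
  have : ‖fderiv ℝ (β k) x‖ ≤ (s k)⁻¹ := norm_fderiv_le_of_lip (by positivity) (fun z => by
    rw [Real.norm_eq_abs, inv_mul_eq_div, le_div_iff₀ sp]; exact hS.lip k x z)
  calc _ ≤ s k * (s k)⁻¹ := by gcongr
    _ = 1 := by field_simp

include hS in
lemma glue_DB {c R : ℝ} (hc : 0 ≤ c) (hv : Differentiable ℝ v) (hvR : ∀ x, ‖fderiv ℝ v x‖ ≤ R)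
    (hV : ∀ k, Differentiable ℝ (V k)) (hVR : ∀ k x, ‖fderiv ℝ (V k) x‖ ≤ R)
    (hVv : ∀ k z, β k z ≠ 0 → |V k z - v z| ≤ c * s k) :
    Differentiable ℝ (glue β v V) ∧ ∀ x, ‖fderiv ℝ (glue β v V) x‖ ≤ R + c := by
  have key : ∀ x, ∃ D, HasFDerivAt (glue β v V) D x ∧ ‖D‖ ≤ R + c := fun x => by
    by_cases h : ∀ k, β k x = 0
    · exact ⟨_, glue_fderiv_none hS h (hv x) hVv, by linarith [hvR x]⟩
    · push Not at h
      obtain ⟨k, hk⟩ := h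
      refine ⟨_, glue_fderiv hS hk (hv x) (hV k x), ?_⟩
      have e : fderiv ℝ v x + (β k x • (fderiv ℝ (V k) x - fderiv ℝ v x) +
        (V k x - v x) • fderiv ℝ (β k) x) = (1 - β k x) • fderiv ℝ v x + β k x • fderiv ℝ (V k) x +
          (V k x - v x) • fderiv ℝ (β k) x := by ext w; simp; ring
      have b0 := hS.nn k x
      have b1 := hS.le1 k x
      rw [e]
      refine (norm_add_le _ _).trans (add_le_add ((norm_add_le _ _).trans ?_) ?_)
      · rw [norm_smul, norm_smul, Real.norm_eq_abs, Real.norm_eq_abs, abs_of_nonneg b0,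
          abs_of_nonneg (by linarith : 0 ≤ 1 - β k x)]
        nlinarith [hvR x, hVR k x]
      · rw [norm_smul, Real.norm_eq_abs]
        have := shell_fderiv hS k x
        calc _ ≤ c * s k * ‖fderiv ℝ (β k) x‖ := by gcongr; exact hVv k x hk
          _ = c * (s k * ‖fderiv ℝ (β k) x‖) := by ring
          _ ≤ c * 1 := by gcongr
          _ = c := mul_one c
  refine ⟨fun x => ?_, fun x => ?_⟩
  · obtain ⟨D, hD, -⟩ := key x; exact hD.differentiableAt
  · obtain ⟨D, hD, h⟩ := key x; rw [hD.fderiv]; exact h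

include hS in
lemma glue_sub {c : ℝ} (hc : 0 ≤ c) (hVv : ∀ k z, β k z ≠ 0 → |V k z - v z| ≤ c * s k) (z : X)
    (hρ : 0 ≤ ρ z) :
    |glue β v V z - v z| ≤ c * ρ z := by
  by_cases h : ∀ k, β k z = 0
  · rw [glue_none h, sub_self, abs_zero]; positivity
  · push Not at h
    obtain ⟨k, hk⟩ := h
    rw [glue_eq hS hk, show v z + β k z * (V k z - v z) - v z = β k z * (V k z - v z) by ring, abs_mul,
      abs_of_nonneg (hS.nn k z)]
    have b0 := hS.nn k z
    calc _ ≤ β k z * (c * s k) := by gcongr; exact hVv k z hk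
      _ = c * (β k z * s k) := by ring
      _ ≤ c * ρ z := by gcongr; exact hS.bd k z

omit hS in
lemma StepAt.perturb {δ c c' κ : ℝ} {v V W : X → ℝ} {x : X} (hc' : 0 ≤ c') (h : StepAt δ c v V x κ)
    (hW : W =ᶠ[nhds x] V) (hl : ∀ z, |W z - V z| ≤ c' * ‖z - x‖) : StepAt δ (c + c') v W x κ := by
  obtain ⟨h1, h2, h3, h4, h5⟩ := h
  have e0 := hW.eq_of_nhds
  refine ⟨h1, h2, ?_, fun z => ?_, fun z => ?_⟩
  · rw [hW.fderiv_eq]; linarith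
  · have e : W z - W x - (v z - v x) = (V z - V x - (v z - v x)) + (W z - V z) := by rw [e0]; ring
    rw [e]
    refine (abs_add_le _ _).trans ?_
    linarith [h4 z, hl z]
  · have e : W z - W x = (V z - V x) + (W z - V z) := by rw [e0]; ring
    rw [e]
    refine (abs_add_le _ _).trans ?_
    linarith [h5 z, hl z]

include hS in
lemma glue_step {δ c κ : ℝ} {x : X} {k : ℕ} (hδ : 0 ≤ δ) (hc : 0 ≤ c) (hk : β k x ≠ 0)
    (h : StepAt δ c v (V k) x κ) (hv : Differentiable ℝ v) (hV : Differentiable ℝ (V k))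
    (hVv : ∀ k z, |V k z - v z| ≤ c * s k) :
    StepAt δ (c + c + c) v (glue β v V) x (1 - β k x + β k x * κ) := by
  refine StepAt.perturb hc (StepAt.blend hδ hc hc h (hv x) (hV x) (hS.diff k x) (hS.nn k x) (hS.le1 k x)
    (hVv k) (fun z => ?_)) (glue_near hS hk) (fun z => ?_)
  · have := hS.lip k x z
    calc _ = c * (|β k z - β k x| * s k) := by ring
      _ ≤ _ := by gcongr
  · by_cases hz : β k z = 0
    · obtain ⟨l, hl⟩ := glue_eq' hS (v := v) (V := V) z
      rw [hl, hz]
      by_cases hlk : l = k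
      · rw [hlk, hz]; simp; positivity
      · have : β l x = 0 := by
          by_contra hne
          exact hlk (hS.disj x l k hne hk)
        have a := hS.lip l x z
        rw [this, sub_zero, abs_of_nonneg (hS.nn l z)] at a
        have b0 := hS.nn l z
        rw [show v z + β l z * (V l z - v z) - (v z + 0 * (V k z - v z)) = β l z * (V l z - v z) by ring,
          abs_mul, abs_of_nonneg b0]
        calc _ ≤ β l z * (c * s l) := by gcongr; exact hVv l z
          _ = c * (β l z * s l) := by ring
          _ ≤ _ := by gcongr
    · rw [glue_eq hS hz, sub_self, abs_zero]; positivity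

include hS in
lemma glue_step_none {δ c : ℝ} {x : X} (hδ : 0 ≤ δ) (hc : 0 ≤ c) (hx : ∀ k, β k x = 0)
    (hv : Differentiable ℝ v)
    (hVv : ∀ k z, |V k z - v z| ≤ c * s k) :
    StepAt δ c v (glue β v V) x 1 := by
  have hl : ∀ z, |glue β v V z - v z| ≤ c * ‖z - x‖ := fun z => by
    obtain ⟨l, hl⟩ := glue_eq' hS (v := v) (V := V) z
    have a := hS.lip l x z
    rw [hx l, sub_zero, abs_of_nonneg (hS.nn l z)] at a
    have b0 := hS.nn l z
    rw [hl, show v z + β l z * (V l z - v z) - v z = β l z * (V l z - v z) by ring,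
      abs_mul, abs_of_nonneg b0]
    calc _ ≤ β l z * (c * s l) := by gcongr; exact hVv l z
      _ = c * (β l z * s l) := by ring
      _ ≤ _ := by gcongr
  have e0 : glue β v V x = v x := glue_none hx
  refine ⟨by linarith, by linarith, ?_, fun z => ?_, fun z => ?_⟩
  · rw [(glue_fderiv_none hS hx (hv x) (fun k z _ => hVv k z)).fderiv]; simpa using hc
  · rw [e0, show glue β v V z - v x - (v z - v x) = glue β v V z - v z by ring]
    have : 0 ≤ (δ + 152 * max 0 (1 - 1)) * |v z - v x| := by positivity
    linarith [hl z]
  · rw [e0, show glue β v V z - v x = (v z - v x) + (glue β v V z - v z) by ring]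
    refine (abs_add_le _ _).trans ?_
    nlinarith [hl z, abs_nonneg (v z - v x)]
end
end ApproxLp


namespace ApproxLp
variable {X : Type*} [NormedAddCommGroup X] [NormedSpace ℝ X]

lemma StepAt.mono {δ c δ' c' κ : ℝ} {v V : X → ℝ} {x : X} (hδ : δ ≤ δ') (hc : c ≤ c')
    (h : StepAt δ c v V x κ) : StepAt δ' c' v V x κ := by
  obtain ⟨h1, h2, h3, h4, h5⟩ := h
  refine ⟨by linarith, by linarith, by linarith, fun z => (h4 z).trans ?_, fun z => (h5 z).trans ?_⟩
  · gcongr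
  · gcongr

lemma exists_Lambda : ∃ (Λ Λ' : ℝ → ℝ) (C : ℝ), (∀ t, HasDerivAt Λ (Λ' t) t) ∧ (∀ t, |Λ' t| ≤ C) ∧
    (∀ t, 0 ≤ Λ t) ∧ (∀ t, Λ t ≤ 1) ∧ (∀ t, t ≤ 0 → Λ t = 0) ∧ (∀ t, 1 ≤ t → Λ t = 1) := by
  have hcd : ContDiff ℝ 1 Real.smoothTransition := Real.smoothTransition.contDiff
  have hd : Differentiable ℝ Real.smoothTransition := hcd.differentiable (by norm_num)
  have hc : Continuous (deriv Real.smoothTransition) := hcd.continuous_deriv (by norm_num)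
  obtain ⟨C, hC⟩ := isCompact_Icc.exists_bound_of_continuousOn (s := Set.Icc (0:ℝ) 1) hc.continuousOn
  have hC0 : 0 ≤ C := (norm_nonneg _).trans (hC 0 (by simp))
  refine ⟨Real.smoothTransition, deriv Real.smoothTransition, C, fun t => (hd t).hasDerivAt, fun t => ?_,
    Real.smoothTransition.nonneg, Real.smoothTransition.le_one,
    fun t ht => Real.smoothTransition.zero_of_nonpos ht, fun t ht => Real.smoothTransition.one_of_one_le ht⟩
  by_cases h : t ∈ Set.Icc (0:ℝ) 1
  · exact hC t h
  · have : deriv Real.smoothTransition t = 0 := by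
      rw [Set.mem_Icc, not_and_or, not_le, not_le] at h
      rcases h with h | h
      · have : Real.smoothTransition =ᶠ[nhds t] fun _ => 0 := by
          filter_upwards [gt_mem_nhds h] with z hz
          exact Real.smoothTransition.zero_of_nonpos hz.le
        rw [this.deriv_eq]; simp
      · have : Real.smoothTransition =ᶠ[nhds t] fun _ => 1 := by
          filter_upwards [lt_mem_nhds h] with z hz
          exact Real.smoothTransition.one_of_one_le hz.le
        rw [this.deriv_eq]; simp
    rw [this]; simpa using hC0

lemma toolstep (N : ℕ) (Y : ℕ → X → ℝ) (hY : ∀ i, DB (Y i)) (u : X → ℝ) (hu : DB u)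
    {β : ℕ → X → ℝ} {s : ℕ → ℝ} {ρ : X → ℝ} (hS : Shell β s ρ) (hs1 : ∀ k, s k ≤ 1)
    (hρ0 : ∀ x, 0 ≤ ρ x) (hρ1 : ∀ x, ρ x ≤ 1)
    (l : ℕ → X → ℝ) (hl : ∀ i, DB (l i)) (l0 : ∀ i x, 0 ≤ l i x) (l1 : ∀ i x, l i x ≤ 1)
    (δ e : ℝ) (hδ : 0 < δ) (he : 0 < e) :
    ∃ Y' : ℕ → X → ℝ, (∀ i, DB (Y' i)) ∧ (∀ i < N, ∀ z, |Y' i z - Y i z| ≤ e * l i z) ∧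
      (∀ i > N, Y' i = Y i) ∧
      (∀ z, |Y' N z - u z| ≤ e * ρ z) ∧ ∀ x, ∃ κ : ℕ → ℝ, (∀ i < N, StepAt δ δ (Y i) (Y' i) x (κ i)) ∧
        ((∃ k, β k x = 1) → fderiv ℝ (Y' N) x = 0 ∨ ∀ i < N, l i x = 1 → κ i ≤ δ) := by
  choose hYd M hM using hY
  choose hld L hL using hl
  obtain ⟨hud, U, hU⟩ := hu
  obtain ⟨R, hR⟩ := gadgetU (X := X) N M U (δ/6) (by positivity)
  set LL : ℝ := ∑ i ∈ Finset.range N, |L i| with hLL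
  have hLL0 : 0 ≤ LL := Finset.sum_nonneg (fun i _ => abs_nonneg _)
  have hLi : ∀ i < N, L i ≤ LL := fun i hi => (le_abs_self _).trans
    (Finset.single_le_sum (f := fun i => |L i|) (fun i _ => abs_nonneg _) (Finset.mem_range.2 hi))
  set c : ℝ := min e (δ / (6 * (1 + LL))) with hcdef
  have hc0 : 0 < c := by positivity
  have hce : c ≤ e := min_le_left _ _
  have hcL : LL * c ≤ δ/6 := by
    have : c ≤ δ / (6 * (1 + LL)) := min_le_right _ _
    calc LL * c ≤ (1 + LL) * (δ / (6 * (1 + LL))) := by gcongr; linarith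
      _ = δ/6 := by field_simp
  have hcδ : c ≤ δ/6 := by
    refine (min_le_right _ _).trans ?_
    rw [div_le_div_iff₀ (by positivity) (by positivity)]
    nlinarith
  have H := fun k => hR Y u (fun i _ => ⟨hYd i, hM i⟩) hud hU (c * s k) (mul_pos hc0 (hS.spos k))
  choose Q Z hQd hZd hZR hQY hZu hκ using H
  let V : ℕ → ℕ → X → ℝ := fun i k z => Y i z + l i z * (Q k i z - Y i z)
  have hVd : ∀ i < N, ∀ k, Differentiable ℝ (V i k) := fun i hi k =>
    (hYd i).add ((hld i).mul ((hQd k i hi).sub (hYd i)))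
  have hVabs : ∀ i < N, ∀ k z, |V i k z - Y i z| ≤ l i z * (c * s k) := fun i hi k z => by
    simp only [V]
    rw [add_sub_cancel_left, abs_mul, abs_of_nonneg (l0 i z)]
    exact mul_le_mul_of_nonneg_left (hQY k i hi z) (l0 i z)
  have hVabs' : ∀ i < N, ∀ k z, |V i k z - Y i z| ≤ δ/3 * s k := fun i hi k z => by
    refine (hVabs i hi k z).trans ?_
    have := hS.spos k
    calc l i z * (c * s k) ≤ 1 * (c * s k) := by gcongr; exact l1 i z
      _ = c * s k := one_mul _
      _ ≤ δ/3 * s k := by gcongr; linarith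
  have hstep1 : ∀ i < N, ∀ k x κ, StepAt (δ/6) (δ/6) (Y i) (Q k i) x κ →
      StepAt (δ/6) (δ/3) (Y i) (V i k) x (1 - l i x + l i x * κ) := fun i hi k x κ h => by
    refine (StepAt.blend (c' := δ/6) (τ := c * s k) (by positivity) (by positivity) (by positivity) h (hYd i x)
      (hQd k i hi x) (hld i x) (l0 i x) (l1 i x) (hQY k i hi) (fun z => ?_)).mono le_rfl (by linarith)
    have h1 := lip_of_fderiv (hld i) (hL i) x z
    have := hS.spos k
    calc |l i z - l i x| * (c * s k) ≤ (LL * ‖z - x‖) * (c * 1) := by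
          gcongr
          · refine h1.trans ?_
            gcongr
            exact hLi i hi
          · exact hs1 k
      _ = (LL * c) * ‖z - x‖ := by ring
      _ ≤ _ := by gcongr
  have hZu' : ∀ k z, β k z ≠ 0 → |Z k z - u z| ≤ c * s k := fun k z _ => hZu k z
  have hmain : ∀ x, ∃ κ : ℕ → ℝ, (∀ i < N, StepAt δ δ (Y i) (glue β (Y i) (V i)) x (κ i)) ∧
        ((∃ k, β k x = 1) → fderiv ℝ (glue β u Z) x = 0 ∨ ∀ i < N, l i x = 1 → κ i ≤ δ) := by
    intro x
    by_cases hx : ∀ k, β k x = 0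
    · refine ⟨fun _ => 1, fun i hi => ?_, ?_⟩
      · exact (glue_step_none hS (δ := δ) (c := δ/3) hδ.le (by positivity) hx (hYd i) (hVabs' i hi)).mono le_rfl
          (by linarith)
      · rintro ⟨k, hk⟩; rw [hx k] at hk; norm_num at hk
    · push Not at hx
      obtain ⟨k, hk⟩ := hx
      obtain ⟨κ0, hκ0, hκ1⟩ := hκ k x
      refine ⟨fun i => 1 - β k x + β k x * (1 - l i x + l i x * κ0 i), fun i hi => ?_, ?_⟩
      · exact (glue_step hS (by positivity) (by positivity) hk (hstep1 i hi k x _ (hκ0 i hi)) (hYd i) (hVd i hi k)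
          (hVabs' i hi)).mono (by linarith) (by linarith)
      · rintro ⟨k', hk'⟩
        have : k' = k := hS.disj x k' k (by rw [hk']; norm_num) hk
        subst this
        rcases hκ1 with h | h
        · left
          rw [(glue_fderiv_one hS hk' (hud x) (hZd k' x)).fderiv, h]
        · right
          intro i hi hli
          simp only [hk', hli]
          linarith [h i hi]
  refine ⟨fun i => if i < N then glue β (Y i) (V i) else if i = N then glue β u Z else Y i, fun i => ?_, fun i hi z => ?_,
    fun i hi => ?_, fun z => ?_, fun x => ?_⟩
  · by_cases h1 : i < N
    · simp only [h1, if_true]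
      refine ⟨fun x => ?_, (1 + δ) * M i + δ, fun x => ?_⟩
      · by_cases hx : ∀ k, β k x = 0
        · exact (glue_fderiv_none hS hx (hYd i x) (fun k z _ => hVabs' i h1 k z)).differentiableAt
        · push Not at hx
          obtain ⟨k, hk⟩ := hx
          exact (glue_fderiv hS hk (hYd i x) (hVd i h1 k x)).differentiableAt
      · obtain ⟨κ, h, -⟩ := hmain x
        obtain ⟨a1, a2, a3, -⟩ := h i h1
        have e1 : fderiv ℝ (glue β (Y i) (V i)) x = (fderiv ℝ (glue β (Y i) (V i)) x - κ i • fderiv ℝ (Y i) x) + κ i • fderiv ℝ (Y i) x := by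
          abel
        rw [e1]
        refine (norm_add_le _ _).trans ?_
        rw [norm_smul, Real.norm_eq_abs]
        have : |κ i| ≤ 1 + δ := by rw [abs_le]; constructor <;> linarith
        have : |κ i| * ‖fderiv ℝ (Y i) x‖ ≤ (1 + δ) * M i := by gcongr; exact hM i x
        linarith
    · by_cases h2 : i = N
      · simp only [h1, h2, if_false, if_true, lt_irrefl]
        obtain ⟨a, b⟩ := glue_DB hS (v := u) (V := Z) (R := max U R) hc0.le hud (fun x => (hU x).trans (le_max_left _ _)) hZd
          (fun k x => (hZR k x).trans (le_max_right _ _)) hZu'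
        exact ⟨a, _, b⟩
      · simp only [h1, h2, if_false]
        exact ⟨hYd i, M i, hM i⟩
  · simp only [hi, if_true]
    obtain ⟨k, hk⟩ := glue_eq' hS (v := Y i) (V := V i) z
    rw [hk, add_sub_cancel_left, abs_mul, abs_of_nonneg (hS.nn k z)]
    have b0 := hS.nn k z
    have := l0 i z
    calc _ ≤ β k z * (l i z * (c * s k)) := by gcongr; exact hVabs i hi k z
      _ = c * l i z * (β k z * s k) := by ring
      _ ≤ e * l i z * 1 := by
        have := hS.spos k
        gcongr
        exact (hS.bd k z).trans (hρ1 z)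
      _ = _ := mul_one _
  · have h1 : ¬ i < N := by omega
    have h2 : i ≠ N := by omega
    simp only [h1, h2, if_false]
  · simp only [lt_irrefl, if_false, if_true]
    have h1 := hρ0 z
    refine (glue_sub hS hc0.le hZu' z h1).trans ?_
    gcongr
  · obtain ⟨κ, a, b⟩ := hmain x
    refine ⟨κ, fun i hi => ?_, ?_⟩
    · simp only [hi, if_true]; exact a i hi
    · simp only [lt_irrefl, if_false, if_true]; exact b
end ApproxLp


namespace ApproxLp
variable {X : Type*} [NormedAddCommGroup X] [NormedSpace ℝ X]

lemma exists_rec {S : Type*} (P : ℕ → S → S → Prop) (h : ∀ n s, ∃ s', P n s s') (s0 : S) :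
    ∃ F : ℕ → S, F 0 = s0 ∧ ∀ n, P n (F n) (F (n+1)) := by
  choose f hf using h
  exact ⟨fun n => Nat.rec s0 (fun n s => f n s) n, rfl, fun n => hf n _⟩

lemma tool1 (u : ℕ → X → ℝ) (hu : ∀ N, DB (u N)) (ρ : ℕ → X → ℝ) (hρ : ∀ N, DB (ρ N))
    (hρ0 : ∀ N x, 0 ≤ ρ N x) (hρ1 : ∀ N x, ρ N x ≤ 1) (β : ℕ → ℕ → X → ℝ) (s : ℕ → ℕ → ℝ)
    (hS : ∀ N, Shell (β N) (s N) (ρ N)) (hs1 : ∀ N k, s N k ≤ 1) (ε : ℕ → ℝ) (hε : ∀ N, 0 < ε N) :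
    ∃ y : ℕ → X → ℝ, (∀ N, DB (y N)) ∧ (∀ N x, |y N x - u N x| ≤ ε N * ρ N x) ∧
      ∀ x, ∀ e > 0, ∀ᶠ N in atTop, (∃ k, β N k x = 1) → ‖fderiv ℝ (y N) x‖ ≤ e := by
  obtain ⟨Λ, Λ', C, hΛ, hΛC, Λ0, Λ1, Λz, Λo⟩ := exists_Lambda
  have hC0 : 0 ≤ C := (abs_nonneg _).trans (hΛC 0)
  have hΛlin : ∀ t, 0 ≤ t → Λ t ≤ C * t := fun t ht => by
    have := lip_of_deriv hΛ hΛC 0 t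
    rw [Λz 0 le_rfl, sub_zero, sub_zero, abs_of_nonneg (Λ0 t), abs_of_nonneg ht] at this
    exact this
  let l : ℕ → ℕ → X → ℝ := fun N i x => Λ (((N:ℝ) + 1) * ρ i x)
  have hl : ∀ N i, DB (l N i) := fun N i => ((hρ i).const_mul _).comp hΛ hΛC
  let δ : ℕ → ℝ := fun N => (1/2)^N
  have hδ : ∀ N, 0 < δ N := fun N => by positivity
  have he : ∀ N : ℕ, ∃ e : ℝ, 0 < e ∧ ∀ i ≤ N, e * (C * (N + 1)) ≤ δ N / 8 * ε i ∧ e ≤ ε i / 4 := fun N => by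
    set m := (Finset.range (N+1)).inf' ⟨0, by simp⟩ ε with hm
    have hm0 : 0 < m := (Finset.lt_inf'_iff _).2 (fun i _ => hε i)
    have hmi : ∀ i ≤ N, m ≤ ε i := fun i hi => Finset.inf'_le _ (Finset.mem_range.2 (by omega))
    refine ⟨min (m/4) (δ N / 8 * m / (C * (N+1) + 1)), ?_, fun i hi => ⟨?_, (min_le_left _ _).trans (by linarith [hmi i hi])⟩⟩
    · have := hδ N; positivity
    · have := hδ N
      calc _ ≤ (δ N / 8 * m / (C * (N+1) + 1)) * (C * (N + 1) + 1) := by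
            gcongr
            · exact min_le_right _ _
            · linarith
        _ = δ N / 8 * m := by field_simp
        _ ≤ _ := by gcongr; exact hmi i hi
  choose e he0 he1 using he
  let S := {Y : ℕ → X → ℝ // ∀ i, DB (Y i)}
  obtain ⟨F, -, hF⟩ := exists_rec (S := S) (fun N Y Y' => (∀ i < N, ∀ z, |Y'.1 i z - Y.1 i z| ≤ e N * l N i z) ∧
      (∀ z, |Y'.1 N z - u N z| ≤ e N * ρ N z) ∧ ∀ x, ∃ κ : ℕ → ℝ, (∀ i < N, StepAt (δ N) (δ N) (Y.1 i) (Y'.1 i) x (κ i)) ∧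
        ((∃ k, β N k x = 1) → fderiv ℝ (Y'.1 N) x = 0 ∨ ∀ i < N, l N i x = 1 → κ i ≤ δ N))
    (fun N Y => by
      obtain ⟨Y', h1, h2, -, h3, h4⟩ := toolstep N Y.1 Y.2 (u N) (hu N) (hS N) (hs1 N) (hρ0 N) (hρ1 N) (l N) (hl N)
        (fun i x => Λ0 _) (fun i x => Λ1 _) (δ N) (e N) (hδ N) (he0 N)
      exact ⟨⟨Y', h1⟩, h2, h3, h4⟩) ⟨u, hu⟩
  choose hF1 hF2 κ hF3 hF4 using hF
  -- the sequence for index i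
  let b : ℕ → ℕ → X → ℝ := fun i q => (F (q + (i+1))).1 i
  have hbs : ∀ i q z, dist (b i q z) (b i (q+1) z) ≤ ((1/2)^q * (ε i * ρ i z / 8)) := fun i q z => by
    rw [dist_comm, Real.dist_eq]
    simp only [b]
    rw [show q + 1 + (i+1) = q + (i+1) + 1 by ring]
    refine (hF1 (q + (i+1)) i (by omega) z).trans ?_
    have h1 : l (q + (i+1)) i z ≤ C * ((((q + (i+1) : ℕ):ℝ) + 1) * ρ i z) := hΛlin _ (mul_nonneg (by positivity) (hρ0 i z))
    have h2 := (he1 (q + (i+1)) i (by omega)).1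
    have h3 := hρ0 i z
    have h4 : δ (q + (i+1)) ≤ (1/2)^q := by
      simp only [δ]
      exact pow_le_pow_of_le_one (by norm_num) (by norm_num) (by omega)
    have h5 := he0 (q + (i+1))
    have h6 := hε i
    calc _ ≤ e (q + (i+1)) * (C * ((((q + (i+1) : ℕ):ℝ) + 1) * ρ i z)) := by gcongr
      _ = e (q + (i+1)) * (C * ((((q + (i+1) : ℕ):ℝ) + 1))) * ρ i z := by ring
      _ ≤ δ (q + (i+1)) / 8 * ε i * ρ i z := by gcongr
      _ ≤ (1/2)^q / 8 * ε i * ρ i z := by gcongr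
      _ = _ := by ring
  have hsum : ∀ i z, Summable (fun q : ℕ => ((1/2:ℝ)^q * (ε i * ρ i z / 8))) := fun i z =>
    summable_geometric_two.mul_right _
  have hlim : ∀ i z, ∃ L, Tendsto (fun q => b i q z) atTop (nhds L) := fun i z =>
    cauchySeq_tendsto_of_complete (cauchySeq_of_dist_le_of_summable _ (hbs i · z) (hsum i z))
  choose y hy using hlim
  have hbd : ∀ i q, DB (b i q) := fun i q => (F _).2 i
  let g : ℕ → ℕ → ℝ := fun i q => δ (q + (i+1))
  have hg0 : ∀ i q, 0 ≤ g i q := fun i q => (hδ _).le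
  have hgs : ∀ i, Summable (g i) := fun i => (summable_nat_add_iff (f := δ) (i+1)).2 summable_geometric_two
  have hgt : ∀ i, ∑' q, g i q = (1/2)^i := fun i => by
    simp only [g, δ, pow_add]
    rw [tsum_mul_right, tsum_geometric_two]; ring
  have hstep : ∀ i x q, StepAt (g i q) (g i q) (b i q) (b i (q+1)) x (κ (q + (i+1)) x i) := fun i x q => by
    have := hF3 (q + (i+1)) x i (by omega)
    simp only [b]
    rw [show q + 1 + (i+1) = q + (i+1) + 1 by ring]
    exact this
  have hyd : ∀ i, Differentiable ℝ (y i) := fun i x =>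
    lim_diff (fun q => (hbd i q).1 x) (hg0 i) (hgs i) (hstep i x) (hy i)
  have hyb : ∀ i x, ‖fderiv ℝ (y i) x‖ ≤ Real.exp 1 * (‖fderiv ℝ (b i 0) x‖ + (1/2)^i) := fun i x => by
    have := lim_bound (fun q => (hbd i q).1 x) (hg0 i) (hgs i) (hstep i x) (hy i) (hyd i x).hasFDerivAt 0
    simp only [add_zero, hgt] at this
    refine this.trans ?_
    gcongr
    exact pow_le_one₀ (by norm_num) (by norm_num)
  refine ⟨y, fun i => ⟨hyd i, ?_⟩, fun i x => ?_, fun x r hr => ?_⟩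
  · obtain ⟨M, hM⟩ := (hbd i 0).2
    refine ⟨Real.exp 1 * (M + (1/2)^i), fun x => (hyb i x).trans ?_⟩
    gcongr
    exact hM x
  · have h1 := dist_le_tsum_of_dist_le_of_tendsto₀ _ (hbs i · x) (hsum i x) (hy i x)
    rw [tsum_mul_right, tsum_geometric_two, dist_comm, Real.dist_eq] at h1
    have h2 : |b i 0 x - u i x| ≤ e i * ρ i x := by
      have := hF2 i x
      simpa [b] using this
    have h3 := (he1 i i le_rfl).2
    have h4 := mul_le_mul_of_nonneg_right h3 (hρ0 i x)
    have h5 := mul_nonneg (hε i).le (hρ0 i x)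
    have := abs_sub_le (y i x) (b i 0 x) (u i x)
    linarith
  · by_cases hinf : ∀ L, ∃ N, L ≤ N ∧ (∃ k, β N k x = 1) ∧ fderiv ℝ ((F (N+1)).1 N) x ≠ 0
    · refine Eventually.of_forall (fun i hi => ?_)
      obtain ⟨k, hk⟩ := hi
      have hpos : 0 < ρ i x := by
        have := (hS i).bd k x
        rw [hk, one_mul] at this
        exact ((hS i).spos k).trans_le this
      have : fderiv ℝ (y i) x = 0 := by
        refine lim_flat (fun q => (hbd i q).1 x) (hg0 i) (hgs i) (hstep i x) (hy i) (fun L => ?_)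
        obtain ⟨K, hK⟩ := exists_nat_gt (ρ i x)⁻¹
        obtain ⟨N, hN, h1, h2⟩ := hinf (L + (i+1) + K)
        refine ⟨N - (i+1), by omega, ?_⟩
        have h3 : N - (i+1) + (i+1) = N := by omega
        simp only [g]
        rw [h3]
        refine ((hF4 N x h1).resolve_left h2) i (by omega) ?_
        refine Λo _ ?_
        have : (K:ℝ) ≤ N := by exact_mod_cast (by omega : K ≤ N)
        calc (1:ℝ) = (ρ i x)⁻¹ * ρ i x := by field_simp
          _ ≤ _ := by gcongr; linarith
      rw [this]; simpa using hr.le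
    · push Not at hinf
      obtain ⟨L, hL⟩ := hinf
      have ht : Tendsto (fun i : ℕ => Real.exp 1 * (1/2:ℝ)^i) atTop (nhds 0) := by
        have := (tendsto_pow_atTop_nhds_zero_of_lt_one (r := (1/2:ℝ)) (by norm_num) (by norm_num)).const_mul (Real.exp 1)
        simpa using this
      filter_upwards [eventually_ge_atTop L, ht.eventually (gt_mem_nhds hr)] with i hi h2 h3
      have h4 : fderiv ℝ (b i 0) x = 0 := by
        have := hL i hi h3
        simpa [b] using this
      have := hyb i x
      rw [h4, norm_zero, zero_add] at this
      linarith
end ApproxLp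


namespace ApproxLp
variable {X : Type*} [NormedAddCommGroup X] [NormedSpace ℝ X]

lemma exists_bump (c r R : ℝ) (hr : 0 < r) (hR : r < R) : ∃ (g g' : ℝ → ℝ) (C : ℝ),
    (∀ t, HasDerivAt g (g' t) t) ∧ (∀ t, |g' t| ≤ C) ∧
    (∀ t, 0 ≤ g t) ∧ (∀ t, g t ≤ 1) ∧ (∀ t, |t - c| ≤ r → g t = 1) ∧ (∀ t, R ≤ |t - c| → g t = 0) := by
  let f : ContDiffBump c := ⟨r, R, hr, hR⟩
  have hcd : ContDiff ℝ 1 (f : ℝ → ℝ) := f.contDiff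
  have hd : Differentiable ℝ (f : ℝ → ℝ) := hcd.differentiable (by norm_num)
  have hc : Continuous (deriv (f : ℝ → ℝ)) := hcd.continuous_deriv (by norm_num)
  have hcs : HasCompactSupport (deriv (f : ℝ → ℝ)) := f.hasCompactSupport.deriv
  obtain ⟨C, hC⟩ := hcs.exists_bound_of_continuous hc
  refine ⟨f, deriv f, C, fun t => (hd t).hasDerivAt, hC, fun t => f.nonneg, fun t => f.le_one,
    fun t ht => f.one_of_mem_closedBall (by simpa [Real.dist_eq] using ht), fun t ht =>
      f.zero_of_le_dist (by simpa [Real.dist_eq] using ht)⟩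

lemma exists_shell {ρ : X → ℝ} (hρ : DB ρ) (hρ0 : ∀ x, 0 ≤ ρ x) {g g' : ℝ → ℝ} {C : ℝ}
    (hg : ∀ t, HasDerivAt g (g' t) t) (hC : ∀ t, |g' t| ≤ C) (g0 : ∀ t, 0 ≤ g t) (g1 : ∀ t, g t ≤ 1)
    (gs : ∀ t, g t ≠ 0 → 1/2 < t ∧ t < 2) :
    ∃ a : ℝ, 0 < a ∧ a ≤ 1 ∧ Shell (fun k x => g (4^k * ρ x)) (fun k => a * (1/4)^k) ρ := by
  obtain ⟨hd, K, hK⟩ := hρ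
  have hC0 : 0 ≤ C := (abs_nonneg _).trans (hC 0)
  have hK0 : 0 ≤ K := (norm_nonneg _).trans (hK 0)
  set a : ℝ := min (1/2) (1 / (C * K + 1)) with ha
  have ha0 : 0 < a := by positivity
  have ha1 : a ≤ 1/2 := min_le_left _ _
  have ha2 : C * K * a ≤ 1 := by
    have : a ≤ 1 / (C * K + 1) := min_le_right _ _
    calc C * K * a ≤ (C * K + 1) * (1 / (C * K + 1)) := by gcongr; linarith
      _ = 1 := by field_simp
  have hp : ∀ k : ℕ, (4:ℝ)^k * (1/4)^k = 1 := fun k => by rw [← mul_pow]; norm_num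
  have hbdiff : ∀ k, Differentiable ℝ (fun x => g (4^k * ρ x)) := fun k x =>
    (hg _).differentiableAt.comp x ((hd x).const_mul _)
  have hbd : ∀ (k : ℕ) (z : X), g (4^k * ρ z) * (a * (1/4)^k) ≤ ρ z := fun k z => by
    by_cases h : g (4^k * ρ z) = 0
    · rw [h, zero_mul]; exact hρ0 z
    · have h1 := (gs _ h).1
      calc g (4^k * ρ z) * (a * (1/4)^k) ≤ 1 * ((4^k * ρ z) * (1/4)^k) := by
            gcongr
            · exact g1 _
            · linarith
        _ = (4^k * (1/4)^k) * ρ z := by ring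
        _ = ρ z := by rw [hp, one_mul]
  refine ⟨a, ha0, by linarith, ⟨fun k => by positivity, hbdiff, fun k x => g0 _, fun k x => g1 _,
    ?_, fun k x z => ?_, fun x hx ε hε => ?_, hbd⟩⟩
  · have aux : ∀ z (k l : ℕ), g (4^k * ρ z) ≠ 0 → g (4^l * ρ z) ≠ 0 → ¬ k < l := by
      intro z k l hk hl hkl
      obtain ⟨h1, -⟩ := gs _ hk
      obtain ⟨-, h2⟩ := gs _ hl
      have : (4:ℝ)^(k+1) ≤ 4^l := pow_le_pow_right₀ (by norm_num) hkl
      have := mul_le_mul_of_nonneg_right this (hρ0 z)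
      rw [pow_succ] at this
      linarith
    intro z k l hk hl
    have := aux z k l hk hl
    have := aux z l k hl hk
    omega
  · have h1 := lip_of_deriv hg hC (4^k * ρ x) (4^k * ρ z)
    have h2 := lip_of_fderiv hd hK x z
    rw [← mul_sub, abs_mul, abs_of_pos (by positivity : (0:ℝ) < 4^k)] at h1
    calc |g (4^k * ρ z) - g (4^k * ρ x)| * (a * (1/4)^k) ≤ (C * (4^k * (K * ‖z - x‖))) * (a * (1/4)^k) := by
          gcongr
          exact h1.trans (by gcongr)
      _ = (4^k * (1/4)^k) * (C * K * a) * ‖z - x‖ := by ring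
      _ ≤ 1 * 1 * ‖z - x‖ := by rw [hp]; gcongr
      _ = _ := by ring
  · -- small derivative lemma
    have hmin : ∀ f : X → ℝ, Differentiable ℝ f → (∀ z, 0 ≤ f z) → f x = 0 → ∀ r > 0,
        ∀ᶠ z in nhds x, f z ≤ r * ‖z - x‖ := by
      intro f hf f0 fx r hr
      have : fderiv ℝ f x = 0 := by
        apply IsLocalMin.fderiv_eq_zero
        exact Eventually.of_forall (fun z => by rw [fx]; exact f0 z)
      have h := (hf x).hasFDerivAt
      rw [this, hasFDerivAt_iff_isLittleO, Asymptotics.isLittleO_iff] at h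
      filter_upwards [h hr] with z hz
      rw [fx, zero_apply, sub_zero, sub_zero] at hz
      exact (le_abs_self _).trans hz
    rcases (hρ0 x).eq_or_lt with h0 | h0
    · filter_upwards [hmin ρ hd hρ0 h0.symm ε hε] with z hz k
      exact (hbd k z).trans hz
    · obtain ⟨L, hL⟩ := pow_unbounded_of_one_lt (4 / ρ x) (show (1:ℝ) < 4 by norm_num)
      have hfin : ∀ᶠ z in nhds x, ∀ k ∈ Finset.range L, g (4^k * ρ z) ≤ ε * ‖z - x‖ :=
        (Filter.eventually_all_finset _).2 (fun k _ => hmin _ (hbdiff k) (fun z => g0 _) (hx k) ε hε)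
      have hcont : ∀ᶠ z in nhds x, ρ x / 2 < ρ z :=
        (hd.continuous.continuousAt (x := x)).eventually (lt_mem_nhds (by linarith))
      filter_upwards [hfin, hcont] with z h1 h2 k
      by_cases hk : k < L
      · have h3 := h1 k (Finset.mem_range.2 hk)
        have : a * (1/4:ℝ)^k ≤ 1 := by
          calc a * (1/4:ℝ)^k ≤ 1 * 1 := by
                gcongr
                · linarith
                · exact pow_le_one₀ (by norm_num) (by norm_num)
            _ = 1 := one_mul 1
        calc _ ≤ g (4^k * ρ z) * 1 := by
              have := g0 (4^k * ρ z)
              gcongr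
          _ ≤ _ := by rw [mul_one]; exact h3
      · have : g (4^k * ρ z) = 0 := by
          by_contra hne
          have h3 := (gs _ hne).2
          have : (4:ℝ)^L ≤ 4^k := pow_le_pow_right₀ (by norm_num) (by omega)
          have h4 : 4 / ρ x * (ρ x / 2) ≤ 4^k * ρ z := by gcongr; linarith
          have : 4 / ρ x * (ρ x / 2) = 2 := by field_simp; norm_num
          linarith
        rw [this, zero_mul]; positivity

lemma glue_norm {β : ℕ → X → ℝ} {s : ℕ → ℝ} {ρ : X → ℝ} (hS : Shell β s ρ) {v : X → ℝ} {V : ℕ → X → ℝ}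
    {c R : ℝ} (hc : 0 ≤ c) {x : X} {k : ℕ} (hk : β k x ≠ 0) (hv : DifferentiableAt ℝ v x)
    (hvR : ‖fderiv ℝ v x‖ ≤ R) (hV : DifferentiableAt ℝ (V k) x) (hVR : ‖fderiv ℝ (V k) x‖ ≤ R)
    (hVv : |V k x - v x| ≤ c * s k) : ‖fderiv ℝ (glue β v V) x‖ ≤ R + c := by
  rw [(glue_fderiv hS hk hv hV).fderiv]
  have e : fderiv ℝ v x + (β k x • (fderiv ℝ (V k) x - fderiv ℝ v x) +
    (V k x - v x) • fderiv ℝ (β k) x) = (1 - β k x) • fderiv ℝ v x + β k x • fderiv ℝ (V k) x +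
      (V k x - v x) • fderiv ℝ (β k) x := by ext w; simp; ring
  have b0 := hS.nn k x
  have b1 := hS.le1 k x
  rw [e]
  refine (norm_add_le _ _).trans (add_le_add ((norm_add_le _ _).trans ?_) ?_)
  · rw [norm_smul, norm_smul, Real.norm_eq_abs, Real.norm_eq_abs, abs_of_nonneg b0,
      abs_of_nonneg (by linarith : 0 ≤ 1 - β k x)]
    nlinarith
  · rw [norm_smul, Real.norm_eq_abs]
    have := shell_fderiv hS k x
    calc _ ≤ c * s k * ‖fderiv ℝ (β k) x‖ := by gcongr
      _ = c * (s k * ‖fderiv ℝ (β k) x‖) := by ring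
      _ ≤ c * 1 := by gcongr
      _ = c := mul_one c

theorem tool (u : ℕ → X → ℝ) (hu : ∀ N, DB (u N)) (ρ : ℕ → X → ℝ) (hρ : ∀ N, DB (ρ N))
    (hρ0 : ∀ N x, 0 ≤ ρ N x) (hρ1 : ∀ N x, ρ N x ≤ 1) (ε : ℕ → ℝ) (hε : ∀ N, 0 < ε N) :
    ∃ y : ℕ → X → ℝ, (∀ N, DB (y N)) ∧ (∀ N x, |y N x - u N x| ≤ ε N * ρ N x) ∧
      ∀ x, ∀ e > 0, ∀ᶠ N in atTop, 0 < ρ N x → ‖fderiv ℝ (y N) x‖ ≤ e := by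
  obtain ⟨g, g', C, hg, hgC, g0, g1, gone, gz⟩ := exists_bump (23/20) (11/20) (16/25) (by norm_num) (by norm_num)
  obtain ⟨h, h', C', hh, hhC, h0, h1, hone, hz⟩ := exists_bump (11/10) (1/4) (1/2) (by norm_num) (by norm_num)
  have hsupp : ∀ t, h t ≠ 0 → 3/5 < t ∧ t < 8/5 := fun t ht => by
    by_contra hne
    refine ht (hz t ?_)
    by_contra hlt
    rw [not_le, abs_lt] at hlt
    exact hne ⟨by linarith [hlt.1], by linarith [hlt.2]⟩
  have gsupp : ∀ t, g t ≠ 0 → 1/2 < t ∧ t < 2 := fun t ht => by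
    by_contra hne
    refine ht (gz t ?_)
    by_contra hlt
    rw [not_le, abs_lt] at hlt
    exact hne ⟨by linarith [hlt.1], by linarith [hlt.2]⟩
  have gcore : ∀ t, 3/5 ≤ t → t ≤ 17/10 → g t = 1 := fun t a b => gone t (by rw [abs_le]; constructor <;> linarith)
  have hH := fun N => exists_shell (hρ N) (hρ0 N) hh hhC h0 h1 (fun t ht => ⟨by linarith [(hsupp t ht).1], by linarith [(hsupp t ht).2]⟩)
  choose a ha0 ha1 hSh using hH
  let ρ' : ℕ → X → ℝ := fun N x => (if N % 2 = 0 then 1 else 1/2) * ρ (N/2) x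
  have hρ' : ∀ N, DB (ρ' N) := fun N => (hρ (N/2)).const_mul _
  have hρ'0 : ∀ N x, 0 ≤ ρ' N x := fun N x => mul_nonneg (by split_ifs <;> norm_num) (hρ0 _ x)
  have hρ'1 : ∀ N x, ρ' N x ≤ ρ (N/2) x := fun N x =>
    mul_le_of_le_one_left (hρ0 _ x) (by split_ifs <;> norm_num)
  have hG := fun N => exists_shell (hρ' N) (hρ'0 N) hg hgC g0 g1 gsupp
  choose a' ha'0 ha'1 hSg using hG
  let ε' : ℕ → ℝ := fun N => min (ε N) (a N * (1/2)^N / 4)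
  have hε' : ∀ N, 0 < ε' N := fun N => lt_min (hε N) (by have := ha0 N; positivity)
  obtain ⟨y, hy, hyu, hyd⟩ := tool1 (fun N => u (N/2)) (fun N => hu _) ρ' hρ' hρ'0 (fun N x => (hρ'1 N x).trans (hρ1 _ x))
    (fun N k x => g (4^k * ρ' N x)) (fun N k => a' N * (1/4)^k) hSg (fun N k => by
      calc a' N * (1/4:ℝ)^k ≤ 1 * 1 := by
            gcongr
            · exact ha'1 N
            · exact pow_le_one₀ (by norm_num) (by norm_num)
        _ = 1 := one_mul 1) (fun N => ε' (N/2)) (fun N => hε' _)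
  have hy0 : ∀ N x, |y (2*N) x - u N x| ≤ ε' N * ρ N x := fun N x => by
    have := hyu (2*N) x
    have h2 := hρ'1 (2*N) x
    rw [show 2*N/2 = N by omega] at this h2
    have := hε' N
    exact ‹_ ≤ _›.trans (by gcongr)
  have hy1 : ∀ N x, |y (2*N+1) x - u N x| ≤ ε' N * ρ N x := fun N x => by
    have := hyu (2*N+1) x
    have h2 := hρ'1 (2*N+1) x
    rw [show (2*N+1)/2 = N by omega] at this h2
    have := hε' N
    exact ‹_ ≤ _›.trans (by gcongr)
  let c : ℕ → ℝ := fun N => (1/2)^(N:ℕ) * 2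
  have hc0 : ∀ N, 0 ≤ c N := fun N => by positivity
  have hVv : ∀ N k z, h (4^k * ρ N z) ≠ 0 → |y (2*N) z - y (2*N+1) z| ≤ c N * (a N * (1/4)^k) := by
    intro N k z hne
    have h3 := (hsupp _ hne).2
    have hp : (4:ℝ)^k * (1/4)^k = 1 := by rw [← mul_pow]; norm_num
    have h4 : ρ N z ≤ 2 * (1/4)^k := by
      calc ρ N z = (4^k * (1/4)^k) * ρ N z := by rw [hp, one_mul]
        _ = (4^k * ρ N z) * (1/4)^k := by ring
        _ ≤ 2 * (1/4)^k := by gcongr; linarith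
    have h5 : ε' N ≤ a N * (1/2)^N / 4 := min_le_right _ _
    have h6 := abs_sub_le (y (2*N) z) (u N z) (y (2*N+1) z)
    rw [abs_sub_comm (u N z)] at h6
    have h7 : ε' N * ρ N z ≤ (a N * (1/2)^N / 4) * (2 * (1/4)^k) := by
      have := hρ0 N z
      have := ha0 N
      gcongr
    have := hy0 N z
    have := hy1 N z
    have e : c N * (a N * (1/4)^k) = 4 * ((a N * (1/2)^N / 4) * (2 * (1/4)^k)) := by simp only [c]; ring
    have : 0 ≤ (a N * (1/2)^N / 4) * (2 * (1/4)^k) := by have := ha0 N; positivity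
    rw [e]; linarith
  refine ⟨fun N => glue (fun k x => h (4^k * ρ N x)) (y (2*N+1)) (fun _ => y (2*N)), fun N => ?_, fun N x => ?_,
    fun x e he => ?_⟩
  · obtain ⟨d1, M1, hM1⟩ := hy (2*N)
    obtain ⟨d2, M2, hM2⟩ := hy (2*N+1)
    obtain ⟨r1, r2⟩ := glue_DB (hSh N) (R := max M1 M2) (hc0 N) d2 (fun x => (hM2 x).trans (le_max_right _ _)) (fun _ => d1)
      (fun _ x => (hM1 x).trans (le_max_left _ _)) (hVv N)
    exact ⟨r1, _, r2⟩
  · obtain ⟨k, hk⟩ := glue_eq' (hSh N) (v := y (2*N+1)) (V := fun _ => y (2*N)) x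
    simp only
    rw [hk]
    have b0 := h0 (4^k * ρ N x)
    have b1 := h1 (4^k * ρ N x)
    rw [show y (2*N+1) x + h (4^k * ρ N x) * (y (2*N) x - y (2*N+1) x) - u N x =
      (1 - h (4^k * ρ N x)) * (y (2*N+1) x - u N x) + h (4^k * ρ N x) * (y (2*N) x - u N x) by ring]
    refine (abs_add_le _ _).trans ?_
    rw [abs_mul, abs_mul, abs_of_nonneg b0, abs_of_nonneg (by linarith : 0 ≤ 1 - h (4^k * ρ N x))]
    have h3 := hy0 N x
    have h4 := hy1 N x
    have h5 : ε' N * ρ N x ≤ ε N * ρ N x := by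
      have := hρ0 N x
      gcongr
      exact min_le_left _ _
    nlinarith
  · have ht : Tendsto c atTop (nhds 0) := by
      have := (tendsto_pow_atTop_nhds_zero_of_lt_one (r := (1/2:ℝ)) (by norm_num) (by norm_num)).mul_const 2
      rw [zero_mul] at this
      exact this
    have hE := hyd x (e/2) (by positivity)
    have t0 : Tendsto (fun N : ℕ => 2*N) atTop atTop :=
      tendsto_atTop_mono (fun N => by simp only [id]; omega) tendsto_id
    have t1 : Tendsto (fun N : ℕ => 2*N+1) atTop atTop :=
      tendsto_atTop_mono (fun N => by simp only [id]; omega) tendsto_id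
    filter_upwards [t0.eventually hE, t1.eventually hE, ht.eventually (gt_mem_nhds (half_pos he))] with N e0 e1 ec hpos
    have q0 : ∀ z, ρ' (2*N) z = ρ N z := fun z => by
      simp only [ρ', show 2*N/2 = N by omega, show 2*N % 2 = 0 by omega, if_true, one_mul]
    have q1 : ∀ z, ρ' (2*N+1) z = 1/2 * ρ N z := fun z => by
      simp only [ρ', show (2*N+1)/2 = N by omega, show (2*N+1) % 2 = 1 by omega]; norm_num
    simp only [q0] at e0
    simp only [q1] at e1
    -- find k
    have hex : ∃ k : ℕ, 3/5 ≤ 4^k * ρ N x := by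
      obtain ⟨L, hL⟩ := pow_unbounded_of_one_lt (1 / ρ N x) (show (1:ℝ) < 4 by norm_num)
      refine ⟨L, ?_⟩
      have : 1 / ρ N x * ρ N x ≤ 4^L * ρ N x := by gcongr
      rw [div_mul_cancel₀ _ hpos.ne'] at this
      linarith
    obtain ⟨k, hk1, hk2⟩ : ∃ k : ℕ, 3/5 ≤ 4^k * ρ N x ∧ 4^k * ρ N x < 12/5 := by
      classical
      refine ⟨Nat.find hex, Nat.find_spec hex, ?_⟩
      rcases Nat.eq_zero_or_pos (Nat.find hex) with hz | hz
      · rw [hz]; linarith [hρ1 N x]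
      · have := Nat.find_min hex (Nat.sub_lt hz one_pos)
        rw [not_le] at this
        have e : Nat.find hex = (Nat.find hex - 1) + 1 := by omega
        rw [e, pow_succ]; linarith
    by_cases hcase : 17/20 ≤ 4^k * ρ N x ∧ 4^k * ρ N x ≤ 27/20
    · have hh1 : h (4^k * ρ N x) = 1 := hone _ (by rw [abs_le]; constructor <;> linarith)
      rw [(glue_fderiv_one (hSh N) (v := y (2*N+1)) (V := fun _ => y (2*N)) hh1 ((hy _).1 x) ((hy _).1 x)).fderiv]
      have := e0 ⟨k, gcore _ hk1 (by linarith)⟩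
      linarith
    · have hcore1 : ‖fderiv ℝ (y (2*N+1)) x‖ ≤ e/2 := by
        refine e1 ?_
        by_cases h3 : 17/20 ≤ 4^k * ρ N x
        · have h4 : 27/20 < 4^k * ρ N x := by by_contra hne; exact hcase ⟨h3, by linarith⟩
          exact ⟨k, gcore _ (by linarith) (by linarith)⟩
        · exact ⟨k+1, gcore _ (by rw [pow_succ]; linarith) (by rw [pow_succ]; linarith)⟩
      by_cases hx : ∀ k, h (4^k * ρ N x) = 0
      · rw [(glue_fderiv_none (hSh N) (v := y (2*N+1)) (V := fun _ => y (2*N)) hx ((hy _).1 x) (hVv N)).fderiv]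
        linarith
      · push Not at hx
        obtain ⟨k', hk'⟩ := hx
        obtain ⟨s1, s2⟩ := hsupp _ hk'
        have hcore0 := e0 ⟨k', gcore _ (by linarith) (by linarith)⟩
        have := glue_norm (hSh N) (V := fun _ => y (2*N)) (hc0 N) hk' ((hy (2*N+1)).1 x) hcore1 ((hy (2*N)).1 x) hcore0
          (hVv N k' x hk')
        linarith
end ApproxLp


namespace ApproxLp
variable {X : Type*} [NormedAddCommGroup X] [NormedSpace ℝ X]

/-- symmetric averaging in direction `e` -/
noncomputable def avg (e : X) (ψ : X → ℝ) (h : X) : ℝ := (1/2) * ∫ s in (-1:ℝ)..1, ψ (h + s • e)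

lemma avg_cont {ψ : X → ℝ} (hψ : Continuous ψ) (e h : X) : Continuous (fun s : ℝ => ψ (h + s • e)) := by
  fun_prop

lemma avg_meas {ψ : X → ℝ} (hψ : Differentiable ℝ ψ) (e h η : X) :
    Measurable (fun s : ℝ => fderiv ℝ ψ (h + s • e) η) := by
  have hc := hψ.continuous
  refine measurable_of_tendsto_metrizable (f := fun (n : ℕ) (s : ℝ) =>
    ((n:ℝ)+1) * (ψ ((h + s • e) + ((n:ℝ)+1)⁻¹ • η) - ψ (h + s • e))) (fun n => ?_) ?_
  · apply Continuous.measurable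
    fun_prop
  · rw [tendsto_pi_nhds]
    intro s
    have h1 := (hψ (h + s • e)).hasFDerivAt
    have h2 := HasFDerivAt.lim h1 η (c := fun n : ℕ => (n:ℝ)+1) (l := atTop) ?_
    · simpa using h2
    · exact tendsto_norm_atTop_atTop.comp (tendsto_natCast_atTop_atTop.atTop_add tendsto_const_nhds)

lemma avg_int {ψ : X → ℝ} (hψ : Differentiable ℝ ψ) {L : ℝ} (hL : ∀ x, ‖fderiv ℝ ψ x‖ ≤ L) (e h η : X) :
    IntervalIntegrable (fun s : ℝ => fderiv ℝ ψ (h + s • e) η) volume (-1) 1 := by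
  refine (intervalIntegrable_const (c := L * ‖η‖)).mono_fun' (avg_meas hψ e h η).aestronglyMeasurable ?_
  exact Eventually.of_forall fun s => (ContinuousLinearMap.le_opNorm _ _).trans (mul_le_mul_of_nonneg_right (hL _) (norm_nonneg _))

lemma half_int_le {f : ℝ → ℝ} {C : ℝ} (h : ∀ s, |s| ≤ 1 → |f s| ≤ C) : |(1/2) * ∫ s in (-1:ℝ)..1, f s| ≤ C := by
  have := intervalIntegral.norm_integral_le_of_norm_le_const (a := (-1:ℝ)) (b := 1) (f := f) (C := C) (fun s hs => by
    rw [Set.uIoc_of_le (by norm_num)] at hs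
    exact h s (abs_le.2 ⟨hs.1.le, hs.2⟩))
  rw [Real.norm_eq_abs] at this
  rw [abs_mul]
  norm_num at this ⊢
  linarith

lemma avg_hasFDeriv {ψ : X → ℝ} (hψ : Differentiable ℝ ψ) {L : ℝ} (hL : ∀ x, ‖fderiv ℝ ψ x‖ ≤ L) (e h : X) :
    ∃ D : X →L[ℝ] ℝ, HasFDerivAt (avg e ψ) D h ∧
      ∀ η, D η = (1/2) * ∫ s in (-1:ℝ)..1, fderiv ℝ ψ (h + s • e) η := by
  have hL0 : 0 ≤ L := (norm_nonneg _).trans (hL 0)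
  let D0 : X →ₗ[ℝ] ℝ :=
    { toFun := fun η => (1/2) * ∫ s in (-1:ℝ)..1, fderiv ℝ ψ (h + s • e) η
      map_add' := fun x y => by
        simp only [map_add]
        rw [intervalIntegral.integral_add (avg_int hψ hL e h x) (avg_int hψ hL e h y), mul_add]
      map_smul' := fun c x => by
        simp only [map_smul, smul_eq_mul, RingHom.id_apply]
        rw [intervalIntegral.integral_const_mul]; ring }
  let D : X →L[ℝ] ℝ := D0.mkContinuous L (fun η => by
    refine half_int_le fun s _ => ?_
    exact (ContinuousLinearMap.le_opNorm _ _).trans (mul_le_mul_of_nonneg_right (hL _) (norm_nonneg _)))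
  refine ⟨D, ?_, fun η => rfl⟩
  have hD : ∀ η, D η = (1/2) * ∫ s in (-1:ℝ)..1, fderiv ℝ ψ (h + s • e) η := fun η => rfl
  rw [hasFDerivAt_iff_tendsto]
  have hc := hψ.continuous
  have key : Tendsto (fun z => ∫ s in (-1:ℝ)..1, ‖z - h‖⁻¹ * (ψ (z + s • e) - ψ (h + s • e) -
      fderiv ℝ ψ (h + s • e) (z - h))) (nhds h) (nhds (∫ s in (-1:ℝ)..1, (0:ℝ))) := by
    refine intervalIntegral.tendsto_integral_filter_of_dominated_convergence (fun _ => 2 * L) ?_ ?_ ?_ ?_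
    · refine Eventually.of_forall fun z => Measurable.aestronglyMeasurable ?_
      have := avg_meas hψ e h (z - h)
      have h1 : Measurable (fun s : ℝ => ψ (z + s • e)) := (avg_cont hc e z).measurable
      have h2 : Measurable (fun s : ℝ => ψ (h + s • e)) := (avg_cont hc e h).measurable
      fun_prop
    · refine Eventually.of_forall fun z => Eventually.of_forall fun s _ => ?_
      rw [Real.norm_eq_abs, abs_mul, abs_inv, abs_norm]
      have h1 := lip_of_fderiv hψ hL (h + s • e) (z + s • e)
      rw [add_sub_add_right_eq_sub] at h1
      have h2 : |fderiv ℝ ψ (h + s • e) (z - h)| ≤ L * ‖z - h‖ :=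
        (ContinuousLinearMap.le_opNorm _ _).trans (mul_le_mul_of_nonneg_right (hL _) (norm_nonneg _))
      have h3 := abs_sub (ψ (z + s • e) - ψ (h + s • e)) (fderiv ℝ ψ (h + s • e) (z - h))
      calc ‖z - h‖⁻¹ * |ψ (z + s • e) - ψ (h + s • e) - fderiv ℝ ψ (h + s • e) (z - h)|
          ≤ ‖z - h‖⁻¹ * (‖z - h‖ * (2 * L)) := by gcongr; linarith
        _ ≤ 2 * L := by
          rw [← mul_assoc]
          exact mul_le_of_le_one_left (by positivity) (inv_mul_le_one)
    · exact intervalIntegrable_const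
    · refine Eventually.of_forall fun s _ => ?_
      have h1 := (hψ (h + s • e)).hasFDerivAt
      rw [hasFDerivAt_iff_tendsto] at h1
      have h2 : Tendsto (fun z => z + s • e) (nhds h) (nhds (h + s • e)) := by
        exact (continuous_id.add continuous_const).tendsto h
      have h3 := h1.comp h2
      rw [tendsto_zero_iff_norm_tendsto_zero]
      refine h3.congr fun z => ?_
      simp [Function.comp]
  rw [intervalIntegral.integral_zero] at key
  have := (key.const_mul (1/2)).norm
  rw [mul_zero, norm_zero] at this
  refine this.congr fun z => ?_
  rw [intervalIntegral.integral_const_mul, intervalIntegral.integral_sub, intervalIntegral.integral_sub, hD]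
  · simp only [avg]
    rw [← mul_sub, ← mul_sub, norm_mul, norm_mul, norm_mul, norm_inv, norm_norm]
    ring
  · exact (avg_cont hc e z).intervalIntegrable _ _
  · exact (avg_cont hc e h).intervalIntegrable _ _
  · exact ((avg_cont hc e z).sub (avg_cont hc e h)).intervalIntegrable _ _
  · exact avg_int hψ hL e h _

lemma avg_fderiv {ψ : X → ℝ} (hψ : Differentiable ℝ ψ) {L : ℝ} (hL : ∀ x, ‖fderiv ℝ ψ x‖ ≤ L) (e h η : X) :
    fderiv ℝ (avg e ψ) h η = (1/2) * ∫ s in (-1:ℝ)..1, fderiv ℝ ψ (h + s • e) η := by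
  obtain ⟨D, hD, h1⟩ := avg_hasFDeriv hψ hL e h
  rw [hD.fderiv, h1]

lemma avg_diff {ψ : X → ℝ} (hψ : Differentiable ℝ ψ) {L : ℝ} (hL : ∀ x, ‖fderiv ℝ ψ x‖ ≤ L) (e : X) :
    Differentiable ℝ (avg e ψ) := fun h => by
  obtain ⟨D, hD, h1⟩ := avg_hasFDeriv hψ hL e h
  exact hD.differentiableAt

lemma avg_bound {ψ : X → ℝ} (hψ : Differentiable ℝ ψ) {L : ℝ} (hL : ∀ x, ‖fderiv ℝ ψ x‖ ≤ L) (e : X) :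
    ∀ x, ‖fderiv ℝ (avg e ψ) x‖ ≤ L := fun x => by
  refine ContinuousLinearMap.opNorm_le_bound _ ((norm_nonneg _).trans (hL 0)) fun η => ?_
  rw [avg_fderiv hψ hL]
  refine half_int_le fun s _ => ?_
  exact (ContinuousLinearMap.le_opNorm _ _).trans (mul_le_mul_of_nonneg_right (hL _) (norm_nonneg _))

lemma half_const (c : ℝ) : (1/2) * ∫ _ in (-1:ℝ)..1, c = c := by
  rw [intervalIntegral.integral_const]; norm_num; ring

lemma avg_affine {ψ : X → ℝ} (hψ : Continuous ψ) (e : X) {c τ R : ℝ} {ℓ : X →L[ℝ] ℝ} {h : X}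
    (H : ∀ x, ‖x - h‖ ≤ R → |ψ x - c - ℓ (x - h)| ≤ τ) :
    ∀ x, ‖x - h‖ ≤ R - ‖e‖ → |avg e ψ x - c - ℓ (x - h)| ≤ τ := by
  intro x hx
  have e1 : avg e ψ x - c - ℓ (x - h) = (1/2) * ∫ s in (-1:ℝ)..1, (ψ (x + s • e) - c - ℓ (x + s • e - h)) := by
    have : ∀ s : ℝ, ψ (x + s • e) - c - ℓ (x + s • e - h) = ψ (x + s • e) - (c + ℓ (x - h)) - s * ℓ e := fun s => by
      rw [show x + s • e - h = (x - h) + s • e by abel]; simp; ring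
    simp only [this]
    rw [intervalIntegral.integral_sub, intervalIntegral.integral_sub, mul_sub, mul_sub, half_const,
      intervalIntegral.integral_mul_const, integral_id]
    · simp only [avg]; ring
    · exact (avg_cont hψ e x).intervalIntegrable _ _
    · exact intervalIntegrable_const
    · exact ((avg_cont hψ e x).sub continuous_const).intervalIntegrable _ _
    · exact (continuous_id.mul continuous_const).intervalIntegrable _ _
  rw [e1]
  refine half_int_le fun s hs => H _ ?_
  have : ‖s • e‖ ≤ ‖e‖ := by rw [norm_smul]; exact mul_le_of_le_one_left (norm_nonneg _) hs
  rw [show x + s • e - h = (x - h) + s • e by abel]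
  exact (norm_add_le _ _).trans (by linarith)

lemma avg_dir {ψ : X → ℝ} (hψ : Differentiable ℝ ψ) {L : ℝ} (hL : ∀ x, ‖fderiv ℝ ψ x‖ ≤ L) (e : X) {r τ R : ℝ}
    {h v : X} (H : ∀ x, ‖x - h‖ ≤ R → |fderiv ℝ ψ x v - r| ≤ τ) :
    ∀ x, ‖x - h‖ ≤ R - ‖e‖ → |fderiv ℝ (avg e ψ) x v - r| ≤ τ := by
  intro x hx
  have e1 : fderiv ℝ (avg e ψ) x v - r = (1/2) * ∫ s in (-1:ℝ)..1, (fderiv ℝ ψ (x + s • e) v - r) := by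
    rw [avg_fderiv hψ hL, intervalIntegral.integral_sub (avg_int hψ hL e x v) intervalIntegrable_const, mul_sub, half_const]
  rw [e1]
  refine half_int_le fun s hs => H _ ?_
  have : ‖s • e‖ ≤ ‖e‖ := by rw [norm_smul]; exact mul_le_of_le_one_left (norm_nonneg _) hs
  rw [show x + s • e - h = (x - h) + s • e by abel]
  exact (norm_add_le _ _).trans (by linarith)

lemma avg_self {ψ : X → ℝ} (hψ : Differentiable ℝ ψ) {L : ℝ} (hL : ∀ x, ‖fderiv ℝ ψ x‖ ≤ L) (e x : X) :
    fderiv ℝ (avg e ψ) x e = (1/2) * (ψ (x + e) - ψ (x - e)) := by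
  rw [avg_fderiv hψ hL]
  have := intervalIntegral.integral_eq_sub_of_hasDerivAt (a := (-1:ℝ)) (b := 1) (f := fun s => ψ (x + s • e))
    (f' := fun s => fderiv ℝ ψ (x + s • e) e) (fun s _ => by
      have h1 : HasDerivAt (fun s : ℝ => x + s • e) e s := by
        simpa using ((hasDerivAt_id s).smul_const e).const_add x
      exact (hψ (x + s • e)).hasFDerivAt.comp_hasDerivAt s h1) (avg_int hψ hL e x e)
  rw [this]
  simp [sub_eq_add_neg]

/-- iterated averaging -/
noncomputable def mavg (e : ℕ → X) (φ : X → ℝ) : ℕ → X → ℝ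
  | 0 => φ
  | n+1 => avg (e n) (mavg e φ n)

lemma mavg_basic (e : ℕ → X) {φ : X → ℝ} (hφ : Differentiable ℝ φ) {L : ℝ} (hL : ∀ x, ‖fderiv ℝ φ x‖ ≤ L) (n : ℕ) :
    Differentiable ℝ (mavg e φ n) ∧ ∀ x, ‖fderiv ℝ (mavg e φ n) x‖ ≤ L := by
  induction n with
  | zero => exact ⟨hφ, hL⟩
  | succ n ih => exact ⟨avg_diff ih.1 ih.2 _, avg_bound ih.1 ih.2 _⟩

lemma mavg_affine (e : ℕ → X) {φ : X → ℝ} (hφ : Differentiable ℝ φ) {L : ℝ} (hL : ∀ x, ‖fderiv ℝ φ x‖ ≤ L)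
    {c τ R : ℝ} {ℓ : X →L[ℝ] ℝ} {h : X} (H : ∀ x, ‖x - h‖ ≤ R → |φ x - c - ℓ (x - h)| ≤ τ) (n : ℕ) :
    ∀ x, ‖x - h‖ ≤ R - ∑ i ∈ Finset.range n, ‖e i‖ → |mavg e φ n x - c - ℓ (x - h)| ≤ τ ∧
      ∀ i < n, |fderiv ℝ (mavg e φ n) x (e i) - ℓ (e i)| ≤ τ := by
  induction n with
  | zero => 
    intro x hx
    exact ⟨H x (by simpa using hx), fun i hi => absurd hi (Nat.not_lt_zero _)⟩
  | succ n ih =>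
    obtain ⟨d1, d2⟩ := mavg_basic e hφ hL n
    intro x hx
    rw [Finset.sum_range_succ, ← sub_sub] at hx
    refine ⟨avg_affine d1.continuous (e n) (fun z hz => (ih z hz).1) x hx, fun i hi => ?_⟩
    rcases Nat.lt_succ_iff_lt_or_eq.1 hi with h1 | rfl
    · exact avg_dir d1 d2 (e n) (fun z hz => (ih z hz).2 i h1) x hx
    · change |fderiv ℝ (avg (e i) (mavg e φ i)) x (e i) - ℓ (e i)| ≤ τ
      rw [avg_self d1 d2]
      have h1 := (ih (x + e i) (by
        rw [show x + e i - h = (x - h) + e i by abel]; exact (norm_add_le _ _).trans (by linarith))).1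
      have h2 := (ih (x - e i) (by
        rw [show x - e i - h = (x - h) - e i by abel]; exact (norm_sub_le _ _).trans (by linarith))).1
      rw [show x + e i - h = (x - h) + e i by abel, map_add] at h1
      rw [show x - e i - h = (x - h) - e i by abel, map_sub] at h2
      rw [abs_le] at *
      constructor <;> linarith [h1.1, h1.2, h2.1, h2.2]

lemma mavg_close (e : ℕ → X) {φ : X → ℝ} (hφ : Differentiable ℝ φ) {L : ℝ} (hL : ∀ x, ‖fderiv ℝ φ x‖ ≤ L) (n : ℕ) (x : X) :
    |mavg e φ n x - φ x| ≤ L * ∑ i ∈ Finset.range n, ‖e i‖ := by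
  have := (mavg_affine e hφ hL (c := φ x) (ℓ := 0) (h := x) (R := ∑ i ∈ Finset.range n, ‖e i‖)
    (τ := L * ∑ i ∈ Finset.range n, ‖e i‖) (fun z hz => by
      have := lip_of_fderiv hφ hL x z
      have hL0 : 0 ≤ L := (norm_nonneg _).trans (hL 0)
      simp only [zero_apply, sub_zero]
      exact this.trans (by gcongr)) n x (by simp)).1
  simpa using this

theorem mollify [TopologicalSpace.SeparableSpace X] {φ : X → ℝ} (hφ : Differentiable ℝ φ) {L : ℝ}
    (hL : ∀ x, ‖fderiv ℝ φ x‖ ≤ L) : ∃ G : ℕ → X → ℝ, (∀ J, Differentiable ℝ (G J)) ∧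
      (∀ J x, ‖fderiv ℝ (G J) x‖ ≤ L) ∧ (∀ J x, |G J x - φ x| ≤ L * (1 / ((J:ℝ)+1))) ∧
      ∀ h η, ∀ e > 0, ∃ J0 : ℕ, ∀ J ≥ J0, ∀ x, ‖x - h‖ ≤ 1 / ((J:ℝ)+1) →
        |fderiv ℝ (G J) x η - fderiv ℝ φ h η| ≤ e := by
  have hL0 : 0 ≤ L := (norm_nonneg _).trans (hL 0)
  let b : ℕ → X := TopologicalSpace.denseSeq X
  let a : ℕ → ℝ := fun i => (1/2)^(i+1) / (1 + ‖b i‖)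
  have ha : ∀ i, 0 < a i := fun i => by positivity
  have hab : ∀ i, a i * ‖b i‖ ≤ (1/2)^(i+1) := fun i => by
    simp only [a]
    rw [div_mul_eq_mul_div, div_le_iff₀ (by positivity)]
    gcongr; linarith
  have hsum : ∀ n, ∑ i ∈ Finset.range n, a i * ‖b i‖ ≤ 1 := fun n => by
    have : ∀ n, ∑ i ∈ Finset.range n, (1/2:ℝ)^(i+1) = 1 - (1/2)^n := fun n => by
      induction n with
      | zero => simp
      | succ n ih => rw [Finset.sum_range_succ, ih, pow_succ]; ring
    refine (Finset.sum_le_sum fun i _ => hab i).trans ?_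
    rw [this]
    have : (0:ℝ) ≤ (1/2)^n := by positivity
    linarith
  let ε : ℕ → ℝ := fun J => 1 / ((J:ℝ)+1)
  have hε : ∀ J, 0 < ε J := fun J => by positivity
  let E : ℕ → ℕ → X := fun J i => (ε J * a i) • b i
  have hE : ∀ J n, ∑ i ∈ Finset.range n, ‖E J i‖ ≤ ε J := fun J n => by
    have : ∀ i, ‖E J i‖ = ε J * (a i * ‖b i‖) := fun i => by
      simp only [E]
      rw [norm_smul, Real.norm_eq_abs, abs_of_pos (mul_pos (hε J) (ha i)), mul_assoc]
    simp only [this]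
    rw [← Finset.mul_sum]
    exact mul_le_of_le_one_right (hε J).le (hsum n)
  refine ⟨fun J => mavg (E J) φ J, fun J => (mavg_basic _ hφ hL J).1, fun J => (mavg_basic _ hφ hL J).2,
    fun J x => (mavg_close _ hφ hL J x).trans (by gcongr; exact hE J J), fun h η e he => ?_⟩
  obtain ⟨i, hi⟩ : ∃ i, ‖b i - η‖ < e / (4 * (L + 1)) := by
    obtain ⟨i, hi⟩ := (TopologicalSpace.denseRange_denseSeq X).exists_dist_lt η (show 0 < e / (4 * (L + 1)) by positivity)
    exact ⟨i, by rwa [dist_comm, dist_eq_norm] at hi⟩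
  have hder := (hφ h).hasFDerivAt
  rw [hasFDerivAt_iff_isLittleO, Asymptotics.isLittleO_iff] at hder
  have hκ : 0 < e * a i / 4 := by have := ha i; positivity
  obtain ⟨δ, hδ, hball⟩ := Metric.eventually_nhds_iff.1 (hder hκ)
  obtain ⟨J1, hJ1⟩ := exists_nat_one_div_lt (show 0 < δ/2 by positivity)
  refine ⟨max (i+1) J1, fun J hJ x hx => ?_⟩
  have hi1 : i < J := lt_of_lt_of_le (Nat.lt_succ_self i) ((le_max_left _ _).trans hJ)
  have hJ2 : ε J < δ/2 := by
    refine lt_of_le_of_lt ?_ hJ1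
    have : (J1:ℝ) ≤ J := by exact_mod_cast (le_max_right _ _).trans hJ
    simp only [ε]
    gcongr
  have hx' : ‖x - h‖ ≤ ε J := hx
  have key := (mavg_affine (E J) hφ hL (c := φ h) (ℓ := fderiv ℝ φ h) (h := h) (R := 2 * ε J)
    (τ := e * a i / 4 * (2 * ε J)) (fun z hz => by
      have := hball (y := z) (by rw [dist_eq_norm]; linarith)
      rw [Real.norm_eq_abs] at this
      exact this.trans (by gcongr)) J x (by have := hE J J; linarith)).2 i hi1
  simp only [E, map_smul, smul_eq_mul] at key
  rw [← mul_sub, abs_mul, abs_of_pos (mul_pos (hε J) (ha i))] at key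
  have key2 : |fderiv ℝ (mavg (E J) φ J) x (b i) - fderiv ℝ φ h (b i)| ≤ e / 2 := by
    have hp := mul_pos (hε J) (ha i)
    refine le_of_mul_le_mul_left (key.trans_eq ?_) hp
    ring
  have b1 : |fderiv ℝ (mavg (E J) φ J) x (b i - η)| ≤ L * (e / (4 * (L+1))) :=
    (ContinuousLinearMap.le_opNorm _ _).trans
      (mul_le_mul ((mavg_basic _ hφ hL J).2 x) hi.le (norm_nonneg _) hL0)
  have b2 : |fderiv ℝ φ h (b i - η)| ≤ L * (e / (4 * (L+1))) :=
    (ContinuousLinearMap.le_opNorm _ _).trans (mul_le_mul (hL h) hi.le (norm_nonneg _) hL0)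
  have b3 : L * (e / (4 * (L+1))) ≤ e / 4 := by
    rw [mul_div_assoc', div_le_div_iff₀ (by positivity) (by positivity)]
    nlinarith
  rw [map_sub] at b1 b2
  simp only
  rw [abs_le] at *
  constructor <;> linarith [b1.1, b1.2, b2.1, b2.2, key2.1, key2.2]

/-- If `ρ x = 0` then the modified function has the same derivative. -/
lemma fderiv_eq_of_rho_zero {u y ρ : X → ℝ} {ε : ℝ} (hu : Differentiable ℝ u) (hy : Differentiable ℝ y)
    (hρ : Differentiable ℝ ρ) (hρ0 : ∀ x, 0 ≤ ρ x) (h : ∀ x, |y x - u x| ≤ ε * ρ x) {x : X} (hx : ρ x = 0) :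
    fderiv ℝ y x = fderiv ℝ u x := by
  have h1 : fderiv ℝ ρ x = 0 := IsLocalMin.fderiv_eq_zero (Eventually.of_forall fun z => by rw [hx]; exact hρ0 z)
  have h0 : y x - u x = 0 := by
    have := h x
    rw [hx, mul_zero] at this
    exact abs_nonpos_iff.1 this
  have hd : HasFDerivAt (fun z => ε * ρ z - (y z - u z)) (ε • fderiv ℝ ρ x - (fderiv ℝ y x - fderiv ℝ u x)) x :=
    ((hρ x).hasFDerivAt.const_mul ε).sub ((hy x).hasFDerivAt.sub (hu x).hasFDerivAt)
  have h2 : fderiv ℝ (fun z => ε * ρ z - (y z - u z)) x = 0 := IsLocalMin.fderiv_eq_zero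
    (Eventually.of_forall fun z => by
      simp only [hx, h0, mul_zero, sub_zero]
      linarith [(abs_le.1 (h z)).2])
  rw [hd.fderiv, h1, smul_zero, zero_sub, neg_eq_zero, sub_eq_zero] at h2
  exact h2
end ApproxLp


namespace ApproxLp
variable {X : Type*} [NormedAddCommGroup X] [NormedSpace ℝ X]

lemma exists_gate (ε : ℝ) (hε : 0 < ε) : ∃ (g g' : ℝ → ℝ) (C : ℝ), (∀ t, HasDerivAt g (g' t) t) ∧ (∀ t, |g' t| ≤ C) ∧
    (∀ t, 0 ≤ g t) ∧ (∀ t, g t ≤ 1) ∧ ∀ t, g t = 0 ↔ |t| ≤ ε := by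
  let q : ℝ → ℝ := Real.smoothTransition
  have hcd : ContDiff ℝ 1 q := Real.smoothTransition.contDiff
  have hd : Differentiable ℝ q := hcd.differentiable (by norm_num)
  have hc : Continuous (deriv q) := hcd.continuous_deriv (by norm_num)
  obtain ⟨C, hC⟩ : ∃ C, ∀ t, |deriv q t| ≤ C := by
    have hcs : HasCompactSupport (deriv q) := by
      refine HasCompactSupport.intro (isCompact_Icc (a := (0:ℝ)) (b := 1)) fun t ht => ?_
      rw [Set.mem_Icc, not_and_or, not_le, not_le] at ht
      rcases ht with h | h
      · have : q =ᶠ[nhds t] fun _ => 0 := by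
          filter_upwards [gt_mem_nhds h] with z hz
          exact Real.smoothTransition.zero_of_nonpos hz.le
        rw [this.deriv_eq]; simp
      · have : q =ᶠ[nhds t] fun _ => 1 := by
          filter_upwards [lt_mem_nhds h] with z hz
          exact Real.smoothTransition.one_of_one_le hz.le
        rw [this.deriv_eq]; simp
    exact hcs.exists_bound_of_continuous hc
  have hz : ∀ t, q t = 0 ↔ t ≤ 0 := fun t => ⟨fun h => by
    by_contra hlt
    exact (Real.smoothTransition.pos_of_pos (not_le.1 hlt)).ne' h, Real.smoothTransition.zero_of_nonpos⟩
  have q0 : ∀ t, 0 ≤ q t := Real.smoothTransition.nonneg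
  have q1 : ∀ t, q t ≤ 1 := Real.smoothTransition.le_one
  refine ⟨fun t => 1/2 * (q (t - ε) + q (-t - ε)), fun t => 1/2 * (deriv q (t - ε) + deriv q (-t - ε) * (-1)), C,
    fun t => ?_, fun t => ?_, fun t => ?_, fun t => ?_, fun t => ?_⟩
  · have h1 : HasDerivAt (fun t => q (t - ε)) (deriv q (t - ε) * 1) t :=
      (hd _).hasDerivAt.comp t ((hasDerivAt_id t).sub_const ε)
    have h2 : HasDerivAt (fun t => q (-t - ε)) (deriv q (-t - ε) * (-1)) t :=
      (hd _).hasDerivAt.comp t ((hasDerivAt_neg t).sub_const ε)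
    rw [mul_one] at h1
    exact (h1.add h2).const_mul _
  · have h1 := abs_le.1 (hC (t - ε))
    have h2 := abs_le.1 (hC (-t - ε))
    rw [abs_le]
    constructor <;> linarith [h1.1, h1.2, h2.1, h2.2]
  · have := q0 (t - ε); have := q0 (-t - ε); positivity
  · have := q1 (t - ε); have := q1 (-t - ε); linarith
  · have a := q0 (t - ε); have b := q0 (-t - ε)
    constructor
    · intro h
      have h1 : q (t - ε) = 0 := by linarith
      have h2 : q (-t - ε) = 0 := by linarith
      rw [hz] at h1 h2
      rw [abs_le]; constructor <;> linarith
    · intro h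
      rw [abs_le] at h
      simp only
      rw [(hz (t - ε)).2 (by linarith), (hz (-t - ε)).2 (by linarith)]; norm_num

lemma exists_rho_family (F : ℕ → X →L[ℝ] ℝ) (ε : ℝ) (hε : 0 < ε) : ∃ ρ : X → ℝ, DB ρ ∧ (∀ x, 0 ≤ ρ x) ∧
    (∀ x, ρ x ≤ 1) ∧ ∀ x, ρ x = 0 ↔ ∀ i, |F i x| ≤ ε := by
  obtain ⟨g, g', C, hg, hC, g0, g1, gz⟩ := exists_gate ε hε
  have hC0 : 0 ≤ C := (abs_nonneg _).trans (hC 0)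
  let w : ℕ → ℝ := fun i => (1/2)^(i+1) / (1 + ‖F i‖)
  have hw : ∀ i, 0 < w i := fun i => by positivity
  have hgeo : HasSum (fun i : ℕ => (1/2:ℝ)^(i+1)) 1 := by
    have := hasSum_geometric_two.mul_left (1/2)
    norm_num at this
    exact this.congr_fun fun i => by ring
  have hw1 : ∀ i, w i ≤ (1/2)^(i+1) := fun i => div_le_self (by positivity) (by linarith [norm_nonneg (F i)])
  have hwF : ∀ i, w i * ‖F i‖ ≤ (1/2)^(i+1) := fun i => by
    simp only [w]
    rw [div_mul_eq_mul_div, div_le_iff₀ (by positivity)]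
    gcongr; linarith
  have ht : ∀ i x, w i * g (F i x) ≤ (1/2)^(i+1) := fun i x =>
    (mul_le_of_le_one_right (hw i).le (g1 _)).trans (hw1 i)
  have hnn : ∀ i x, 0 ≤ w i * g (F i x) := fun i x => mul_nonneg (hw i).le (g0 _)
  have hs : ∀ x, Summable fun i => w i * g (F i x) := fun x =>
    Summable.of_nonneg_of_le (fun i => hnn i x) (fun i => ht i x) hgeo.summable
  have hder : ∀ i x, HasFDerivAt (fun x => w i * g (F i x)) (w i • (g' (F i x) • F i)) x := fun i x =>
    ((hg (F i x)).comp_hasFDerivAt x (F i).hasFDerivAt).const_mul _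
  have hbd : ∀ i x, ‖w i • (g' (F i x) • F i)‖ ≤ C * (1/2)^(i+1) := fun i x => by
    rw [norm_smul, norm_smul, Real.norm_eq_abs, Real.norm_eq_abs, abs_of_pos (hw i)]
    calc w i * (|g' (F i x)| * ‖F i‖) = |g' (F i x)| * (w i * ‖F i‖) := by ring
      _ ≤ _ := mul_le_mul (hC _) (hwF i) (mul_nonneg (hw i).le (norm_nonneg _)) hC0
  have hD : ∀ x, HasFDerivAt (fun x => ∑' i, w i * g (F i x)) (∑' i, w i • (g' (F i x) • F i)) x := fun x =>
    hasFDerivAt_tsum (hgeo.summable.mul_left C) hder hbd (hs 0) x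
  refine ⟨fun x => ∑' i, w i * g (F i x), ⟨fun x => (hD x).differentiableAt, C * 1, fun x => ?_⟩, fun x => tsum_nonneg fun i => hnn i x,
    fun x => ?_, fun x => ?_⟩
  · rw [(hD x).fderiv]
    exact tsum_of_norm_bounded (hgeo.mul_left C) (fun i => hbd i x)
  · rw [← hgeo.tsum_eq]
    exact (hs x).tsum_le_tsum (fun i => ht i x) hgeo.summable
  · constructor
    · intro h i
      simp only at h
      have h1 := (hasSum_zero_iff_of_nonneg (fun i => hnn i x)).1 (by have := (hs x).hasSum; rwa [h] at this)
      have h2 := congrFun h1 i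
      simp only [Pi.zero_apply, mul_eq_zero] at h2
      exact (gz _).1 (h2.resolve_left (hw i).ne')
    · intro h
      have : ∀ i, w i * g (F i x) = 0 := fun i => by rw [(gz _).2 (h i), mul_zero]
      simp [this]

lemma exists_norming (E : Type*) [NormedAddCommGroup E] [NormedSpace ℝ E] [TopologicalSpace.SeparableSpace E] :
    ∃ f : ℕ → E →L[ℝ] ℝ, ∀ (v : E) (ε : ℝ), ‖v‖ ≤ ε ↔ ∀ n, |f n v| ≤ ε := by
  have h1 := fun n => exists_dual_vector'' ℝ (TopologicalSpace.denseSeq E n)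
  choose f hf1 hf2 using h1
  have hle : ∀ n v, |f n v| ≤ ‖v‖ := fun n v =>
    ((f n).le_opNorm v).trans (mul_le_of_le_one_left (norm_nonneg _) (hf1 n))
  refine ⟨f, fun v ε => ⟨fun h n => (hle n v).trans h, fun h => ?_⟩⟩
  refine le_of_forall_pos_le_add fun δ hδ => ?_
  obtain ⟨n, hn⟩ := (TopologicalSpace.denseRange_denseSeq E).exists_dist_lt v (half_pos hδ)
  set b := TopologicalSpace.denseSeq E n
  rw [dist_eq_norm] at hn
  have h2 := hle n (v - b)
  have h3 := h n
  have h4 : f n b = ‖b‖ := by simpa using hf2 n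
  have h5 : ‖v‖ ≤ ‖v - b‖ + ‖b‖ := by simpa using norm_add_le (v - b) b
  rw [map_sub, h4] at h2
  linarith [(abs_le.1 h2).1, (abs_le.1 h3).2]

lemma exists_rho {E : Type*} [NormedAddCommGroup E] [NormedSpace ℝ E] [TopologicalSpace.SeparableSpace E]
    (P : ℕ → X →L[ℝ] E) (m : ℕ) (ε : ℝ) (hε : 0 < ε) : ∃ ρ : X → ℝ, DB ρ ∧ (∀ x, 0 ≤ ρ x) ∧
    (∀ x, ρ x ≤ 1) ∧ ∀ x, ρ x = 0 ↔ ∀ k ≥ m, ‖P k x - P m x‖ ≤ ε := by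
  obtain ⟨f, hf⟩ := exists_norming E
  obtain ⟨ρ, h1, h2, h3, h4⟩ := exists_rho_family (fun i => (f i.unpair.1).comp (P (m + i.unpair.2) - P m)) ε hε
  refine ⟨ρ, h1, h2, h3, fun x => ?_⟩
  rw [h4]
  constructor
  · intro h k hk
    rw [hf]
    intro n
    have := h (Nat.pair n (k - m))
    simpa [Nat.add_sub_cancel' hk] using this
  · intro h i
    have := (hf _ _).1 (h (m + i.unpair.2) (by omega)) i.unpair.1
    simpa using this
end ApproxLp


namespace ApproxLp
set_option linter.unusedSectionVars false

section kernel
variable {K : Type*} [MetricSpace K] [CompactSpace K] [MeasurableSpace K] [BorelSpace K]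
variable {V : Type*} [NormedAddCommGroup V] [NormedSpace ℝ V] [CompleteSpace V]
  [SecondCountableTopology V]

/-- hat kernel -/
noncomputable def ker (m : ℕ) (t s : K) : ℝ := max 0 (1 - ((m:ℝ)+1) * dist t s)

lemma ker_nonneg (m : ℕ) (t s : K) : 0 ≤ ker m t s := le_max_left _ _
lemma ker_le_one (m : ℕ) (t s : K) : ker m t s ≤ 1 :=
  max_le zero_le_one (by have : 0 ≤ ((m:ℝ)+1) * dist t s := by positivity
                         linarith)
lemma ker_cont (m : ℕ) : Continuous (fun p : K × K => ker m p.1 p.2) := by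
  unfold ker; fun_prop
lemma ker_cont1 (m : ℕ) (s : K) : Continuous (fun t : K => ker m t s) := by
  unfold ker; fun_prop
lemma ker_cont2 (m : ℕ) (t : K) : Continuous (fun s : K => ker m t s) := by
  unfold ker; fun_prop
lemma ker_zero (m : ℕ) (t s : K) (h : 1 / ((m:ℝ)+1) ≤ dist t s) : ker m t s = 0 := by
  refine max_eq_left ?_
  rw [div_le_iff₀ (by positivity)] at h
  linarith

variable (μ : Measure K) [IsFiniteMeasure μ] 

lemma ker_int (m : ℕ) (t : K) {f : K → V} (hf : Integrable f μ) : Integrable (fun s => ker m t s • f s) μ := by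
  refine hf.mono ?_ (Eventually.of_forall fun s => ?_)
  · exact (ker_cont2 m t).measurable.aestronglyMeasurable.smul hf.aestronglyMeasurable
  · rw [norm_smul, Real.norm_eq_abs, abs_of_nonneg (ker_nonneg _ _ _)]
    exact mul_le_of_le_one_left (norm_nonneg _) (ker_le_one _ _ _)

lemma ker_num_cont (m : ℕ) {f : K → V} (hf : Integrable f μ) :
    Continuous (fun t => ∫ s, ker m t s • f s ∂μ) := by
  refine continuous_of_dominated (bound := fun s => ‖f s‖) (fun t => (ker_int μ m t hf).aestronglyMeasurable)
    (fun t => Eventually.of_forall fun s => ?_) hf.norm (Eventually.of_forall fun s => ?_)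
  · rw [norm_smul, Real.norm_eq_abs, abs_of_nonneg (ker_nonneg _ _ _)]
    exact mul_le_of_le_one_left (norm_nonneg _) (ker_le_one _ _ _)
  · exact (ker_cont1 m s).smul continuous_const

noncomputable def den (m : ℕ) (t : K) : ℝ := ∫ s, ker m t s ∂μ

lemma den_int (m : ℕ) (t : K) : Integrable (fun s => ker m t s) μ := by
  simpa using ker_int μ m t (integrable_const (1:ℝ))

lemma den_cont (m : ℕ) : Continuous (den μ m) := by
  have := ker_num_cont μ m (integrable_const (1:ℝ))
  simp only [smul_eq_mul, mul_one] at this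
  exact this

lemma den_pos [μ.IsOpenPosMeasure] (m : ℕ) (t : K) : 0 < den μ m t := by
  refine integral_pos_of_integrable_nonneg_nonzero (ker_cont2 m t) (den_int μ m t)
    (fun s => ker_nonneg _ _ _) (x := t) ?_
  simp [ker]

lemma lp_int (f : Lp V 2 μ) : Integrable f μ := (Lp.memLp f).integrable (by norm_num)

lemma lp_bound : ∃ C : ℝ, 0 ≤ C ∧ ∀ f : Lp V 2 μ, ∫ s, ‖f s‖ ∂μ ≤ C * ‖f‖ := by
  refine ⟨(μ Set.univ ^ ((1:ℝ) / (1:ENNReal).toReal - 1 / (2:ENNReal).toReal)).toReal, ENNReal.toReal_nonneg, fun f => ?_⟩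
  have h1 := eLpNorm_le_eLpNorm_mul_rpow_measure_univ (μ := μ) (p := 1) (q := 2) (by norm_num)
    (Lp.memLp f).aestronglyMeasurable
  rw [eLpNorm_one_eq_lintegral_enorm, ← ofReal_integral_norm_eq_lintegral_enorm (lp_int μ f)] at h1
  have hfin : eLpNorm f 2 μ * μ Set.univ ^ ((1:ℝ) / (1:ENNReal).toReal - 1 / (2:ENNReal).toReal) ≠ ⊤ := by
    refine ENNReal.mul_ne_top (Lp.memLp f).eLpNorm_ne_top (ENNReal.rpow_ne_top_of_nonneg (by norm_num) (measure_ne_top _ _))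
  have h2 := ENNReal.toReal_mono hfin h1
  rw [ENNReal.toReal_ofReal (integral_nonneg fun _ => norm_nonneg _), ENNReal.toReal_mul] at h2
  rw [mul_comm]
  exact h2

theorem exists_P [μ.IsOpenPosMeasure] : ∃ P : ℕ → Lp V 2 μ →L[ℝ] C(K, V),
    ∀ h : C(K, V), Tendsto (fun m => P m (ContinuousMap.toLp 2 μ ℝ h)) atTop (nhds h) := by
  obtain ⟨C, hC0, hC⟩ := lp_bound (V := V) μ
  have hinv : ∀ m, Continuous (fun t => (den μ m t)⁻¹) := fun m =>
    (den_cont μ m).inv₀ (fun t => (den_pos μ m t).ne')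
  have hbd : ∀ m, ∃ B : ℝ, 0 ≤ B ∧ ∀ t, (den μ m t)⁻¹ ≤ B := fun m => by
    obtain ⟨B, hB⟩ := isCompact_univ.exists_bound_of_continuousOn (hinv m).continuousOn
    refine ⟨max B 0, le_max_right _ _, fun t => ?_⟩
    exact ((le_abs_self _).trans (hB t (Set.mem_univ t))).trans (le_max_left _ _)
  choose B hB0 hB using hbd
  let P0 : ℕ → Lp V 2 μ →ₗ[ℝ] C(K, V) := fun m =>
    { toFun := fun f => ⟨fun t => (den μ m t)⁻¹ • ∫ s, ker m t s • f s ∂μ,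
        (hinv m).smul (ker_num_cont μ m (lp_int μ f))⟩
      map_add' := fun f g => by
        ext1 t
        simp only [ContinuousMap.coe_mk, ContinuousMap.add_apply]
        rw [← smul_add, ← integral_add (ker_int μ m t (lp_int μ f)) (ker_int μ m t (lp_int μ g))]
        congr 1
        refine integral_congr_ae ?_
        filter_upwards [Lp.coeFn_add f g] with s hs
        rw [hs, Pi.add_apply, smul_add]
      map_smul' := fun c f => by
        ext1 t
        simp only [ContinuousMap.coe_mk, ContinuousMap.smul_apply, RingHom.id_apply]
        rw [smul_comm c, ← integral_smul c]
        congr 1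
        refine integral_congr_ae ?_
        filter_upwards [Lp.coeFn_smul c f] with s hs
        rw [hs, Pi.smul_apply, smul_comm] }
  let P : ℕ → Lp V 2 μ →L[ℝ] C(K, V) := fun m => (P0 m).mkContinuous (B m * C) (fun f => by
    rw [ContinuousMap.norm_le _ (by have := hB0 m; positivity)]
    intro t
    change ‖(den μ m t)⁻¹ • ∫ s, ker m t s • f s ∂μ‖ ≤ _
    rw [norm_smul, Real.norm_eq_abs, abs_of_pos (inv_pos.2 (den_pos μ m t)), mul_assoc]
    refine mul_le_mul (hB m t) ?_ (norm_nonneg _) (hB0 m)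
    refine (norm_integral_le_integral_norm _).trans (le_trans ?_ (hC f))
    refine integral_mono (ker_int μ m t (lp_int μ f)).norm (lp_int μ f).norm fun s => ?_
    simp only
    rw [norm_smul, Real.norm_eq_abs, abs_of_nonneg (ker_nonneg _ _ _)]
    exact mul_le_of_le_one_left (norm_nonneg _) (ker_le_one _ _ _))
  have hP : ∀ m f t, P m f t = (den μ m t)⁻¹ • ∫ s, ker m t s • f s ∂μ := fun m f t => rfl
  refine ⟨P, fun h => ?_⟩
  rw [Metric.tendsto_atTop]
  intro e he
  have huc := CompactSpace.uniformContinuous_of_continuous h.continuous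
  obtain ⟨δ, hδ, hd⟩ := Metric.uniformContinuous_iff.1 huc (e/2) (by positivity)
  obtain ⟨N, hN⟩ := exists_nat_one_div_lt hδ
  refine ⟨N, fun m hm => ?_⟩
  rw [dist_eq_norm]
  refine lt_of_le_of_lt ?_ (half_lt_self he)
  rw [ContinuousMap.norm_le _ (by positivity)]
  intro t
  rw [ContinuousMap.sub_apply, hP]
  have hintg : Integrable h μ := (lp_int μ (ContinuousMap.toLp 2 μ ℝ h)).congr (ContinuousMap.coeFn_toLp (𝕜 := ℝ) μ h)
  have e1 : ∫ s, ker m t s • (ContinuousMap.toLp 2 μ ℝ h) s ∂μ = ∫ s, ker m t s • h s ∂μ := by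
    refine integral_congr_ae ?_
    filter_upwards [ContinuousMap.coeFn_toLp (𝕜 := ℝ) μ h (p := 2)] with s hs
    rw [hs]
  have hpos := den_pos μ m t
  have e2 : (den μ m t)⁻¹ • ∫ s, ker m t s • (ContinuousMap.toLp 2 μ ℝ h) s ∂μ - h t =
      (den μ m t)⁻¹ • ∫ s, ker m t s • (h s - h t) ∂μ := by
    have : ∫ s, ker m t s • (h s - h t) ∂μ = ∫ s, ker m t s • h s ∂μ - den μ m t • h t := by
      simp only [smul_sub]
      rw [integral_sub (ker_int μ m t hintg) (ker_int μ m t (integrable_const _)), integral_smul_const]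
      rfl
    rw [e1, this, smul_sub, inv_smul_smul₀ hpos.ne']
  rw [e2, norm_smul, Real.norm_eq_abs, abs_of_pos (inv_pos.2 hpos), inv_mul_le_iff₀ hpos, mul_comm]
  unfold den
  rw [← integral_const_mul]
  refine (norm_integral_le_integral_norm _).trans ?_
  refine integral_mono (ker_int μ m t (hintg.sub (integrable_const _))).norm ((den_int μ m t).const_mul _) fun s => ?_
  simp only
  rw [norm_smul, Real.norm_eq_abs, abs_of_nonneg (ker_nonneg _ _ _), mul_comm]
  by_cases hs : 1 / ((m:ℝ)+1) ≤ dist t s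
  · rw [ker_zero m t s hs]; simp
  · refine mul_le_mul_of_nonneg_right ?_ (ker_nonneg _ _ _)
    rw [← dist_eq_norm]
    refine (hd ?_).le
    rw [dist_comm]
    refine (not_le.1 hs).trans (lt_of_le_of_lt ?_ hN)
    have : (N:ℝ) ≤ m := by exact_mod_cast hm
    gcongr
end kernel

lemma icc_openPos (T : ℝ) (hT : 0 < T) : (volume : Measure (Set.Icc (0:ℝ) T)).IsOpenPosMeasure := by
  constructor
  rintro U hU ⟨⟨x, hx⟩, hxU⟩ h0
  obtain ⟨W, hW, rfl⟩ := isOpen_induced_iff.1 hU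
  have h1 := (MeasurableEmbedding.subtype_coe (measurableSet_Icc (a := (0:ℝ)) (b := T))).comap_apply volume ((↑) ⁻¹' W)
  rw [Subtype.image_preimage_coe, Set.inter_comm] at h1
  rw [show Measure.comap _ volume (Subtype.val ⁻¹' W) = 0 from h0] at h1
  have hc : x ∈ closure (Set.Ioo 0 T) := by rw [closure_Ioo hT.ne]; exact hx
  obtain ⟨z, hz1, hz2⟩ := mem_closure_iff.1 hc W hW hxU
  have h2 : 0 < volume (W ∩ Set.Ioo 0 T) := (hW.inter isOpen_Ioo).measure_pos _ ⟨z, hz1, hz2⟩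
  have h3 : volume (W ∩ Set.Ioo 0 T) ≤ volume (W ∩ Set.Icc 0 T) :=
    measure_mono (Set.inter_subset_inter_right _ Set.Ioo_subset_Icc_self)
  rw [← h1] at h3
  exact absurd h2 (not_lt.2 h3)
end ApproxLp


namespace ApproxLp
variable {X : Type*} [NormedAddCommGroup X] [NormedSpace ℝ X]

lemma exists_level (p : ℕ → Prop) (hp : ∀ i j, i ≤ j → p j → p i) (m : ℕ) :
    ∃ J ≤ m, (∀ j < J, p j) ∧ ∀ j, J ≤ j → j < m → ¬ p j := by
  induction m with
  | zero => exact ⟨0, le_rfl, fun j hj => absurd hj (Nat.not_lt_zero _), fun j _ hj => absurd hj (Nat.not_lt_zero _)⟩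
  | succ m ih =>
    by_cases h : p m
    · exact ⟨m+1, le_rfl, fun j hj => hp j m (by omega) h, fun j h1 h2 => by omega⟩
    · obtain ⟨J, h1, h2, h3⟩ := ih
      refine ⟨J, by omega, h2, fun j h4 h5 => ?_⟩
      rcases Nat.lt_succ_iff_lt_or_eq.1 h5 with h6 | rfl
      · exact h3 j h4 h6
      · exact h

theorem assembly {E : Type*} [NormedAddCommGroup E] [NormedSpace ℝ E] [TopologicalSpace.SeparableSpace E]
    (P : ℕ → X →L[ℝ] E) (ι : E →L[ℝ] X) (hP : ∀ h, Tendsto (fun m => P m (ι h)) atTop (nhds h))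
    (φ : E → ℝ) (hbdd : ∃ M, ∀ h, |φ h| ≤ M) (hdiff : Differentiable ℝ φ) (hDbdd : ∃ M, ∀ h, ‖fderiv ℝ φ h‖ ≤ M) :
    ∃ φn : ℕ → X → ℝ, (∀ n, (∃ M, ∀ x, |φn n x| ≤ M) ∧ Differentiable ℝ (φn n) ∧ ∃ M, ∀ x, ‖fderiv ℝ (φn n) x‖ ≤ M) ∧
      (∀ h, Tendsto (fun n => φn n (ι h)) atTop (nhds (φ h))) ∧
      (∀ h η, Tendsto (fun n => fderiv ℝ (φn n) (ι h) (ι η)) atTop (nhds (fderiv ℝ φ h η))) := by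
  obtain ⟨M, hM⟩ := hbdd
  obtain ⟨L, hL⟩ := hDbdd
  have hL0 : 0 ≤ L := (norm_nonneg _).trans (hL 0)
  obtain ⟨G, hGd, hGL, hGc, hGm⟩ := mollify hdiff hL
  have hρex := fun (m j : ℕ) => exists_rho P m (1 / (((j+1:ℕ):ℝ)+1)) (by positivity)
  choose ρ hρ hρ0 hρ1 hρz using hρex
  have hGP : ∀ j m x, HasFDerivAt (fun x => G j (P m x)) ((fderiv ℝ (G j) (P m x)).comp (P m)) x := fun j m x =>
    (hGd j (P m x)).hasFDerivAt.comp x (P m).hasFDerivAt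
  have hGDB : ∀ j m, DB (fun x => G j (P m x)) := fun j m => ⟨fun x => (hGP j m x).differentiableAt, L * ‖P m‖, fun x => by
    rw [(hGP j m x).fderiv]
    exact (ContinuousLinearMap.opNorm_comp_le _ _).trans (mul_le_mul_of_nonneg_right (hGL _ _) (norm_nonneg _))⟩
  let u : ℕ → ℕ → X → ℝ := fun m j x => G (j+1) (P m x) - G j (P m x)
  have hu : ∀ m j x, HasFDerivAt (u m j) ((fderiv ℝ (G (j+1)) (P m x)).comp (P m) - (fderiv ℝ (G j) (P m x)).comp (P m)) x :=
    fun m j x => (hGP (j+1) m x).sub (hGP j m x)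
  have huDB : ∀ m j, DB (u m j) := fun m j => by
    have := (hGDB (j+1) m).add ((hGDB j m).const_mul (-1))
    have e : u m j = fun x => G (j+1) (P m x) + (-1) * G j (P m x) := by funext x; simp only [u]; ring
    rw [e]; exact this
  obtain ⟨y, hy, hyu, hyd⟩ := tool (fun N => fun x => ((N.unpair.1:ℝ)+1) * u N.unpair.1 N.unpair.2 x)
    (fun N => (huDB _ _).const_mul _) (fun N => ρ N.unpair.1 N.unpair.2) (fun N => hρ _ _) (fun N => hρ0 _ _)
    (fun N => hρ1 _ _) (fun N => 1 / ((N.unpair.1:ℝ)+1)) (fun N => by positivity)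
  let Y : ℕ → ℕ → X → ℝ := fun m j x => (1 / ((m:ℝ)+1)) * y (Nat.pair m j) x
  have hY : ∀ m j, DB (Y m j) := fun m j => (hy _).const_mul _
  have hYu : ∀ m j x, |Y m j x - u m j x| ≤ (1 / ((m:ℝ)+1) * (1 / ((m:ℝ)+1))) * ρ m j x := fun m j x => by
    have := hyu (Nat.pair m j) x
    simp only [Nat.unpair_pair] at this
    have e : Y m j x - u m j x = (1 / ((m:ℝ)+1)) * (y (Nat.pair m j) x - ((m:ℝ)+1) * u m j x) := by
      simp only [Y]; field_simp
    rw [e, abs_mul, abs_of_pos (by positivity), mul_assoc]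
    gcongr
  have hYd : ∀ x, ∀ e > 0, ∀ᶠ m in atTop, ∀ j, 0 < ρ m j x → ‖fderiv ℝ (Y m j) x‖ ≤ (1 / ((m:ℝ)+1)) * e := by
    intro x e he
    obtain ⟨N0, hN0⟩ := eventually_atTop.1 (hyd x e he)
    filter_upwards [eventually_ge_atTop N0] with m hm j hj
    have h1 := hN0 (Nat.pair m j) (hm.trans (Nat.left_le_pair m j))
    simp only [Nat.unpair_pair] at h1
    have h2 : HasFDerivAt (Y m j) ((1 / ((m:ℝ)+1)) • fderiv ℝ (y (Nat.pair m j)) x) x :=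
      ((hy (Nat.pair m j)).1 x).hasFDerivAt.const_mul _
    rw [h2.fderiv, norm_smul, Real.norm_eq_abs, abs_of_pos (by positivity)]
    exact mul_le_mul_of_nonneg_left (h1 hj) (by positivity)
  let Φ : ℕ → X → ℝ := fun m x => G 0 (P m x) + ∑ j ∈ Finset.range m, Y m j x
  have hΦ : ∀ m x, HasFDerivAt (Φ m) ((fderiv ℝ (G 0) (P m x)).comp (P m) + ∑ j ∈ Finset.range m, fderiv ℝ (Y m j) x) x :=
    fun m x => (hGP 0 m x).add (HasFDerivAt.fun_sum fun j _ => ((hY m j).1 x).hasFDerivAt)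
  have hΦc : ∀ m x, |Φ m x - G m (P m x)| ≤ 1 / ((m:ℝ)+1) := fun m x => by
    have e : Φ m x - G m (P m x) = ∑ j ∈ Finset.range m, (Y m j x - u m j x) := by
      have := Finset.sum_range_sub (fun j => G j (P m x)) m
      rw [Finset.sum_sub_distrib]
      simp only [u, this, Φ]; ring
    rw [e]
    refine (Finset.abs_sum_le_sum_abs _ _).trans ((Finset.sum_le_card_nsmul _ _ (1 / ((m:ℝ)+1) * (1 / ((m:ℝ)+1))) fun j _ =>
      (hYu m j x).trans (mul_le_of_le_one_right (by positivity) (hρ1 _ _ _))).trans ?_)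
    rw [Finset.card_range, nsmul_eq_mul, ← mul_assoc]
    refine mul_le_of_le_one_left (by positivity) ?_
    rw [mul_one_div, div_le_one (by positivity)]
    linarith
  refine ⟨Φ, fun m => ⟨⟨1 / ((m:ℝ)+1) + (L * (1 / ((m:ℝ)+1)) + M), fun x => ?_⟩, fun x => (hΦ m x).differentiableAt, ?_⟩,
    fun h => ?_, fun h η => ?_⟩
  · have h1 := abs_le.1 (hΦc m x)
    have h2 := abs_le.1 (hGc m (P m x))
    have h3 := abs_le.1 (hM (P m x))
    rw [abs_le]; constructor <;> linarith [h1.1, h1.2, h2.1, h2.2, h3.1, h3.2]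
  · obtain ⟨-, M0, hM0⟩ := hGDB 0 m
    choose M1 hM1 using fun j => (hY m j).2
    refine ⟨M0 + ∑ j ∈ Finset.range m, M1 j, fun x => ?_⟩
    rw [(hΦ m x).fderiv]
    refine (norm_add_le _ _).trans (add_le_add ?_ ?_)
    · rw [← (hGP 0 m x).fderiv]; exact hM0 x
    · exact norm_sum_le_of_le _ fun j _ => hM1 j x
  · have t1 : Tendsto (fun m : ℕ => 1 / ((m:ℝ)+1)) atTop (nhds 0) := tendsto_one_div_add_atTop_nhds_zero_nat
    have t2 : Tendsto (fun m => φ (P m (ι h))) atTop (nhds (φ h)) := (hdiff.continuous.tendsto h).comp (hP h)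
    have t3 : Tendsto (fun m => Φ m (ι h) - φ (P m (ι h))) atTop (nhds 0) := by
      have t4 : Tendsto (fun m : ℕ => 1 / ((m:ℝ)+1) + L * (1 / ((m:ℝ)+1))) atTop (nhds 0) := by
        simpa using t1.add (t1.const_mul L)
      refine squeeze_zero_norm (fun m => ?_) t4
      have h1 := abs_le.1 (hΦc m (ι h))
      have h2 := abs_le.1 (hGc m (P m (ι h)))
      rw [Real.norm_eq_abs, abs_le]; constructor <;> linarith [h1.1, h1.2, h2.1, h2.2]
    simpa using t3.add t2
  · have hlev := fun m => exists_level (fun j => ρ m j (ι h) = 0) (fun i j hij hj => by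
      rw [hρz] at hj ⊢
      intro k hk
      refine (hj k hk).trans ?_
      have : (i:ℝ) ≤ j := by exact_mod_cast hij
      push_cast
      gcongr) m
    choose J hJm hJz hJp using hlev
    have hJtop : ∀ j0, ∀ᶠ m in atTop, j0 ≤ J m := by
      intro j0
      have hpos : 0 < 1 / (((j0+1:ℕ):ℝ)+1) := by positivity
      obtain ⟨N, hN⟩ := Metric.cauchySeq_iff.1 (hP h).cauchySeq _ hpos
      filter_upwards [eventually_ge_atTop N, eventually_gt_atTop j0] with m h1 h2
      by_contra hlt
      refine hJp m j0 (by omega) h2 ?_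
      rw [hρz]
      intro k hk
      rw [← dist_eq_norm]
      exact (hN k (h1.trans hk) m h1).le
    have hclose : ∀ m, 0 < J m → ‖P m (ι h) - h‖ ≤ 1 / ((J m:ℝ)+1) := by
      intro m hm
      have h1 := hJz m (J m - 1) (by omega)
      rw [hρz, Nat.sub_add_cancel hm] at h1
      have t : Tendsto (fun k => ‖P k (ι h) - P m (ι h)‖) atTop (nhds ‖h - P m (ι h)‖) := ((hP h).sub_const _).norm
      rw [norm_sub_rev]
      refine le_of_tendsto t ?_
      filter_upwards [eventually_ge_atTop m] with k hk
      exact h1 k hk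
    have hform : ∀ m, fderiv ℝ (Φ m) (ι h) (ι η) = fderiv ℝ (G (J m)) (P m (ι h)) (P m (ι η)) +
        ∑ j ∈ Finset.Ico (J m) m, fderiv ℝ (Y m j) (ι h) (ι η) := by
      intro m
      rw [(hΦ m (ι h)).fderiv]
      simp only [ContinuousLinearMap.add_apply, ContinuousLinearMap.comp_apply, ContinuousLinearMap.sum_apply]
      rw [Finset.range_eq_Ico, ← Finset.sum_Ico_consecutive _ (Nat.zero_le _) (hJm m), ← Finset.range_eq_Ico]
      have : ∑ j ∈ Finset.range (J m), fderiv ℝ (Y m j) (ι h) (ι η) = ∑ j ∈ Finset.range (J m),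
          (fderiv ℝ (G (j+1)) (P m (ι h)) (P m (ι η)) - fderiv ℝ (G j) (P m (ι h)) (P m (ι η))) := by
        refine Finset.sum_congr rfl fun j hj => ?_
        rw [fderiv_eq_of_rho_zero (huDB m j).1 (hY m j).1 (hρ m j).1 (hρ0 m j) (hYu m j) (hJz m j (Finset.mem_range.1 hj)),
          (hu m j (ι h)).fderiv]
        rfl
      rw [this, Finset.sum_range_sub (fun j => fderiv ℝ (G j) (P m (ι h)) (P m (ι η)))]
      ring
    rw [Metric.tendsto_nhds]
    intro r hr
    have hden : 0 < ‖ι η‖ + L + 1 := by positivity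
    set e := r / (2 * (‖ι η‖ + L + 1)) with he_def
    have he : 0 < e := by positivity
    have hee : e * ‖ι η‖ + L * e + e = r / 2 := by rw [he_def]; field_simp
    obtain ⟨J0, hJ0⟩ := hGm h η e he
    have hη : ∀ᶠ m in atTop, ‖P m (ι η) - η‖ < e := by
      filter_upwards [Metric.tendsto_nhds.1 (hP η) e he] with m hm
      rwa [dist_eq_norm] at hm
    filter_upwards [hJtop (J0+1), hη, hYd (ι h) e he] with m h1 h2 h3
    rw [Real.dist_eq, hform]
    have a1 := hJ0 (J m) (by omega) (P m (ι h)) (hclose m (by omega))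
    have a2 : |fderiv ℝ (G (J m)) (P m (ι h)) (P m (ι η) - η)| ≤ L * e :=
      (ContinuousLinearMap.le_opNorm _ _).trans (mul_le_mul (hGL _ _) h2.le (norm_nonneg _) hL0)
    have a3 : |∑ j ∈ Finset.Ico (J m) m, fderiv ℝ (Y m j) (ι h) (ι η)| ≤ e * ‖ι η‖ := by
      refine (Finset.abs_sum_le_sum_abs _ _).trans ((Finset.sum_le_card_nsmul _ _ (((1 / ((m:ℝ)+1)) * e) * ‖ι η‖) fun j hj => ?_).trans ?_)
      · rw [Finset.mem_Ico] at hj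
        have := h3 j (lt_of_le_of_ne (hρ0 m j _) (Ne.symm (hJp m j hj.1 hj.2)))
        exact (ContinuousLinearMap.le_opNorm _ _).trans (mul_le_mul_of_nonneg_right this (norm_nonneg _))
      · rw [Nat.card_Ico, nsmul_eq_mul]
        have hc : ((m - J m : ℕ):ℝ) ≤ (m:ℝ) + 1 := by
          have : m - J m ≤ m + 1 := by omega
          exact_mod_cast this
        calc ((m - J m : ℕ):ℝ) * (((1 / ((m:ℝ)+1)) * e) * ‖ι η‖) ≤ ((m:ℝ)+1) * (((1 / ((m:ℝ)+1)) * e) * ‖ι η‖) := by gcongr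
          _ = e * ‖ι η‖ := by field_simp
    rw [map_sub] at a2
    have b1 := abs_le.1 a1
    have b2 := abs_le.1 a2
    have b3 := abs_le.1 a3
    rw [abs_lt]
    constructor <;> linarith [b1.1, b1.2, b2.1, b2.2, b3.1, b3.2]
end ApproxLp


/-- Smooth cylindrical approximation: a bounded Fréchet differentiable function with bounded
derivative on `E = C([0,T];ℝ^d)` is the pointwise limit, together with its directional
derivatives along directions from `E`, of bounded Fréchet differentiable functions with bounded
derivatives on `X = L²(0,T;ℝ^d)`. -/
theorem approximation_on_Lp (d : ℕ) (hd : 1 ≤ d) (T : ℝ) (hT : 0 < T)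
    (φ : C(Set.Icc (0:ℝ) T, EuclideanSpace ℝ (Fin d)) → ℝ)
    (hbdd : ∃ M, ∀ h, |φ h| ≤ M)
    (hdiff : Differentiable ℝ φ)
    (hDbdd : ∃ M, ∀ h, ‖fderiv ℝ φ h‖ ≤ M) :
    ∃ φn : ℕ → Lp (EuclideanSpace ℝ (Fin d)) 2
        (volume : Measure (Set.Icc (0:ℝ) T)) → ℝ,
      (∀ n, (∃ M, ∀ x, |φn n x| ≤ M) ∧ Differentiable ℝ (φn n) ∧
          ∃ M, ∀ x, ‖fderiv ℝ (φn n) x‖ ≤ M) ∧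
      (∀ h, Tendsto (fun n => φn n (ContinuousMap.toLp 2 volume ℝ h)) atTop (nhds (φ h))) ∧
      (∀ h η, Tendsto
          (fun n => fderiv ℝ (φn n) (ContinuousMap.toLp 2 volume ℝ h)
            (ContinuousMap.toLp 2 volume ℝ η))
          atTop (nhds (fderiv ℝ φ h η))) := by
  haveI := ApproxLp.icc_openPos T hT
  obtain ⟨P, hP⟩ := ApproxLp.exists_P (V := EuclideanSpace ℝ (Fin d)) (volume : Measure (Set.Icc (0:ℝ) T))
  exact ApproxLp.assembly P (ContinuousMap.toLp 2 volume ℝ) hP φ hbdd hdiff hDbdd
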